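/- arXiv:1610.03694 — 2 statements merged into one kernel-verified Lean document; each statement's English description precedes it below -/
import Mathlib

section
/- Law of large numbers for the second-derivative term: Fix (H,σ) ∈ (0,1)×(0,∞) and any sequence Δ_n > 0. Under P^n_{(H,σ)}, E_n → e_H = (1/(4π)) ∫_{−π}^{π} |∂_H log f_H(λ)|² dλ in probability as n → ∞. -/
open MeasureTheory Filter Topology Matrix

noncomputable section

/-- Covariance matrix `T_n(H)` of a standard fractional Gaussian noise: its `(i,j)` entry is
`(|i-j+1|^{2H} - 2|i-j|^{2H} + |i-j-1|^{2H})/2`. -/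
def fgnT (n : ℕ) (H : ℝ) : Matrix (Fin n) (Fin n) ℝ := fun i j =>
  (|((i : ℕ) : ℝ) - ((j : ℕ) : ℝ) + 1| ^ (2 * H)
      - 2 * |((i : ℕ) : ℝ) - ((j : ℕ) : ℝ)| ^ (2 * H)
      + |((i : ℕ) : ℝ) - ((j : ℕ) : ℝ) - 1| ^ (2 * H)) / 2

/-- Quadratic form `⟨x, M x⟩`. -/
def qForm {n : ℕ} (M : Matrix (Fin n) (Fin n) ℝ) (x : Fin n → ℝ) : ℝ :=
  ∑ i, ∑ j, x i * M i j * x j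

/-- Centered Gaussian measure on `ℝⁿ` with nondegenerate covariance matrix `S`, given by its
density with respect to Lebesgue measure. -/
def gaussianPi (n : ℕ) (S : Matrix (Fin n) (Fin n) ℝ) : Measure (Fin n → ℝ) :=
  volume.withDensity fun x => ENNReal.ofReal
    ((2 * Real.pi) ^ (-(n : ℝ) / 2) * S.det ^ (-(1 : ℝ) / 2) *
      Real.exp (-(qForm S⁻¹ x) / 2))

/-- The law `Pⁿ_{(H,σ)}` of fractional Gaussian noise observed with time step `Δ`:
a centered Gaussian measure on `ℝⁿ` with covariance `σ² Δ^{2H} T_n(H)`. -/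
def fgnP (n : ℕ) (Δ H σ : ℝ) : Measure (Fin n → ℝ) :=
  gaussianPi n ((σ ^ 2 * Δ ^ (2 * H)) • fgnT n H)

/-- Spectral density `f_H` of the increments of fractional Brownian motion. -/
def fgnSpec (H l : ℝ) : ℝ :=
  (Real.Gamma (2 * H + 1) * Real.sin (Real.pi * H) / (2 * Real.pi)) *
    (2 * (1 - Real.cos l)) * ∑' k : ℤ, |l + 2 * (k : ℝ) * Real.pi| ^ (-2 * H - 1)

/-- `∂_H log f_H(λ)`. -/
def dlogSpec (H l : ℝ) : ℝ := deriv (fun h : ℝ => Real.log (fgnSpec h l)) H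

/-- `j_H = -(1/(2π)) ∫_{-π}^{π} ∂_H log f_H(λ) dλ`. -/
def jH (H : ℝ) : ℝ := -(1 / (2 * Real.pi)) * ∫ l in (-Real.pi)..Real.pi, dlogSpec H l

/-- `e_H = (1/(4π)) ∫_{-π}^{π} |∂_H log f_H(λ)|² dλ`. -/
def eH (H : ℝ) : ℝ := (1 / (4 * Real.pi)) * ∫ l in (-Real.pi)..Real.pi, (dlogSpec H l) ^ 2

/-- The limit covariance matrix `J(H)` of `(A_n, B_n)`. -/
def Jmat (H : ℝ) : Matrix (Fin 2) (Fin 2) ℝ := !![2, jH H; jH H, eH H]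

/-- Log-likelihood `ℓ_n(H,σ)` of the fGn sample. -/
def loglik (n : ℕ) (Δ H σ : ℝ) (x : Fin n → ℝ) : ℝ :=
  -(n : ℝ) / 2 * Real.log (2 * Real.pi) - (n : ℝ) * H * Real.log Δ - (n : ℝ) * Real.log σ
    - Real.log (fgnT n H).det / 2
    - qForm (fgnT n H)⁻¹ x / (2 * σ ^ 2 * Δ ^ (2 * H))

/-- `C_n = (1/(nσ²Δ^{2H})) ⟨x, T_n(H)⁻¹ x⟩`. -/
def Cstat (n : ℕ) (Δ H σ : ℝ) (x : Fin n → ℝ) : ℝ :=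
  qForm (fgnT n H)⁻¹ x / ((n : ℝ) * σ ^ 2 * Δ ^ (2 * H))

/-- `A_n = √n (C_n - 1)`. -/
def Astat (n : ℕ) (Δ H σ : ℝ) (x : Fin n → ℝ) : ℝ :=
  Real.sqrt n * (Cstat n Δ H σ x - 1)

/-- Entrywise derivative in `H` of `T_n(H)⁻¹`. -/
def dInvT (n : ℕ) (H : ℝ) : Matrix (Fin n) (Fin n) ℝ := fun i j =>
  deriv (fun h : ℝ => (fgnT n h)⁻¹ i j) H

/-- Entrywise second derivative in `H` of `T_n(H)⁻¹`. -/
def d2InvT (n : ℕ) (H : ℝ) : Matrix (Fin n) (Fin n) ℝ := fun i j =>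
  deriv (fun h : ℝ => deriv (fun h' : ℝ => (fgnT n h')⁻¹ i j) h) H

/-- Entrywise derivative in `H` of `T_n(H)`. -/
def dT (n : ℕ) (H : ℝ) : Matrix (Fin n) (Fin n) ℝ := fun i j =>
  deriv (fun h : ℝ => fgnT n h i j) H

/-- `B_n = (1/√n) ( (1/2) ∂_H log det T_n(H) + (1/(2σ²Δ^{2H})) ⟨x, ∂_H(T_n(H)⁻¹) x⟩ )`. -/
def Bstat (n : ℕ) (Δ H σ : ℝ) (x : Fin n → ℝ) : ℝ :=
  (1 / Real.sqrt n) *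
    (deriv (fun h : ℝ => Real.log (fgnT n h).det) H / 2
      + qForm (dInvT n H) x / (2 * σ ^ 2 * Δ ^ (2 * H)))

/-- `D_n = (1/(nσ²Δ^{2H})) ⟨x, ∂_H(T_n(H)⁻¹) x⟩`. -/
def Dstat (n : ℕ) (Δ H σ : ℝ) (x : Fin n → ℝ) : ℝ :=
  qForm (dInvT n H) x / ((n : ℝ) * σ ^ 2 * Δ ^ (2 * H))

/-- `E_n = (1/n) ( (1/2) ∂_H² log det T_n(H) + (1/(2σ²Δ^{2H})) ⟨x, ∂_H²(T_n(H)⁻¹) x⟩ )`. -/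
def Estat (n : ℕ) (Δ H σ : ℝ) (x : Fin n → ℝ) : ℝ :=
  (1 / (n : ℝ)) *
    (deriv (fun h : ℝ => deriv (fun h' : ℝ => Real.log (fgnT n h').det) h) H / 2
      + qForm (d2InvT n H) x / (2 * σ ^ 2 * Δ ^ (2 * H)))

/-- Convergence in law (weak convergence of the laws against bounded continuous functions). -/
def TendstoInLaw {E : Type*} [MeasurableSpace E] [TopologicalSpace E]
    (μ : ℕ → Measure E) (ν : Measure E) : Prop :=
  ∀ g : BoundedContinuousFunction E ℝ,
    Tendsto (fun n => ∫ x, g x ∂μ n) atTop (𝓝 (∫ x, g x ∂ν))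

/-- Convergence in law to the centered Gaussian distribution on `ℝᵈ` with covariance matrix `S`,
expressed through the Cramér–Wold device: every linear functional converges in law to the
corresponding one-dimensional centered Gaussian law. -/
def TendstoInLawGaussian {d : ℕ} (μ : ℕ → Measure (Fin d → ℝ))
    (S : Matrix (Fin d) (Fin d) ℝ) : Prop :=
  ∀ t : Fin d → ℝ,
    TendstoInLaw (fun n => (μ n).map fun z => ∑ i, t i * z i)
      (ProbabilityTheory.gaussianReal 0 (qForm S t).toNNReal)

/-- Convergence in probability to a constant, for statistics defined on varying sample spaces. -/
def TendstoInProb {X : ℕ → Type*} [∀ n, MeasurableSpace (X n)]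
    (μ : ∀ n, Measure (X n)) (f : ∀ n, X n → ℝ) (c : ℝ) : Prop :=
  ∀ ε > 0, Tendsto (fun n => μ n {x | ε ≤ |f n x - c|}) atTop (𝓝 0)

/-- The LAN expansion: the likelihood ratio of `P^n_{θ₀ + φ_n u}` with respect to `P^n_{θ₀}`
is `exp(⟨u, ζ_n⟩ - ½⟨I u, u⟩ + r_n(u))` with `ζ_n → N(0, I)` in law and `r_n(u) → 0` in
probability under `P^n_{θ₀}`. -/
def LANExpansion {X : ℕ → Type*} [∀ n, MeasurableSpace (X n)] {d : ℕ}
    (P : (n : ℕ) → (Fin d → ℝ) → Measure (X n)) (θ₀ : Fin d → ℝ)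
    (φ : ℕ → Matrix (Fin d) (Fin d) ℝ) (I : Matrix (Fin d) (Fin d) ℝ) : Prop :=
  ∃ (ζ : (n : ℕ) → X n → Fin d → ℝ) (r : (n : ℕ) → (Fin d → ℝ) → X n → ℝ),
    (∀ n, Measurable (ζ n)) ∧
    TendstoInLawGaussian (fun n => (P n θ₀).map (ζ n)) I ∧
    ∀ u : Fin d → ℝ,
      (∀ᶠ n in atTop,
        P n (θ₀ + (φ n).mulVec u) = (P n θ₀).withDensity fun x =>
          ENNReal.ofReal (Real.exp (∑ i, u i * ζ n x i - qForm I u / 2 + r n u x))) ∧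
      TendstoInProb (fun n => P n θ₀) (fun n => r n u) 0

/-- Local Asymptotic Normality at `θ₀` with nondegenerate rate matrices `φ_n`
and nondegenerate Fisher information matrix `I`. -/
def IsLAN {X : ℕ → Type*} [∀ n, MeasurableSpace (X n)] {d : ℕ}
    (P : (n : ℕ) → (Fin d → ℝ) → Measure (X n)) (θ₀ : Fin d → ℝ)
    (φ : ℕ → Matrix (Fin d) (Fin d) ℝ) (I : Matrix (Fin d) (Fin d) ℝ) : Prop :=
  (∀ᶠ n in atTop, (φ n).det ≠ 0) ∧ I.det ≠ 0 ∧ LANExpansion P θ₀ φ I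

namespace FGN

/-! ### Quadratic forms of Gaussian vectors -/

lemma qForm_eq_dotProduct {n : ℕ} (M : Matrix (Fin n) (Fin n) ℝ) (x : Fin n → ℝ) :
    qForm M x = x ⬝ᵥ (M *ᵥ x) := by
  simp [qForm, dotProduct, mulVec, Finset.mul_sum, mul_assoc]

lemma qForm_mulVec {n : ℕ} (M L : Matrix (Fin n) (Fin n) ℝ) (y : Fin n → ℝ) :
    qForm M (L *ᵥ y) = qForm (Lᵀ * M * L) y := by
  rw [qForm_eq_dotProduct, qForm_eq_dotProduct, ← mulVec_mulVec, ← mulVec_mulVec,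
    dotProduct_mulVec y, vecMul_transpose]

lemma qForm_diagonal {n : ℕ} (d x : Fin n → ℝ) :
    qForm (diagonal d) x = ∑ i, d i * x i ^ 2 := by
  rw [qForm_eq_dotProduct]
  simp only [dotProduct, mulVec_diagonal]
  exact Finset.sum_congr rfl fun i _ => by ring

lemma continuous_qForm {n : ℕ} (M : Matrix (Fin n) (Fin n) ℝ) : Continuous (qForm M) := by
  unfold qForm
  fun_prop

/-- Density of a product of standard Gaussian laws. -/
lemma pi_gaussianReal_eq_withDensity (n : ℕ) :
    Measure.pi (fun _ : Fin n => ProbabilityTheory.gaussianReal 0 1) =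
      volume.withDensity fun x : Fin n → ℝ => ENNReal.ofReal
        (∏ i, ProbabilityTheory.gaussianPDFReal 0 1 (x i)) := by
  symm
  refine (Measure.pi_eq fun s hs => ?_).symm
  symm
  rw [withDensity_apply _ (MeasurableSet.univ_pi hs),
    ← lintegral_indicator (MeasurableSet.univ_pi hs)]
  have h1 : ∀ x : Fin n → ℝ, (Set.univ.pi s).indicator (fun x : Fin n → ℝ => ENNReal.ofReal
        (∏ i, ProbabilityTheory.gaussianPDFReal 0 1 (x i))) x
      = ENNReal.ofReal (∏ i, (s i).indicator (ProbabilityTheory.gaussianPDFReal 0 1) (x i)) := by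
    intro x
    by_cases hx : x ∈ Set.univ.pi s
    · rw [Set.indicator_of_mem hx]
      congr 1
      exact Finset.prod_congr rfl fun i _ => by rw [Set.indicator_of_mem (hx i trivial)]
    · rw [Set.indicator_of_notMem hx]
      simp only [Set.mem_univ_pi, not_forall] at hx
      obtain ⟨i, hi⟩ := hx
      rw [Finset.prod_eq_zero (Finset.mem_univ i) (Set.indicator_of_notMem hi _)]
      simp
  have hint : ∀ i, Integrable ((s i).indicator (ProbabilityTheory.gaussianPDFReal 0 1)) :=
    fun i => (ProbabilityTheory.integrable_gaussianPDFReal 0 1).indicator (hs i)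
  have hnn : ∀ i x, 0 ≤ (s i).indicator (ProbabilityTheory.gaussianPDFReal 0 1) x := fun i x =>
    Set.indicator_nonneg (fun y _ => ProbabilityTheory.gaussianPDFReal_nonneg 0 1 y) x
  simp_rw [h1]
  rw [← ofReal_integral_eq_lintegral_ofReal]
  · rw [integral_fintype_prod_volume_eq_prod
      (fun i x => (s i).indicator (ProbabilityTheory.gaussianPDFReal 0 1) x),
      ENNReal.ofReal_prod_of_nonneg fun i _ => integral_nonneg (hnn i)]
    refine Finset.prod_congr rfl fun i _ => ?_
    rw [ProbabilityTheory.gaussianReal_apply_eq_integral 0 one_ne_zero, integral_indicator (hs i)]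
  · exact Integrable.fintype_prod hint
  · exact ae_of_all _ fun x => Finset.prod_nonneg fun i _ => hnn i _

lemma gaussianPi_eq_map {n : ℕ} (S L : Matrix (Fin n) (Fin n) ℝ) (hL : L.det ≠ 0)
    (hS : S = L * Lᵀ) :
    gaussianPi n S = (Measure.pi fun _ : Fin n => ProbabilityTheory.gaussianReal 0 1).map
      (fun y => L *ᵥ y) := by
  have hLm : Measurable fun y : Fin n → ℝ => L *ᵥ y :=
    (Continuous.matrix_mulVec continuous_const continuous_id).measurable
  have hcan : Lᵀ * S⁻¹ * L = 1 := by
    have hu : IsUnit L.det := isUnit_iff_ne_zero.2 hL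
    have hu' : IsUnit Lᵀ.det := by rwa [det_transpose]
    rw [hS, Matrix.mul_inv_rev, ← Matrix.mul_assoc, Matrix.mul_nonsing_inv _ hu', Matrix.one_mul,
      Matrix.nonsing_inv_mul _ hu]
  have hdet : S.det ^ (-(1 : ℝ) / 2) = |L.det|⁻¹ := by
    rw [hS, det_mul, det_transpose, ← sq, ← sq_abs, ← Real.rpow_natCast,
      ← Real.rpow_mul (abs_nonneg _)]
    norm_num
    exact Real.rpow_neg_one _
  ext A hA
  rw [Measure.map_apply hLm hA, pi_gaussianReal_eq_withDensity, gaussianPi,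
    withDensity_apply _ hA, withDensity_apply _ (hLm hA)]
  have hvol := Real.map_matrix_volume_pi_eq_smul_volume_pi hL
  have hdens : ∀ y : Fin n → ℝ, ∏ i, ProbabilityTheory.gaussianPDFReal 0 1 (y i) =
      (2 * Real.pi) ^ (-(n : ℝ) / 2) * Real.exp (-(qForm S⁻¹ (L *ᵥ y)) / 2) := by
    intro y
    rw [qForm_mulVec, hcan]
    have : qForm (1 : Matrix (Fin n) (Fin n) ℝ) y = ∑ i, y i ^ 2 := by
      rw [← diagonal_one, qForm_diagonal]; simp
    rw [this]
    simp only [ProbabilityTheory.gaussianPDFReal_def, Finset.prod_mul_distrib, Finset.prod_const,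
      ← Real.exp_sum, Finset.card_univ, Fintype.card_fin]
    congr 1
    · rw [NNReal.coe_one, mul_one, Real.sqrt_eq_rpow, ← Real.rpow_neg (by positivity),
        ← Real.rpow_natCast, ← Real.rpow_mul (by positivity)]
      congr 1; ring
    · congr 1
      rw [neg_div, Finset.sum_div, ← Finset.sum_neg_distrib]
      exact Finset.sum_congr rfl fun i _ => by simp [neg_div]
  have hmeas : Measurable fun x : Fin n → ℝ => A.indicator (fun x => ENNReal.ofReal
      ((2 * Real.pi) ^ (-(n : ℝ) / 2) * Real.exp (-(qForm S⁻¹ x) / 2))) x := by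
    refine Measurable.indicator ?_ hA
    have := (continuous_qForm S⁻¹).measurable
    fun_prop
  have key : ∫⁻ y in (fun y : Fin n → ℝ => L *ᵥ y) ⁻¹' A,
      ENNReal.ofReal (∏ i, ProbabilityTheory.gaussianPDFReal 0 1 (y i)) =
      ∫⁻ x, A.indicator (fun x => ENNReal.ofReal
      ((2 * Real.pi) ^ (-(n : ℝ) / 2) * Real.exp (-(qForm S⁻¹ x) / 2))) x
        ∂(Measure.map (toLin' L) volume) := by
    have hLm' : Measurable (toLin' L) := hLm
    rw [lintegral_map hmeas hLm', ← lintegral_indicator (hLm hA)]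
    refine lintegral_congr fun y => ?_
    rw [Set.indicator, Set.indicator]
    simp only [toLin'_apply, hdens]
    rfl
  rw [key, hvol, lintegral_smul_measure, lintegral_indicator hA, smul_eq_mul,
    ← lintegral_const_mul' _ _ ENNReal.ofReal_ne_top]
  refine lintegral_congr fun x => ?_
  rw [← ENNReal.ofReal_mul (abs_nonneg _), hdet, abs_inv]
  congr 1; ring

/-- Variance of the square of a standard Gaussian variable. -/
def varSq : ℝ :=
  ProbabilityTheory.variance (fun x : ℝ => x ^ 2) (ProbabilityTheory.gaussianReal 0 1)

lemma memLp_sq_gaussianReal :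
    MemLp (fun x : ℝ => x ^ 2) 2 (ProbabilityTheory.gaussianReal 0 1) := by
  have h := ProbabilityTheory.memLp_id_gaussianReal' (μ := 0) (v := 1) 4 (by norm_num)
  rw [memLp_two_iff_integrable_sq (by fun_prop)]
  have := h.integrable_norm_pow (p := 4) (by norm_num)
  refine this.congr (ae_of_all _ fun x => ?_)
  simp only [id, Real.norm_eq_abs]
  rw [← pow_mul, pow_abs, abs_of_nonneg (by positivity)]

lemma integral_sq_gaussianReal : ∫ x : ℝ, x ^ 2 ∂(ProbabilityTheory.gaussianReal 0 1) = 1 := by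
  have h := ProbabilityTheory.variance_fun_id_gaussianReal (μ := 0) (v := 1)
  rw [ProbabilityTheory.variance_of_integral_eq_zero (by fun_prop)] at h
  · simpa using h
  · simp [ProbabilityTheory.integral_id_gaussianReal]

open scoped MatrixOrder in
lemma exists_diagonalizing_factor {n : ℕ} {S M : Matrix (Fin n) (Fin n) ℝ} (hS : S.PosDef)
    (hM : M.IsSymm) : ∃ (L : Matrix (Fin n) (Fin n) ℝ) (d : Fin n → ℝ),
      L.det ≠ 0 ∧ S = L * Lᵀ ∧ Lᵀ * M * L = diagonal d := by
  obtain ⟨B, hB⟩ := CStarAlgebra.nonneg_iff_eq_star_mul_self.mp hS.posSemidef.nonneg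
  have hB' : S = Bᵀ * B := by rw [hB, star_eq_conjTranspose, conjTranspose_eq_transpose_of_trivial]
  have hW : (B * M * Bᵀ).IsHermitian := by
    rw [IsHermitian, conjTranspose_eq_transpose_of_trivial, transpose_mul, transpose_mul,
      transpose_transpose, hM.eq, Matrix.mul_assoc]
  set O : Matrix (Fin n) (Fin n) ℝ := hW.eigenvectorUnitary.1 with hO
  have hOO : O * Oᵀ = 1 := by
    have := Unitary.coe_mul_star_self hW.eigenvectorUnitary
    rwa [Unitary.coe_star, star_eq_conjTranspose, conjTranspose_eq_transpose_of_trivial] at this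
  have hdiag := hW.conjStarAlgAut_star_eigenvectorUnitary
  rw [Unitary.conjStarAlgAut_star_apply] at hdiag
  rw [star_eq_conjTranspose, conjTranspose_eq_transpose_of_trivial] at hdiag
  refine ⟨Bᵀ * O, RCLike.ofReal ∘ hW.eigenvalues, ?_, ?_, ?_⟩
  rotate_left
  · rw [transpose_mul, transpose_transpose, Matrix.mul_assoc, ← Matrix.mul_assoc O, hOO,
      Matrix.one_mul, hB']
  · rw [← hdiag, transpose_mul, transpose_transpose]
    simp only [Matrix.mul_assoc, hO]
  · intro h0
    have h1 : S = (Bᵀ * O) * (Bᵀ * O)ᵀ := by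
      rw [transpose_mul, transpose_transpose, Matrix.mul_assoc, ← Matrix.mul_assoc O, hOO,
        Matrix.one_mul, hB']
    have := hS.det_pos
    rw [h1, det_mul, h0] at this
    simp at this

/-- Chebyshev's inequality for a quadratic form of a centered Gaussian vector. -/
lemma gaussianPi_qForm_le {n : ℕ} {S M : Matrix (Fin n) (Fin n) ℝ} (hS : S.PosDef)
    (hM : M.IsSymm) {ε : ℝ} (hε : 0 < ε) :
    gaussianPi n S {x | ε ≤ |qForm M x - (M * S).trace|} ≤
      ENNReal.ofReal (varSq * (M * S * (M * S)).trace / ε ^ 2) := by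
  obtain ⟨L, d, hL, hSL, hd⟩ := exists_diagonalizing_factor hS hM
  have htr : (M * S).trace = ∑ i, d i := by
    rw [hSL, ← Matrix.mul_assoc, trace_mul_comm, ← Matrix.mul_assoc, hd, trace_diagonal]
  have htr2 : (M * S * (M * S)).trace = ∑ i, d i ^ 2 := by
    have : M * S * (M * S) = (M * L) * (Lᵀ * M * L * Lᵀ) := by
      rw [hSL]; simp only [Matrix.mul_assoc]
    rw [this, trace_mul_comm]
    have : Lᵀ * M * L * Lᵀ * (M * L) = (Lᵀ * M * L) * (Lᵀ * M * L) := by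
      simp only [Matrix.mul_assoc]
    rw [this, hd, diagonal_mul_diagonal, trace_diagonal]
    exact Finset.sum_congr rfl fun i _ => by ring
  have hLm : Measurable fun y : Fin n → ℝ => L *ᵥ y :=
    (Continuous.matrix_mulVec continuous_const continuous_id).measurable
  have hset : MeasurableSet {x : Fin n → ℝ | ε ≤ |qForm M x - (M * S).trace|} := by
    refine (isClosed_le continuous_const ?_).measurableSet
    exact ((continuous_qForm M).sub continuous_const).abs
  set μ := Measure.pi fun _ : Fin n => ProbabilityTheory.gaussianReal 0 1 with hμ
  rw [gaussianPi_eq_map S L hL hSL, Measure.map_apply hLm hset]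
  have hLp : ∀ i, MemLp (fun x : ℝ => d i * x ^ 2) 2 (ProbabilityTheory.gaussianReal 0 1) :=
    fun i => memLp_sq_gaussianReal.const_mul (d i)
  have hLp' : ∀ i, MemLp (fun y : Fin n → ℝ => d i * y i ^ 2) 2 μ := fun i =>
    (hLp i).comp_measurePreserving (measurePreserving_eval _ i)
  have hsum : MemLp (∑ i, fun y : Fin n → ℝ => d i * y i ^ 2) 2 μ :=
    memLp_finsetSum' _ fun i _ => hLp' i
  have hmean : ∫ y, (∑ i, fun y : Fin n → ℝ => d i * y i ^ 2) y ∂μ = (M * S).trace := by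
    simp only [Finset.sum_apply]
    rw [integral_finsetSum _ fun i _ => (hLp' i).integrable (by norm_num), htr]
    refine Finset.sum_congr rfl fun i _ => ?_
    have := (measurePreserving_eval (fun _ : Fin n => ProbabilityTheory.gaussianReal 0 1) i)
    have h2 : ∫ y, d i * y i ^ 2 ∂μ = ∫ x, d i * x ^ 2 ∂(ProbabilityTheory.gaussianReal 0 1) := by
      rw [← this.map_eq, integral_map this.measurable.aemeasurable (by fun_prop)]
    rw [h2, integral_const_mul, integral_sq_gaussianReal, mul_one]
  have hvar := ProbabilityTheory.variance_sum_pi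
    (μ := fun _ : Fin n => ProbabilityTheory.gaussianReal 0 1) hLp
  have hcheb := ProbabilityTheory.meas_ge_le_variance_div_sq hsum hε
  rw [hmean, hvar] at hcheb
  have hv : ∑ i, ProbabilityTheory.variance (fun x : ℝ => d i * x ^ 2)
      (ProbabilityTheory.gaussianReal 0 1) = varSq * (M * S * (M * S)).trace := by
    rw [htr2, Finset.mul_sum]
    refine Finset.sum_congr rfl fun i _ => ?_
    rw [ProbabilityTheory.variance_const_mul, varSq]
    ring
  rw [hv] at hcheb
  refine le_trans (le_of_eq ?_) hcheb
  congr 1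
  ext y
  simp only [Set.mem_preimage, Set.mem_ofPred_eq, qForm_mulVec, hd, qForm_diagonal,
    Finset.sum_apply]

/-! ### Entrywise calculus of matrix-valued functions -/

section MatrixCalculus

variable {n : ℕ}

/-- Entrywise derivative of a matrix-valued function. -/
def MDeriv (A : ℝ → Matrix (Fin n) (Fin n) ℝ) (A' : Matrix (Fin n) (Fin n) ℝ) (h : ℝ) : Prop :=
  ∀ i j, HasDerivAt (fun t => A t i j) (A' i j) h

lemma MDeriv.mul {A B : ℝ → Matrix (Fin n) (Fin n) ℝ} {A' B' : Matrix (Fin n) (Fin n) ℝ} {h : ℝ}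
    (hA : MDeriv A A' h) (hB : MDeriv B B' h) :
    MDeriv (fun t => A t * B t) (A' * B h + A h * B') h := by
  intro i j
  simp only [Matrix.mul_apply, Matrix.add_apply, ← Finset.sum_add_distrib]
  exact HasDerivAt.fun_sum fun k _ => (hA i k).mul (hB k j)

lemma MDeriv.neg {A : ℝ → Matrix (Fin n) (Fin n) ℝ} {A' : Matrix (Fin n) (Fin n) ℝ} {h : ℝ}
    (hA : MDeriv A A' h) : MDeriv (fun t => -A t) (-A') h := fun i j => (hA i j).neg

lemma MDeriv.trace {A : ℝ → Matrix (Fin n) (Fin n) ℝ} {A' : Matrix (Fin n) (Fin n) ℝ} {h : ℝ}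
    (hA : MDeriv A A' h) : HasDerivAt (fun t => (A t).trace) A'.trace h := by
  simp only [Matrix.trace, Matrix.diag]
  exact HasDerivAt.fun_sum fun k _ => hA k k

lemma MDeriv.unique {A : ℝ → Matrix (Fin n) (Fin n) ℝ} {A' B' : Matrix (Fin n) (Fin n) ℝ} {h : ℝ}
    (hA : MDeriv A A' h) (hB : MDeriv A B' h) : A' = B' := by
  ext i j
  exact (hA i j).unique (hB i j)

/-- Jacobi's formula for the derivative of a determinant. -/
lemma MDeriv.det {A : ℝ → Matrix (Fin n) (Fin n) ℝ} {A' : Matrix (Fin n) (Fin n) ℝ} {h : ℝ}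
    (hA : MDeriv A A' h) :
    HasDerivAt (fun t => (A t).det) ((A h).adjugate * A').trace h := by
  have h1 : HasDerivAt (fun t => (A t).det)
      (∑ σ : Equiv.Perm (Fin n), ((Equiv.Perm.sign σ : ℤ) : ℝ) *
        ∑ i, (∏ j ∈ Finset.univ.erase i, A h (σ j) j) • A' (σ i) i) h := by
    simp only [det_apply']
    exact HasDerivAt.fun_sum fun σ _ =>
      (HasDerivAt.fun_finsetProd fun i _ => hA (σ i) i).const_mul _
  convert h1 using 1
  have h2 : ∀ i, ((A h).adjugate * A') i i = ((A h).updateCol i (fun k => A' k i)).det := by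
    intro i
    rw [← cramer_apply, cramer_eq_adjugate_mulVec]
    rfl
  simp only [Matrix.trace, Matrix.diag, h2, det_apply', Finset.mul_sum]
  rw [Finset.sum_comm]
  refine Finset.sum_congr rfl fun σ _ => Finset.sum_congr rfl fun i _ => ?_
  congr 1
  rw [← Finset.mul_prod_erase _ _ (Finset.mem_univ i), updateCol_self, smul_eq_mul, mul_comm]
  congr 1
  exact Finset.prod_congr rfl fun j hj => updateCol_ne (Finset.ne_of_mem_erase hj)

lemma MDeriv.differentiableAt_inv {A : ℝ → Matrix (Fin n) (Fin n) ℝ}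
    {A' : Matrix (Fin n) (Fin n) ℝ} {h : ℝ} (hA : MDeriv A A' h) (hdet : (A h).det ≠ 0)
    (i j : Fin n) : DifferentiableAt ℝ (fun t => (A t)⁻¹ i j) h := by
  have hadj : DifferentiableAt ℝ (fun t => (A t).adjugate i j) h := by
    have : MDeriv (fun t => (A t).updateRow j (Pi.single i 1)) (A'.updateRow j 0) h := by
      intro k l
      by_cases hk : k = j
      · subst hk
        simp only [updateRow_self]
        exact hasDerivAt_const _ _
      · simp only [updateRow_ne hk]
        exact hA k l
    simp only [adjugate_apply]
    exact this.det.differentiableAt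
  have : (fun t => (A t)⁻¹ i j) = fun t => (A t).det⁻¹ * (A t).adjugate i j := by
    ext t
    rw [Matrix.inv_def, Ring.inverse_eq_inv']
    rfl
  rw [this]
  exact (hA.det.differentiableAt.inv hdet).mul hadj

lemma MDeriv.inv {A : ℝ → Matrix (Fin n) (Fin n) ℝ} {A' : Matrix (Fin n) (Fin n) ℝ} {h : ℝ}
    (hA : MDeriv A A' h) (hdet : (A h).det ≠ 0) :
    MDeriv (fun t => (A t)⁻¹) (-((A h)⁻¹ * A' * (A h)⁻¹)) h := by
  have hB : MDeriv (fun t => (A t)⁻¹) (fun i j => deriv (fun t => (A t)⁻¹ i j) h) h :=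
    fun i j => (hA.differentiableAt_inv hdet i j).hasDerivAt
  set B' : Matrix (Fin n) (Fin n) ℝ := fun i j => deriv (fun t => (A t)⁻¹ i j) h
  have hu : IsUnit (A h).det := isUnit_iff_ne_zero.2 hdet
  have h1 := hB.mul hA
  have h2 : MDeriv (fun t => (A t)⁻¹ * A t) 0 h := by
    intro i j
    have hev : ∀ᶠ t in 𝓝 h, (A t).det ≠ 0 :=
      hA.det.continuousAt.eventually_ne hdet
    refine (hasDerivAt_const h ((1 : Matrix (Fin n) (Fin n) ℝ) i j)).congr_of_eventuallyEq ?_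
    filter_upwards [hev] with t ht
    rw [nonsing_inv_mul _ (isUnit_iff_ne_zero.2 ht)]
  have h3 := h1.unique h2
  have h4 : B' = -((A h)⁻¹ * A' * (A h)⁻¹) := by
    have := congrArg (· * (A h)⁻¹) (eq_neg_of_add_eq_zero_left h3)
    simpa [Matrix.mul_assoc, mul_nonsing_inv _ hu, Matrix.neg_mul] using this
  rw [← h4]
  exact hB

lemma MDeriv.log_det {A : ℝ → Matrix (Fin n) (Fin n) ℝ} {A' : Matrix (Fin n) (Fin n) ℝ} {h : ℝ}
    (hA : MDeriv A A' h) (hdet : (A h).det ≠ 0) :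
    HasDerivAt (fun t => Real.log (A t).det) ((A h)⁻¹ * A').trace h := by
  convert hA.det.log hdet using 1
  rw [Matrix.inv_def, Ring.inverse_eq_inv', Matrix.smul_mul, trace_smul, smul_eq_mul]
  field_simp

variable {A A1 : ℝ → Matrix (Fin n) (Fin n) ℝ} {A2 : Matrix (Fin n) (Fin n) ℝ} {H : ℝ}

lemma deriv_deriv_log_det (hA : ∀ᶠ h in 𝓝 H, MDeriv A (A1 h) h) (hA1 : MDeriv A1 A2 H)
    (hdet : (A H).det ≠ 0) :
    deriv (fun h => deriv (fun t => Real.log (A t).det) h) H =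
      ((A H)⁻¹ * A2).trace - ((A H)⁻¹ * A1 H * ((A H)⁻¹ * A1 H)).trace := by
  have hev : ∀ᶠ t in 𝓝 H, (A t).det ≠ 0 :=
    hA.self_of_nhds.det.continuousAt.eventually_ne hdet
  have h1 : (fun h => deriv (fun t => Real.log (A t).det) h) =ᶠ[𝓝 H]
      fun h => ((A h)⁻¹ * A1 h).trace := by
    filter_upwards [hA, hev] with h h1 h2
    exact (h1.log_det h2).deriv
  rw [h1.deriv_eq, ((hA.self_of_nhds.inv hdet).mul hA1).trace.deriv, trace_add, Matrix.neg_mul,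
    trace_neg, Matrix.mul_assoc ((A H)⁻¹ * A1 H)]
  ring

lemma deriv_deriv_inv (hA : ∀ᶠ h in 𝓝 H, MDeriv A (A1 h) h) (hA1 : MDeriv A1 A2 H)
    (hdet : (A H).det ≠ 0) :
    (fun i j => deriv (fun h => deriv (fun t => (A t)⁻¹ i j) h) H : Matrix (Fin n) (Fin n) ℝ) =
      (2 : ℝ) • ((A H)⁻¹ * A1 H * (A H)⁻¹ * A1 H * (A H)⁻¹) - (A H)⁻¹ * A2 * (A H)⁻¹ := by
  have hev : ∀ᶠ t in 𝓝 H, (A t).det ≠ 0 :=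
    hA.self_of_nhds.det.continuousAt.eventually_ne hdet
  have hI := hA.self_of_nhds.inv hdet
  have h2 := ((hI.mul hA1).mul hI).neg
  ext i j
  have h1 : (fun h => deriv (fun t => (A t)⁻¹ i j) h) =ᶠ[𝓝 H]
      fun h => (-((A h)⁻¹ * A1 h * (A h)⁻¹)) i j := by
    filter_upwards [hA, hev] with h h1 h2
    exact (h1.inv h2 i j).deriv
  rw [h1.deriv_eq, (h2 i j).deriv]
  refine congrFun (congrFun ?_ i) j
  simp only [Matrix.add_mul, Matrix.neg_mul, Matrix.mul_neg, Matrix.mul_assoc, two_smul]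
  abel

end MatrixCalculus

section PSDTraces

variable {m : Type*} [Fintype m] [DecidableEq m]

omit [DecidableEq m] in
lemma posSemidef_mul_mul_of_isSymm {P K : Matrix m m ℝ} (hP : P.PosSemidef) (hK : K.IsSymm) :
    (K * P * K).PosSemidef := by
  have := hP.mul_mul_conjTranspose_same K
  rwa [conjTranspose_eq_transpose_of_trivial, hK.eq] at this

open scoped MatrixOrder in
lemma trace_mul_nonneg {P Q : Matrix m m ℝ} (hP : P.PosSemidef) (hQ : Q.PosSemidef) :
    0 ≤ (P * Q).trace := by
  obtain ⟨B, rfl⟩ := CStarAlgebra.nonneg_iff_eq_star_mul_self.mp hQ.nonneg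
  rw [← Matrix.mul_assoc, trace_mul_comm, ← Matrix.mul_assoc, star_eq_conjTranspose]
  exact (hP.mul_mul_conjTranspose_same B).trace_nonneg

omit [Fintype m] [DecidableEq m] in
lemma PosSemidef_isSymm {P : Matrix m m ℝ} (hP : P.PosSemidef) : P.IsSymm := by
  have := hP.isHermitian
  rwa [Matrix.IsHermitian, conjTranspose_eq_transpose_of_trivial] at this

lemma trace_mul_mul_mul_nonneg {P K : Matrix m m ℝ} (hP : P.PosSemidef) (hK : K.IsSymm) :
    0 ≤ (P * K * (P * K)).trace := by
  have := trace_mul_nonneg hP (posSemidef_mul_mul_of_isSymm hP hK)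
  simpa only [Matrix.mul_assoc] using this

lemma trace_sub_sq_le {P K L : Matrix m m ℝ} (hP : P.PosSemidef) (hK : K.IsSymm) (hL : L.IsSymm) :
    (P * (K - L) * (P * (K - L))).trace ≤
      2 * (P * K * (P * K)).trace + 2 * (P * L * (P * L)).trace := by
  have h := trace_mul_mul_mul_nonneg hP (show (K + L).IsSymm from hK.add hL)
  simp only [Matrix.mul_add, Matrix.add_mul, Matrix.mul_sub, Matrix.sub_mul, trace_add,
    trace_sub] at h ⊢
  linarith

lemma posSemidef_sub_of_forall {T K Q : Matrix m m ℝ} (hT : T.PosDef) (hK : K.IsSymm)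
    (hQ : Q.IsSymm)
    (h : ∀ x y : m → ℝ, 2 * (y ⬝ᵥ K *ᵥ x) ≤ y ⬝ᵥ T *ᵥ y + x ⬝ᵥ Q *ᵥ x) :
    (Q - K * T⁻¹ * K).PosSemidef := by
  have hP : T⁻¹.IsSymm := PosSemidef_isSymm hT.inv.posSemidef
  have hu : IsUnit T.det := (Matrix.isUnit_iff_isUnit_det _).mp hT.isUnit
  refine PosSemidef.of_dotProduct_mulVec_nonneg ?_ fun x => ?_
  · rw [Matrix.IsHermitian, conjTranspose_eq_transpose_of_trivial, transpose_sub, hQ.eq,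
      transpose_mul, transpose_mul, hK.eq, hP.eq, Matrix.mul_assoc]
  · have h1 := h x (T⁻¹ *ᵥ (K *ᵥ x))
    have e1 : T *ᵥ (T⁻¹ *ᵥ (K *ᵥ x)) = K *ᵥ x := by
      rw [mulVec_mulVec, Matrix.mul_nonsing_inv _ hu, one_mulVec]
    have e2 : x ⬝ᵥ (K * T⁻¹ * K) *ᵥ x = (T⁻¹ *ᵥ (K *ᵥ x)) ⬝ᵥ K *ᵥ x := by
      rw [Matrix.mul_assoc, ← mulVec_mulVec, ← mulVec_mulVec, dotProduct_mulVec,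
        ← mulVec_transpose, hK.eq, dotProduct_comm]
    rw [e1] at h1
    rw [star_trivial, sub_mulVec, dotProduct_sub, e2]
    linarith

lemma trace_inv_mul_sq_le {T K Q : Matrix m m ℝ} (hT : T.PosDef)
    (h : (Q - K * T⁻¹ * K).PosSemidef) :
    (T⁻¹ * K * (T⁻¹ * K)).trace ≤ (T⁻¹ * Q).trace := by
  have := trace_mul_nonneg hT.inv.posSemidef h
  rw [Matrix.mul_sub, trace_sub] at this
  simp only [Matrix.mul_assoc] at this ⊢
  linarith

lemma trace_inv_mul_pow_four_le {T K Q : Matrix m m ℝ} (hT : T.PosDef) (hK : K.IsSymm)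
    (h : (Q - K * T⁻¹ * K).PosSemidef) :
    (T⁻¹ * K * (T⁻¹ * K) * (T⁻¹ * K * (T⁻¹ * K))).trace ≤ (T⁻¹ * Q * (T⁻¹ * Q)).trace := by
  have hP := hT.inv.posSemidef
  have hA := posSemidef_mul_mul_of_isSymm hP hK
  have hQ' : Q.PosSemidef := by simpa using h.add hA
  have h1 := trace_mul_nonneg (posSemidef_mul_mul_of_isSymm hA (PosSemidef_isSymm hP)) h
  have h2 := trace_mul_nonneg (posSemidef_mul_mul_of_isSymm hQ' (PosSemidef_isSymm hP)) h
  rw [Matrix.mul_sub, trace_sub] at h1 h2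
  have e : (T⁻¹ * Q * T⁻¹ * (K * T⁻¹ * K)).trace = (T⁻¹ * (K * T⁻¹ * K) * T⁻¹ * Q).trace := by
    rw [trace_mul_comm, ← Matrix.mul_assoc, ← Matrix.mul_assoc, trace_mul_comm]
    simp only [Matrix.mul_assoc]
  simp only [Matrix.mul_assoc] at h1 h2 e ⊢
  linarith

end PSDTraces

lemma tendstoInProb_of_trace {H σ : ℝ} (hσ : 0 < σ) {Δ : ℕ → ℝ} (hΔ : ∀ n, 0 < Δ n)
    {G G2 : (n : ℕ) → Matrix (Fin n) (Fin n) ℝ} (hpos : ∀ n, (fgnT n H).PosDef)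
    (hG : ∀ n, (G n).IsSymm) (hG2 : ∀ n, (G2 n).IsSymm)
    (hM : ∀ n, d2InvT n H = (2 : ℝ) • ((fgnT n H)⁻¹ * G n * (fgnT n H)⁻¹ * G n * (fgnT n H)⁻¹)
      - (fgnT n H)⁻¹ * G2 n * (fgnT n H)⁻¹)
    (hL : ∀ n, deriv (fun h => deriv (fun t => Real.log (fgnT n t).det) h) H =
      ((fgnT n H)⁻¹ * G2 n).trace - ((fgnT n H)⁻¹ * G n * ((fgnT n H)⁻¹ * G n)).trace)
    {e C : ℝ} (hlim : Tendsto (fun n : ℕ =>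
      (1 / (n : ℝ)) * ((fgnT n H)⁻¹ * G n * ((fgnT n H)⁻¹ * G n)).trace) atTop (𝓝 (2 * e)))
    (h4 : ∀ n : ℕ, ((fgnT n H)⁻¹ * G n * ((fgnT n H)⁻¹ * G n) *
      ((fgnT n H)⁻¹ * G n * ((fgnT n H)⁻¹ * G n))).trace ≤ C * n)
    (h2 : ∀ n : ℕ, ((fgnT n H)⁻¹ * G2 n * ((fgnT n H)⁻¹ * G2 n)).trace ≤ C * n) :
    TendstoInProb (fun n => fgnP n (Δ n) H σ) (fun n => Estat n (Δ n) H σ) e := by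
  intro ε hε
  have hlim' : ∀ᶠ n : ℕ in atTop, |(1 / (n : ℝ)) *
      ((fgnT n H)⁻¹ * G n * ((fgnT n H)⁻¹ * G n)).trace / 2 - e| < ε / 2 := by
    have := (hlim.div_const 2)
    rw [show 2 * e / 2 = e by ring] at this
    simpa [Real.dist_eq] using (Metric.tendsto_nhds.mp this) (ε / 2) (by positivity)
  have hbd : ∀ᶠ n : ℕ in atTop, fgnP n (Δ n) H σ {x | ε ≤ |Estat n (Δ n) H σ x - e|} ≤
      ENNReal.ofReal (varSq * (10 * C) / ε ^ 2 * (1 / (n : ℝ))) := by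
    filter_upwards [hlim', eventually_gt_atTop 0] with n hn hn0
    have hn0' : (0 : ℝ) < n := by exact_mod_cast hn0
    set c : ℝ := σ ^ 2 * Δ n ^ (2 * H) with hc
    have hcpos : 0 < c := mul_pos (by positivity) (Real.rpow_pos_of_pos (hΔ n) _)
    set T := fgnT n H with hT
    set P := T⁻¹ with hP
    have hPs : P.IsSymm := PosSemidef_isSymm (hpos n).inv.posSemidef
    have hu : IsUnit T.det := (Matrix.isUnit_iff_isUnit_det _).mp (hpos n).isUnit
    have hPT : P * T = 1 := Matrix.nonsing_inv_mul _ hu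
    have hS : (c • T).PosDef := (hpos n).smul hcpos
    have hM' : d2InvT n H = (2 : ℝ) • (P * G n * P * G n * P) - P * G2 n * P := hM n
    have hMs : (d2InvT n H).IsSymm := by
      rw [hM', Matrix.IsSymm]
      simp only [transpose_sub, transpose_smul, transpose_mul, hPs.eq, (hG n).eq, (hG2 n).eq,
        Matrix.mul_assoc]
    have hMS : d2InvT n H * (c • T) = c • ((2 : ℝ) • (P * (G n * P * G n)) - P * G2 n) := by
      rw [hM', Matrix.mul_smul, Matrix.sub_mul, Matrix.smul_mul]
      simp only [Matrix.mul_assoc]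
      simp only [hPT, Matrix.mul_one]
    have hMS' : d2InvT n H * (c • T) = P * ((2 * c) • (G n * P * G n) - c • G2 n) := by
      rw [hMS, Matrix.mul_sub, smul_sub, smul_smul, Matrix.mul_smul, Matrix.mul_smul, mul_comm c]
    have htr : (d2InvT n H * (c • T) * (d2InvT n H * (c • T))).trace ≤ 10 * C * n * c ^ 2 := by
      rw [hMS']
      have hs1 : ((2 * c) • (G n * P * G n)).IsSymm := by
        rw [Matrix.IsSymm]
        simp only [transpose_smul, transpose_mul, hPs.eq, (hG n).eq, Matrix.mul_assoc]
      have hs2 : (c • G2 n).IsSymm := (hG2 n).smul c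
      refine (trace_sub_sq_le (hpos n).inv.posSemidef hs1 hs2).trans ?_
      have a1 := h4 n
      have a2 := h2 n
      simp only [Matrix.mul_smul, Matrix.smul_mul, trace_smul, smul_eq_mul, Matrix.mul_assoc]
        at a1 a2 ⊢
      nlinarith [mul_le_mul_of_nonneg_left a1 (sq_nonneg c),
        mul_le_mul_of_nonneg_left a2 (sq_nonneg c)]
    have hε' : 0 < ε / 2 * (2 * n * c) := by positivity
    have key := gaussianPi_qForm_le hS hMs hε'
    have hsub : {x | ε ≤ |Estat n (Δ n) H σ x - e|} ⊆
        {x | ε / 2 * (2 * n * c) ≤ |qForm (d2InvT n H) x - (d2InvT n H * (c • T)).trace|} := by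
      intro x hx
      simp only [Set.mem_ofPred_eq] at hx ⊢
      have htrace : (d2InvT n H * (c • T)).trace =
          c * (2 * (P * G n * (P * G n)).trace - (P * G2 n).trace) := by
        rw [hMS]
        simp only [trace_smul, trace_sub, smul_eq_mul, Matrix.mul_assoc]
      have hE : Estat n (Δ n) H σ x - e =
          (qForm (d2InvT n H) x - (d2InvT n H * (c • T)).trace) / (2 * n * c) +
          ((1 / (n : ℝ)) * (P * G n * (P * G n)).trace / 2 - e) := by
        rw [Estat, hL n, htrace, show 2 * σ ^ 2 * Δ n ^ (2 * H) = 2 * c by rw [hc]; ring]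
        field_simp
        ring
      rw [hE] at hx
      have h3 := hx.trans (abs_add_le _ _)
      have h5 : ε / 2 ≤ |(qForm (d2InvT n H) x - (d2InvT n H * (c • T)).trace) / (2 * n * c)| := by
        linarith
      rwa [abs_div, abs_of_pos (show 0 < 2 * n * c by positivity),
        le_div_iff₀ (by positivity)] at h5
    refine (measure_mono hsub).trans (key.trans (ENNReal.ofReal_le_ofReal ?_))
    have hv : 0 ≤ varSq := ProbabilityTheory.variance_nonneg _ _
    calc _ ≤ varSq * (10 * C * n * c ^ 2) / (ε / 2 * (2 * n * c)) ^ 2 := by gcongr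
      _ = _ := by field_simp
  refine tendsto_of_tendsto_of_tendsto_of_le_of_le' tendsto_const_nhds ?_
    (Eventually.of_forall fun _ => zero_le) hbd
  have : Tendsto (fun n : ℕ => varSq * (10 * C) / ε ^ 2 * (1 / (n : ℝ))) atTop (𝓝 0) := by
    simpa using (tendsto_one_div_atTop_nhds_zero_nat (𝕜 := ℝ)).const_mul (varSq * (10 * C) / ε ^ 2)
  simpa using ENNReal.tendsto_ofReal this

/-- Lebesgue measure on the fundamental domain `(-π, π]` of the circle. -/
abbrev circ : Measure ℝ := volume.restrict (Set.Ioc (-Real.pi) Real.pi)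

lemma integral_circ (φ : ℝ → ℝ) : ∫ x, φ x ∂circ = ∫ x in (-Real.pi)..Real.pi, φ x :=
  (intervalIntegral.integral_of_le (by linarith [Real.pi_pos])).symm

lemma integral_circ_of_odd {φ : ℝ → ℝ} (h : ∀ x, φ (-x) = -φ x) : ∫ x, φ x ∂circ = 0 := by
  rw [integral_circ]
  have := intervalIntegral.integral_comp_neg (a := -Real.pi) (b := Real.pi) φ
  simp only [h, neg_neg, intervalIntegral.integral_neg] at this
  linarith

lemma integrable_mul_cos {φ : ℝ → ℝ} (hφ : Integrable φ circ) (c : ℝ) :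
    Integrable (fun x => φ x * Real.cos (c * x)) circ :=
  hφ.mul_bdd (c := 1) (by fun_prop) (Eventually.of_forall fun x => by
    simpa using Real.abs_cos_le_one _)

/-- The cosine Fourier coefficients of a function on the circle. -/
def cosCoeff (φ : ℝ → ℝ) (d : ℤ) : ℝ := ∫ x, φ x * Real.cos (d * x) ∂circ

lemma cosCoeff_neg (φ : ℝ → ℝ) (d : ℤ) : cosCoeff φ (-d) = cosCoeff φ d := by
  simp [cosCoeff]

lemma cosCoeff_add {a b : ℝ → ℝ} (ha : Integrable a circ) (hb : Integrable b circ) (d : ℤ) :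
    cosCoeff (fun x => a x + b x) d = cosCoeff a d + cosCoeff b d := by
  simp only [cosCoeff, add_mul]
  exact integral_add (integrable_mul_cos ha _) (integrable_mul_cos hb _)

lemma cosCoeff_sub {a b : ℝ → ℝ} (ha : Integrable a circ) (hb : Integrable b circ) (d : ℤ) :
    cosCoeff (fun x => a x - b x) d = cosCoeff a d - cosCoeff b d := by
  simp only [cosCoeff, sub_mul]
  exact integral_sub (integrable_mul_cos ha _) (integrable_mul_cos hb _)

lemma hasSum_sq_cosCoeff {a : ℝ → ℝ} (ha : MemLp a 2 circ) (he : ∀ x, a (-x) = a x) :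
    HasSum (fun d => cosCoeff a d ^ 2) (2 * Real.pi * ∫ x, a x ^ 2 ∂circ) := by
  have hpi := Real.pi_pos
  have h := hasSum_sq_fourierCoeffOn (f := fun x => (a x : ℂ))
    (show -Real.pi < Real.pi by linarith) ha.ofReal
  have hi : Integrable a circ := ha.integrable (by norm_num)
  have hc : ∀ d : ℤ, fourierCoeffOn (show -Real.pi < Real.pi by linarith)
      (fun x => (a x : ℂ)) d = ((cosCoeff a d / (2 * Real.pi) : ℝ) : ℂ) := by
    intro d
    rw [fourierCoeffOn_eq_integral, intervalIntegral.integral_of_le (by linarith)]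
    have e : ∀ x : ℝ, (fourier (-d) (x : AddCircle (Real.pi - -Real.pi))) • (a x : ℂ) =
        ((a x * Real.cos (d * x) : ℝ) : ℂ) - ((a x * Real.sin (d * x) : ℝ) : ℂ) * Complex.I := by
      intro x
      rw [fourier_coe_apply, smul_eq_mul]
      have : 2 * (Real.pi : ℂ) * Complex.I * ((-d : ℤ) : ℂ) * x / ((Real.pi - -Real.pi : ℝ) : ℂ) =
          ((-(d * x) : ℝ) : ℂ) * Complex.I := by
        have : (Real.pi : ℂ) ≠ 0 := by exact_mod_cast hpi.ne'
        push_cast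
        field_simp
        ring
      rw [this, Complex.exp_mul_I, ← Complex.ofReal_cos, ← Complex.ofReal_sin, Real.cos_neg,
        Real.sin_neg]
      push_cast
      ring
    have is : Integrable (fun x => a x * Real.sin (d * x)) circ :=
      hi.mul_bdd (c := 1) (by fun_prop) (Eventually.of_forall fun x => by
        simpa using Real.abs_sin_le_one _)
    simp_rw [e]
    have hz : ∫ x, a x * Real.sin (d * x) ∂circ = 0 :=
      integral_circ_of_odd (fun x => by rw [he, mul_neg, Real.sin_neg, mul_neg])
    rw [integral_sub (integrable_mul_cos hi _).ofReal (is.ofReal.mul_const _),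
      integral_mul_const, integral_complex_ofReal, integral_complex_ofReal, hz,
      show (∫ x in Set.Ioc (-Real.pi) Real.pi, a x * Real.cos (d * x)) = cosCoeff a d from rfl]
    simp only [Complex.ofReal_zero, zero_mul, sub_zero, Complex.real_smul]
    push_cast
    ring
  simp_rw [hc, Complex.norm_real, Real.norm_eq_abs, sq_abs] at h
  rw [← integral_circ] at h
  have h2 := h.mul_left ((2 * Real.pi) ^ 2)
  have e1 : (fun d => (2 * Real.pi) ^ 2 * (cosCoeff a d / (2 * Real.pi)) ^ 2) =
      fun d => cosCoeff a d ^ 2 := by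
    ext d; field_simp
  have e2 : (2 * Real.pi) ^ 2 * ((Real.pi - -Real.pi)⁻¹ • ∫ x, a x ^ 2 ∂circ) =
      2 * Real.pi * ∫ x, a x ^ 2 ∂circ := by
    rw [smul_eq_mul, show Real.pi - -Real.pi = 2 * Real.pi by ring]
    field_simp
  rwa [e1, e2] at h2

lemma hasSum_cosCoeff_mul {a b : ℝ → ℝ} (ha : MemLp a 2 circ) (hea : ∀ x, a (-x) = a x)
    (hb : MemLp b 2 circ) (heb : ∀ x, b (-x) = b x) :
    HasSum (fun d => cosCoeff a d * cosCoeff b d) (2 * Real.pi * ∫ x, a x * b x ∂circ) := by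
  have hia : Integrable a circ := ha.integrable (by norm_num)
  have hib : Integrable b circ := hb.integrable (by norm_num)
  have h1 := hasSum_sq_cosCoeff (a := fun x => a x + b x) (ha.add hb) (by simp [hea, heb])
  have h2 := hasSum_sq_cosCoeff (a := fun x => a x - b x) (ha.sub hb) (by simp [hea, heb])
  have h := (h1.sub h2).mul_left (1 / 4)
  have i1 : Integrable (fun x => (a x + b x) ^ 2) circ := (ha.add hb).integrable_sq
  have i2 : Integrable (fun x => (a x - b x) ^ 2) circ := (ha.sub hb).integrable_sq
  have e1 : (fun d => cosCoeff a d * cosCoeff b d) = fun d => 1 / 4 *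
      (cosCoeff (fun x => a x + b x) d ^ 2 - cosCoeff (fun x => a x - b x) d ^ 2) := by
    funext d
    rw [cosCoeff_add hia hib, cosCoeff_sub hia hib]; ring
  have e2 : (fun x => a x * b x) = fun x => (1 / 4) * ((a x + b x) ^ 2 - (a x - b x) ^ 2) := by
    ext x; ring
  have e3 : ∀ A B : ℝ, 2 * Real.pi * (1 / 4 * (A - B)) =
      1 / 4 * (2 * Real.pi * A - 2 * Real.pi * B) := fun A B => by ring
  rwa [e1, e2, integral_const_mul, integral_sub i1 i2, e3]

/-- The Toeplitz matrix of size `n` with symbol `φ`. -/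
def toep (φ : ℝ → ℝ) (n : ℕ) : Matrix (Fin n) (Fin n) ℝ :=
  fun i j => cosCoeff φ ((i : ℤ) - (j : ℤ))

lemma toep_isSymm (φ : ℝ → ℝ) (n : ℕ) : (toep φ n).IsSymm := by
  ext i j
  rw [transpose_apply, toep, toep, ← cosCoeff_neg]
  congr 1; ring

lemma toep_sub {a b : ℝ → ℝ} (ha : Integrable a circ) (hb : Integrable b circ) (n : ℕ) :
    toep (fun x => a x - b x) n = toep a n - toep b n := by
  ext i j; exact cosCoeff_sub ha hb _

lemma toep_add {a b : ℝ → ℝ} (ha : Integrable a circ) (hb : Integrable b circ) (n : ℕ) :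
    toep (fun x => a x + b x) n = toep a n + toep b n := by
  ext i j; exact cosCoeff_add ha hb _

lemma toep_congr {a b : ℝ → ℝ} (h : a =ᵐ[circ] b) (n : ℕ) : toep a n = toep b n := by
  ext i j
  refine integral_congr_ae ?_
  filter_upwards [h] with x hx
  rw [hx]

lemma cosCoeff_one (d : ℤ) : cosCoeff (fun _ => 1) d = if d = 0 then 2 * Real.pi else 0 := by
  rw [cosCoeff]
  simp only [one_mul]
  rw [integral_circ]
  split_ifs with h
  · subst h
    simp
    ring
  · have hd : (d : ℝ) ≠ 0 := by exact_mod_cast h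
    rw [intervalIntegral.integral_comp_mul_left (fun x => Real.cos x) hd, integral_cos]
    simp [Real.sin_int_mul_pi]

lemma toep_const (c : ℝ) (n : ℕ) : toep (fun _ => c) n = (2 * Real.pi * c) • 1 := by
  ext i j
  have : cosCoeff (fun _ => c) ((i : ℤ) - j) = c * cosCoeff (fun _ => 1) ((i : ℤ) - j) := by
    simp only [cosCoeff, one_mul, integral_const_mul]
  rw [toep, this, cosCoeff_one, Matrix.smul_apply, Matrix.one_apply]
  by_cases h : i = j
  · simp [h]; ring
  · have : (i : ℤ) - j ≠ 0 := by
      intro h'; apply h; ext; omega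
    simp [h, this]

/-- Real part of the trigonometric polynomial with coefficients `x`. -/
def trigC {n : ℕ} (x : Fin n → ℝ) (l : ℝ) : ℝ := ∑ i, x i * Real.cos ((i : ℕ) * l)

/-- Imaginary part of the trigonometric polynomial with coefficients `x`. -/
def trigS {n : ℕ} (x : Fin n → ℝ) (l : ℝ) : ℝ := ∑ i, x i * Real.sin ((i : ℕ) * l)

lemma dotProduct_toep_mulVec {φ : ℝ → ℝ} (hφ : Integrable φ circ) {n : ℕ} (x y : Fin n → ℝ) :
    Integrable (fun l => φ l * (trigC y l * trigC x l + trigS y l * trigS x l)) circ ∧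
    y ⬝ᵥ toep φ n *ᵥ x = ∫ l, φ l * (trigC y l * trigC x l + trigS y l * trigS x l) ∂circ := by
  have e : ∀ l, φ l * (trigC y l * trigC x l + trigS y l * trigS x l) =
      ∑ i, ∑ j, y i * x j * (φ l * Real.cos ((((i : ℤ) - (j : ℤ) : ℤ) : ℝ) * l)) := by
    intro l
    simp only [trigC, trigS, Finset.sum_mul_sum]
    simp only [← Finset.sum_add_distrib, Finset.mul_sum]
    refine Finset.sum_congr rfl fun i _ => Finset.sum_congr rfl fun j _ => ?_
    push_cast
    rw [sub_mul, Real.cos_sub]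
    ring
  simp_rw [e]
  refine ⟨integrable_finsetSum _ fun i _ => integrable_finsetSum _ fun j _ =>
    (integrable_mul_cos hφ _).const_mul _, ?_⟩
  rw [integral_finsetSum _ fun i _ => integrable_finsetSum _ fun j _ =>
    (integrable_mul_cos hφ _).const_mul _]
  simp_rw [dotProduct, mulVec, dotProduct, Finset.mul_sum]
  refine Finset.sum_congr rfl fun i _ => ?_
  rw [integral_finsetSum _ fun j _ => (integrable_mul_cos hφ _).const_mul _]
  refine Finset.sum_congr rfl fun j _ => ?_
  rw [integral_const_mul, toep, cosCoeff]
  ring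

lemma toep_posSemidef {φ : ℝ → ℝ} (hφ : Integrable φ circ) (h0 : 0 ≤ᵐ[circ] φ) (n : ℕ) :
    (toep φ n).PosSemidef := by
  refine PosSemidef.of_dotProduct_mulVec_nonneg ?_ fun x => ?_
  · rw [Matrix.IsHermitian, conjTranspose_eq_transpose_of_trivial, (toep_isSymm φ n).eq]
  · rw [star_trivial, (dotProduct_toep_mulVec hφ x x).2]
    refine integral_nonneg_of_ae ?_
    filter_upwards [h0] with l hl
    exact mul_nonneg hl (add_nonneg (mul_self_nonneg _) (mul_self_nonneg _))

lemma toep_posDef {φ : ℝ → ℝ} (hφ : Integrable φ circ) (h0 : ∀ᵐ l ∂circ, 0 < φ l) (n : ℕ) :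
    (toep φ n).PosDef := by
  refine PosDef.of_dotProduct_mulVec_pos ?_ fun x hx => ?_
  · rw [Matrix.IsHermitian, conjTranspose_eq_transpose_of_trivial, (toep_isSymm φ n).eq]
  · rw [star_trivial]
    have h := (toep_posSemidef hφ (h0.mono fun l hl => hl.le) n).dotProduct_mulVec_nonneg x
    rw [star_trivial] at h
    refine lt_of_le_of_ne h fun h' => hx ?_
    obtain ⟨hi, he⟩ := dotProduct_toep_mulVec hφ x x
    rw [he] at h'
    have hz := (integral_eq_zero_iff_of_nonneg_ae (by
      filter_upwards [h0] with l hl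
      exact mul_nonneg hl.le (add_nonneg (mul_self_nonneg _) (mul_self_nonneg _))) hi).mp h'.symm
    have hz' : ∀ᵐ l ∂circ, (1 : ℝ) * (trigC x l * trigC x l + trigS x l * trigS x l) = 0 := by
      filter_upwards [hz, h0] with l h1 h2
      rw [one_mul]
      exact (mul_eq_zero.mp h1).resolve_left h2.ne'
    have h1 := (dotProduct_toep_mulVec (φ := fun _ => 1) (integrable_const _) x x).2
    rw [integral_congr_ae hz', toep_const] at h1
    simp only [mul_one, Matrix.smul_mulVec, Matrix.one_mulVec, dotProduct_smul, smul_eq_mul,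
      integral_zero, mul_eq_zero, Real.pi_ne_zero, OfNat.ofNat_ne_zero, or_self, false_or] at h1
    exact dotProduct_self_eq_zero.mp h1

lemma toep_schur {f h : ℝ → ℝ} (hf : Integrable f circ) (h0 : ∀ᵐ l ∂circ, 0 < f l)
    (hfh : Integrable (fun l => f l * h l) circ) (hfhh : Integrable (fun l => f l * h l ^ 2) circ)
    (n : ℕ) :
    (toep (fun l => f l * h l ^ 2) n -
      toep (fun l => f l * h l) n * (toep f n)⁻¹ * toep (fun l => f l * h l) n).PosSemidef := by
  refine posSemidef_sub_of_forall (toep_posDef hf h0 n) (toep_isSymm _ _) (toep_isSymm _ _) ?_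
  intro x y
  obtain ⟨i1, e1⟩ := dotProduct_toep_mulVec hfh x y
  obtain ⟨i2, e2⟩ := dotProduct_toep_mulVec hf y y
  obtain ⟨i3, e3⟩ := dotProduct_toep_mulVec hfhh x x
  rw [e1, e2, e3, ← integral_const_mul, ← integral_add i2 i3]
  refine integral_mono_ae (i1.const_mul 2) (i2.add i3) ?_
  filter_upwards [h0] with l hl
  have : 0 ≤ f l * ((trigC y l - h l * trigC x l) ^ 2 + (trigS y l - h l * trigS x l) ^ 2) := by
    positivity
  nlinarith

lemma trace_inv_toep_mul_le {f b : ℝ → ℝ} (hf : Integrable f circ) (h0 : ∀ᵐ l ∂circ, 0 < f l)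
    (hf' : Integrable (fun l => 1 / f l) circ) (hb : Integrable b circ) (hb0 : 0 ≤ᵐ[circ] b)
    (n : ℕ) :
    ((toep f n)⁻¹ * toep b n).trace ≤
      1 / (4 * Real.pi ^ 2) * (toep (fun l => 1 / f l) n * toep b n).trace := by
  have e1 : (fun l => f l * (1 / f l)) =ᵐ[circ] fun _ => (1 : ℝ) := by
    filter_upwards [h0] with l hl
    field_simp
  have e2 : (fun l => f l * (1 / f l) ^ 2) =ᵐ[circ] fun l => 1 / f l := by
    filter_upwards [h0] with l hl
    field_simp
  have h := toep_schur (h := fun l => 1 / f l) hf h0 ((integrable_const 1).congr e1.symm)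
    (hf'.congr e2.symm) n
  rw [toep_congr e1, toep_congr e2, toep_const] at h
  have h2 := trace_mul_nonneg h (toep_posSemidef hb hb0 n)
  simp only [mul_one, Matrix.smul_mul, Matrix.one_mul, Matrix.mul_smul,
    Matrix.sub_mul, trace_sub, trace_smul, smul_eq_mul] at h2
  have := Real.pi_pos
  rw [one_div, inv_mul_eq_div, le_div_iff₀ (by positivity)]
  linarith

lemma trace_toep (φ : ℝ → ℝ) (n : ℕ) : (toep φ n).trace = n * ∫ x, φ x ∂circ := by
  simp [Matrix.trace, toep, cosCoeff]

lemma trace_toep_mul_le {a b : ℝ → ℝ} {M : ℝ} (ha : Integrable a circ)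
    (haM : ∀ᵐ l ∂circ, a l ≤ M) (hb : Integrable b circ) (hb0 : 0 ≤ᵐ[circ] b) (n : ℕ) :
    (toep a n * toep b n).trace ≤ 2 * Real.pi * M * (n * ∫ x, b x ∂circ) := by
  have hp : (toep (fun l => M - a l) n).PosSemidef := by
    refine toep_posSemidef ((integrable_const M).sub ha) ?_ n
    filter_upwards [haM] with l hl
    simpa using hl
  have h := trace_mul_nonneg hp (toep_posSemidef hb hb0 n)
  rw [toep_sub (integrable_const M) ha, toep_const, Matrix.sub_mul, Matrix.smul_mul,
    Matrix.one_mul, trace_sub, trace_smul, trace_toep, smul_eq_mul] at h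
  linarith

lemma tendsto_sum_sub_div {c : ℤ → ℝ} {A : ℝ} (hc : HasSum c A) (he : ∀ d, c (-d) = c d) :
    Tendsto (fun n : ℕ => (n : ℝ)⁻¹ * ∑ i : Fin n, ∑ j : Fin n, c ((i : ℤ) - (j : ℤ)))
      atTop (𝓝 A) := by
  set u : ℕ → ℝ := fun n => 2 * ∑ d ∈ Finset.range (n + 1), c d - c 0 with hu
  have hS : ∀ n : ℕ, ∑ i : Fin n, ∑ j : Fin n, c ((i : ℤ) - (j : ℤ)) =
      ∑ k ∈ Finset.range n, u k := by
    intro n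
    induction n with
    | zero => simp
    | succ n ih =>
      rw [Finset.sum_range_succ, ← ih, Fin.sum_univ_castSucc]
      simp_rw [Fin.sum_univ_castSucc]
      rw [Finset.sum_add_distrib]
      have h1 : ∑ i : Fin n, c ((i : ℤ) - n) = ∑ d ∈ Finset.range n, c ((d : ℤ) + 1) := by
        rw [← Finset.sum_range_reflect, Fin.sum_univ_eq_sum_range (fun i => c ((i : ℤ) - n)) n]
        refine Finset.sum_congr rfl fun i hi => ?_
        rw [← he]
        congr 1
        have := Finset.mem_range.mp hi
        omega
      have h2 : ∑ i : Fin n, c ((n : ℤ) - i) = ∑ i : Fin n, c ((i : ℤ) - n) :=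
        Finset.sum_congr rfl fun i _ => by rw [← he]; congr 1; ring
      simp only [Fin.val_castSucc, Fin.val_last, sub_self, h2, h1, hu]
      rw [Finset.sum_range_succ' (fun d : ℕ => c d) n]
      push_cast
      ring
  simp_rw [hS]
  refine Filter.Tendsto.cesaro ?_
  have h1 := hc.nat_add_neg.tendsto_sum_nat
  have h2 := ((tendsto_add_atTop_iff_nat 1).mpr h1).sub_const (c 0)
  simp only [he, ← two_mul, ← Finset.mul_sum, add_sub_cancel_right] at h2
  exact h2

lemma tendsto_trace_toep_mul {a b : ℝ → ℝ} (ha : MemLp a 2 circ) (hea : ∀ x, a (-x) = a x)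
    (hb : MemLp b 2 circ) (heb : ∀ x, b (-x) = b x) :
    Tendsto (fun n : ℕ => (n : ℝ)⁻¹ * (toep a n * toep b n).trace) atTop
      (𝓝 (2 * Real.pi * ∫ x, a x * b x ∂circ)) := by
  have h := tendsto_sum_sub_div (hasSum_cosCoeff_mul ha hea hb heb)
    (fun d => by rw [cosCoeff_neg, cosCoeff_neg])
  refine h.congr fun n => ?_
  congr 1
  simp only [Matrix.trace, Matrix.diag, Matrix.mul_apply]
  refine Finset.sum_congr rfl fun i _ => Finset.sum_congr rfl fun j _ => ?_
  rw [toep, toep, ← cosCoeff_neg b]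
  congr 2
  ring

lemma eventually_trace_toep_mul_le {a b : ℝ → ℝ} {M : ℝ} (ha : Measurable a)
    (hea : ∀ x, a (-x) = a x) (ha0 : 0 ≤ᵐ[circ] a) (haM : ∀ᵐ x ∂circ, a x ≤ M)
    (hb : Integrable b circ) (hbm : Measurable b) (heb : ∀ x, b (-x) = b x) (hb0 : 0 ≤ᵐ[circ] b)
    {ε : ℝ} (hε : 0 < ε) :
    ∀ᶠ n : ℕ in atTop, (toep a n * toep b n).trace ≤
      n * (2 * Real.pi * (∫ x, a x * b x ∂circ) + ε) := by
  have hpi := Real.pi_pos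
  have haM' : ∀ᵐ x ∂circ, ‖a x‖ ≤ M := by
    filter_upwards [ha0, haM] with x h1 h2
    rwa [Real.norm_of_nonneg h1]
  have haL : MemLp a 2 circ := MemLp.of_bound ha.aestronglyMeasurable M haM'
  have hai : Integrable a circ := haL.integrable (by norm_num)
  have hM0 : 0 ≤ |M| := abs_nonneg M
  let bK : ℕ → ℝ → ℝ := fun K x => min (b x) K
  have hbKm : ∀ K, Measurable (bK K) := fun K => hbm.min measurable_const
  have hbK0 : ∀ K, 0 ≤ᵐ[circ] bK K := fun K => by
    filter_upwards [hb0] with x hx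
    exact le_min hx (Nat.cast_nonneg K)
  have hbKL : ∀ K, MemLp (bK K) 2 circ := fun K =>
    MemLp.of_bound (hbKm K).aestronglyMeasurable K (by
      filter_upwards [hbK0 K] with x hx
      rw [Real.norm_of_nonneg hx]
      exact min_le_right _ _)
  have hbKi : ∀ K, Integrable (bK K) circ := fun K => (hbKL K).integrable (by norm_num)
  have hlim : Tendsto (fun K : ℕ => ∫ x, (b x - bK K x) ∂circ) atTop (𝓝 0) := by
    have h := tendsto_integral_of_dominated_convergence (μ := circ)
      (F := fun (K : ℕ) x => b x - bK K x) (f := fun _ => 0) b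
      (fun K => (hbm.sub (hbKm K)).aestronglyMeasurable) hb (fun K => by
        filter_upwards [hbK0 K] with x hx
        have : bK K x ≤ b x := min_le_left _ _
        rw [Real.norm_of_nonneg (by linarith)]
        have : (0 : ℝ) ≤ bK K x := hx
        linarith) (Eventually.of_forall fun x => by
          obtain ⟨K0, hK0⟩ := exists_nat_ge (b x)
          refine tendsto_const_nhds.congr' ?_
          filter_upwards [eventually_ge_atTop K0] with K hK
          have : b x ≤ K := hK0.trans (by exact_mod_cast hK)
          simp [bK, this])
    simpa using h
  have hδ : 0 < ε / 2 / (2 * Real.pi * (|M| + 1)) := by positivity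
  obtain ⟨K, hK⟩ := (hlim.eventually (gt_mem_nhds hδ)).exists
  have hab : Integrable (fun x => a x * b x) circ :=
    hb.bdd_mul (c := M) ha.aestronglyMeasurable haM'
  have hsub : Integrable (fun x => b x - bK K x) circ := hb.sub (hbKi K)
  have habK : Integrable (fun x => a x * bK K x) circ :=
    (hbKi K).bdd_mul (c := M) ha.aestronglyMeasurable haM'
  have hle : ∫ x, a x * bK K x ∂circ ≤ ∫ x, a x * b x ∂circ := by
    refine integral_mono_ae habK hab ?_
    filter_upwards [ha0] with x hx
    exact mul_le_mul_of_nonneg_left (min_le_left _ _) hx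
  have ht := tendsto_trace_toep_mul haL hea (hbKL K) (fun x => by simp only [bK, heb])
  have hev := ht.eventually (gt_mem_nhds (show 2 * Real.pi * ∫ x, a x * bK K x ∂circ <
    2 * Real.pi * (∫ x, a x * bK K x ∂circ) + ε / 2 by linarith))
  filter_upwards [hev, eventually_gt_atTop 0] with n hn hn0
  have hn0' : (0 : ℝ) < n := by exact_mod_cast hn0
  rw [inv_mul_lt_iff₀ hn0'] at hn
  have h2 := trace_toep_mul_le (M := |M|) hai (haM.mono fun x hx => hx.trans (le_abs_self M))
    hsub (by
      filter_upwards with x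
      simp [bK]) n
  have e : toep b n = toep (bK K) n + toep (fun x => b x - bK K x) n := by
    rw [← toep_add (hbKi K) hsub]
    congr 1
    ext x; ring
  rw [e, Matrix.mul_add, trace_add]
  have h3 : 2 * Real.pi * |M| * (∫ x, (b x - bK K x) ∂circ) ≤ ε / 2 := by
    rw [lt_div_iff₀ (by positivity)] at hK
    have h0 : 0 ≤ ∫ x, (b x - bK K x) ∂circ := integral_nonneg fun x => by simp [bK]
    nlinarith
  have h2' : (toep a n * toep (fun x => b x - bK K x) n).trace ≤ n * (ε / 2) := by
    refine h2.trans ?_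
    calc _ = n * (2 * Real.pi * |M| * (∫ x, (b x - bK K x) ∂circ)) := by
          ring
      _ ≤ _ := by gcongr
  have h4 : 2 * Real.pi * (∫ x, a x * bK K x ∂circ) ≤ 2 * Real.pi * (∫ x, a x * b x ∂circ) := by
    gcongr
  nlinarith

/-- The even trigonometric polynomial `∑_{|d| ≤ m} c d cos (d x)`. -/
def cosPoly (m : ℕ) (c : ℤ → ℝ) (x : ℝ) : ℝ :=
  ∑ d ∈ Finset.Icc (-(m : ℤ)) m, c d * Real.cos (d * x)

lemma continuous_cosPoly (m : ℕ) (c : ℤ → ℝ) : Continuous (cosPoly m c) := by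
  unfold cosPoly; fun_prop

lemma cosPoly_neg (m : ℕ) (c : ℤ → ℝ) (x : ℝ) : cosPoly m c (-x) = cosPoly m c x := by
  simp [cosPoly]

lemma sum_mul_sin_eq_zero {m : ℕ} {c : ℤ → ℝ} (he : ∀ d, c (-d) = c d) (x : ℝ) :
    ∑ d ∈ Finset.Icc (-(m : ℤ)) m, c d * Real.sin (d * x) = 0 := by
  have h : ∑ d ∈ Finset.Icc (-(m : ℤ)) m, c d * Real.sin (d * x) =
      ∑ d ∈ Finset.Icc (-(m : ℤ)) m, -(c d * Real.sin (d * x)) := by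
    refine Finset.sum_bij' (fun d _ => -d) (fun d _ => -d) ?_ ?_ (by simp) (by simp) ?_
    · intro d hd; simp only [Finset.mem_Icc] at hd ⊢; omega
    · intro d hd; simp only [Finset.mem_Icc] at hd ⊢; omega
    · intro d _; simp [he]
  rw [Finset.sum_neg_distrib] at h
  linarith

lemma sum_mul_cos_add {m : ℕ} {c : ℤ → ℝ} (he : ∀ d, c (-d) = c d) (A x : ℝ) :
    ∑ d ∈ Finset.Icc (-(m : ℤ)) m, c d * Real.cos (A + d * x) = Real.cos A * cosPoly m c x := by
  have h := sum_mul_sin_eq_zero (m := m) he x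
  calc _ = Real.cos A * cosPoly m c x -
      Real.sin A * ∑ d ∈ Finset.Icc (-(m : ℤ)) m, c d * Real.sin (d * x) := by
        rw [cosPoly, Finset.mul_sum, Finset.mul_sum, ← Finset.sum_sub_distrib]
        refine Finset.sum_congr rfl fun d _ => ?_
        rw [Real.cos_add]; ring
    _ = _ := by rw [h]; ring

lemma sum_fin_band {m k : ℕ} {c : ℤ → ℝ} (h0 : ∀ d, (m : ℤ) < |d| → c d = 0) (F : ℤ → ℝ)
    (j : Fin k) :
    ∑ i : Fin (k + 2 * m), c ((i : ℤ) - j - m) * F i =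
      ∑ d ∈ Finset.Icc (-(m : ℤ)) m, c d * F ((j : ℤ) + m + d) := by
  symm
  have hj := j.2
  refine Finset.sum_bij_ne_zero (fun d hd _ => ⟨((j : ℤ) + m + d).toNat, ?_⟩) ?_ ?_ ?_ ?_
  · simp only [Finset.mem_Icc] at hd; omega
  · intros; exact Finset.mem_univ _
  · intro d₁ h₁ _ d₂ h₂ _ h
    simp only [Finset.mem_Icc, Fin.mk.injEq] at h₁ h₂ h
    omega
  · intro i _ hi
    have hc : c ((i : ℤ) - j - m) ≠ 0 := left_ne_zero_of_mul hi
    have hle : |(i : ℤ) - j - m| ≤ m := by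
      by_contra h
      exact hc (h0 _ (not_le.mp h))
    rw [abs_le] at hle
    refine ⟨(i : ℤ) - j - m, Finset.mem_Icc.mpr hle, ?_, ?_⟩
    · rwa [show (j : ℤ) + m + ((i : ℤ) - j - m) = i by ring]
    · ext; simp only; omega
  · intro d hd _
    simp only [Finset.mem_Icc] at hd
    have : (((((j : ℤ) + m + d).toNat : ℕ)) : ℤ) = (j : ℤ) + m + d := Int.toNat_of_nonneg (by omega)
    simp only [this]
    congr 2
    ring

/-- The band matrix of a convolution, restricted so that no boundary effects occur. -/
def bandMat (m k : ℕ) (c : ℤ → ℝ) : Matrix (Fin (k + 2 * m)) (Fin k) ℝ :=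
  fun i j => c ((i : ℤ) - j - m)

lemma bandMat_transpose_mul_toep_mul {m k : ℕ} {c : ℤ → ℝ} (he : ∀ d, c (-d) = c d)
    (h0 : ∀ d, (m : ℤ) < |d| → c d = 0) {f : ℝ → ℝ} (hf : Integrable f circ) :
    (bandMat m k c)ᵀ * toep f (k + 2 * m) * bandMat m k c =
      toep (fun x => f x * cosPoly m c x ^ 2) k := by
  ext j j'
  rw [Matrix.mul_assoc, Matrix.mul_apply]
  have h1 : ∀ i : Fin (k + 2 * m), (toep f (k + 2 * m) * bandMat m k c) i j' =
      (fun z : ℤ => ∑ d ∈ Finset.Icc (-(m : ℤ)) m, c d * cosCoeff f (z - (j' + m + d))) i := by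
    intro i
    rw [Matrix.mul_apply]
    simp only [toep, bandMat, mul_comm (cosCoeff f _)]
    exact sum_fin_band h0 (fun z => cosCoeff f ((i : ℤ) - z)) j'
  simp_rw [h1, transpose_apply, bandMat]
  refine (sum_fin_band h0 (fun z : ℤ => ∑ d ∈ Finset.Icc (-(m : ℤ)) m,
    c d * cosCoeff f (z - (j' + m + d))) j).trans ?_
  have hi : ∀ A : ℝ, Integrable (fun x => f x * Real.cos (A * x)) circ := integrable_mul_cos hf
  simp only [cosCoeff, Finset.mul_sum, toep]
  simp_rw [← integral_const_mul]
  have e : ∀ d ∈ Finset.Icc (-(m : ℤ)) m,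
      ∑ d' ∈ Finset.Icc (-(m : ℤ)) m, ∫ x, c d * (c d' *
        (f x * Real.cos (((((j : ℤ) + m + d) - ((j' : ℤ) + m + d') : ℤ) : ℝ) * x))) ∂circ =
      ∫ x, ∑ d' ∈ Finset.Icc (-(m : ℤ)) m, c d * (c d' *
        (f x * Real.cos (((((j : ℤ) + m + d) - ((j' : ℤ) + m + d') : ℤ) : ℝ) * x))) ∂circ :=
    fun d _ => (integral_finsetSum _ fun d' _ => ((hi _).const_mul _).const_mul _).symm
  rw [Finset.sum_congr rfl e, ← integral_finsetSum _ fun d _ => integrable_finsetSum _ fun d' _ =>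
    ((hi _).const_mul _).const_mul _]
  refine integral_congr_ae (Eventually.of_forall fun x => ?_)
  simp only
  have e2 : ∀ d : ℤ, ∑ d' ∈ Finset.Icc (-(m : ℤ)) m, c d * (c d' *
        (f x * Real.cos (((((j : ℤ) + m + d) - ((j' : ℤ) + m + d') : ℤ) : ℝ) * x))) =
      f x * cosPoly m c x *
        (c d * Real.cos ((((j : ℤ) - (j' : ℤ) : ℤ) : ℝ) * x + d * x)) := by
    intro d
    have := sum_mul_cos_add (m := m) he (-((((j : ℤ) - (j' : ℤ) : ℤ) : ℝ) * x + d * x)) x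
    rw [Real.cos_neg] at this
    calc _ = f x * c d * ∑ d' ∈ Finset.Icc (-(m : ℤ)) m,
          c d' * Real.cos (-((((j : ℤ) - (j' : ℤ) : ℤ) : ℝ) * x + d * x) + d' * x) := by
          rw [Finset.mul_sum]
          refine Finset.sum_congr rfl fun d' _ => ?_
          rw [← Real.cos_neg (-((((j : ℤ) - (j' : ℤ) : ℤ) : ℝ) * x + d * x) + d' * x)]
          have : -(-((((j : ℤ) - (j' : ℤ) : ℤ) : ℝ) * x + d * x) + d' * x) =
            ((((j : ℤ) + m + d) - ((j' : ℤ) + m + d') : ℤ) : ℝ) * x := by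
            push_cast; ring
          rw [this]; ring
      _ = _ := by rw [this]; ring
  simp_rw [e2]
  rw [← Finset.mul_sum, sum_mul_cos_add he]
  ring

lemma trace_submatrix_mul_bandMat {m k : ℕ} {c : ℤ → ℝ}
    (h0 : ∀ d, (m : ℤ) < |d| → c d = 0) {h : ℝ → ℝ} (hh : Integrable h circ)
    (e : Fin k → Fin (k + 2 * m)) (hee : ∀ j, ((e j : ℕ) : ℤ) = (j : ℕ) + m) :
    ((toep h (k + 2 * m)).submatrix e id * bandMat m k c).trace =
      k * ∫ x, h x * cosPoly m c x ∂circ := by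
  have e1 : ∀ j : Fin k, ((toep h (k + 2 * m)).submatrix e id * bandMat m k c) j j =
      ∫ x, h x * cosPoly m c x ∂circ := by
    intro j
    rw [Matrix.mul_apply]
    simp only [submatrix_apply, id, toep, bandMat, hee, mul_comm (cosCoeff h _)]
    rw [sum_fin_band h0 (fun z => cosCoeff h ((j : ℤ) + m - z)) j]
    have : ∀ d : ℤ, (j : ℤ) + m - (j + m + d) = -d := fun d => by ring
    simp only [this, cosCoeff_neg, cosPoly, Finset.mul_sum]
    simp only [cosCoeff, ← integral_const_mul]
    rw [← integral_finsetSum _ fun d _ => (integrable_mul_cos hh _).const_mul _]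
    refine integral_congr_ae (Eventually.of_forall fun x => ?_)
    exact Finset.sum_congr rfl fun d _ => by ring
  simp [Matrix.trace, e1]

lemma trace_inv_mul_sq_ge {m k : ℕ} {c : ℤ → ℝ} (he : ∀ d, c (-d) = c d)
    (h0 : ∀ d, (m : ℤ) < |d| → c d = 0) {f h : ℝ → ℝ} (hf : Integrable f circ)
    (hf0 : ∀ᵐ x ∂circ, 0 < f x) (hh : Integrable h circ) :
    2 * (k * ∫ x, h x * cosPoly m c x ∂circ) -
      (toep (fun x => f x * cosPoly m c x ^ 2) k * toep f k).trace ≤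
    ((toep f (k + 2 * m))⁻¹ * toep h (k + 2 * m) *
      ((toep f (k + 2 * m))⁻¹ * toep h (k + 2 * m))).trace := by
  let e : Fin k → Fin (k + 2 * m) := fun j => ⟨j + m, by omega⟩
  have hee : ∀ j, ((e j : ℕ) : ℤ) = (j : ℕ) + m := fun j => by simp [e]
  set T := toep f (k + 2 * m) with hT
  set G := toep h (k + 2 * m) with hG
  set V := bandMat m k c with hV
  have hTd : T.PosDef := toep_posDef hf hf0 _
  have hTs : T.IsSymm := toep_isSymm _ _
  have hGs : G.IsSymm := toep_isSymm _ _
  set P := T⁻¹ with hP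
  have hPs : P.PosSemidef := hTd.inv.posSemidef
  have hu : IsUnit T.det := (Matrix.isUnit_iff_isUnit_det _).mp hTd.isUnit
  have hPT : P * T = 1 := Matrix.nonsing_inv_mul _ hu
  have hTP : T * P = 1 := Matrix.mul_nonsing_inv _ hu
  set E : Matrix (Fin (k + 2 * m)) (Fin k) ℝ := (1 : Matrix _ _ ℝ).submatrix id e with hE
  have hEG : ∀ M : Matrix (Fin (k + 2 * m)) (Fin (k + 2 * m)) ℝ, Eᵀ * M = M.submatrix e id := by
    intro M
    ext i j
    simp [hE, Matrix.mul_apply, Matrix.one_apply]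
  have hETE : Eᵀ * T * E = toep f k := by
    rw [hEG]
    ext i j
    simp only [hE, Matrix.mul_apply, Matrix.one_apply, submatrix_apply, id, mul_ite, mul_one,
      mul_zero, Finset.sum_ite_eq', Finset.mem_univ, if_true]
    simp only [hT, toep, hee]
    congr 1
    ring
  have hnn := trace_mul_nonneg hPs (hPs.mul_mul_conjTranspose_same (G - T * V * Eᵀ * T))
  have hX : (G - T * V * Eᵀ * T)ᴴ = G - T * E * Vᵀ * T := by
    rw [conjTranspose_eq_transpose_of_trivial, transpose_sub]
    simp only [transpose_mul, transpose_transpose, hTs.eq, hGs.eq, Matrix.mul_assoc]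
  rw [hX] at hnn
  have hexp : P * ((G - T * V * Eᵀ * T) * P * (G - T * E * Vᵀ * T)) =
      P * G * (P * G) - P * (G * (E * (Vᵀ * T))) - V * (Eᵀ * G) +
        V * (Eᵀ * T * E * (Vᵀ * T)) := by
    have a1 : P * (G - T * V * Eᵀ * T) = P * G - V * Eᵀ * T := by
      rw [Matrix.mul_sub]
      simp only [← Matrix.mul_assoc, hPT, Matrix.one_mul]
    have a2 : P * (G - T * E * Vᵀ * T) = P * G - E * Vᵀ * T := by
      rw [Matrix.mul_sub]
      simp only [← Matrix.mul_assoc, hPT, Matrix.one_mul]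
    rw [Matrix.mul_assoc, a2, ← Matrix.mul_assoc, a1, Matrix.sub_mul, Matrix.mul_sub,
      Matrix.mul_sub]
    have a3 : V * Eᵀ * T * (P * G) = V * (Eᵀ * G) := by
      rw [Matrix.mul_assoc, ← Matrix.mul_assoc T, hTP, Matrix.one_mul, Matrix.mul_assoc]
    rw [a3]
    simp only [Matrix.mul_assoc]
    abel
  rw [hexp] at hnn
  have t1 : (P * (G * (E * (Vᵀ * T)))).trace = (Eᵀ * G * V).trace := by
    rw [trace_mul_comm]
    simp only [Matrix.mul_assoc, hTP, Matrix.mul_one]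
    rw [← trace_transpose]
    simp only [transpose_mul, transpose_transpose, hGs.eq]
    rw [Matrix.mul_assoc, trace_mul_comm, Matrix.mul_assoc]
  have t2 : (V * (Eᵀ * G)).trace = (Eᵀ * G * V).trace := trace_mul_comm _ _
  have t3 : (V * (Eᵀ * T * E * (Vᵀ * T))).trace =
      (toep (fun x => f x * cosPoly m c x ^ 2) k * toep f k).trace := by
    rw [hETE, ← bandMat_transpose_mul_toep_mul he h0 hf, trace_mul_comm, Matrix.mul_assoc,
      trace_mul_comm]
  rw [trace_add, trace_sub, trace_sub, t1, t2, t3, hEG G,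
    trace_submatrix_mul_bandMat h0 hh e hee] at hnn
  linarith

lemma summable_of_band {m : ℕ} {c : ℤ → ℝ} (h0 : ∀ d, (m : ℤ) < |d| → c d = 0) (F : ℤ → ℝ) :
    Summable fun d => c d * F d :=
  summable_of_ne_finset_zero (s := Finset.Icc (-(m : ℤ)) m) fun d hd => by
    rw [h0 d, zero_mul]
    rw [Finset.mem_Icc, ← abs_le] at hd
    omega

lemma cosPoly_eq_tsum {m : ℕ} {c : ℤ → ℝ} (h0 : ∀ d, (m : ℤ) < |d| → c d = 0) (x : ℝ) :
    cosPoly m c x = ∑' d : ℤ, c d * Real.cos (d * x) :=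
  (tsum_eq_sum fun d hd => by
    rw [h0 d, zero_mul]
    rw [Finset.mem_Icc, ← abs_le] at hd
    omega).symm

lemma exists_cosPoly_one_sub_cos_mul {N : ℕ} {c : ℤ → ℝ} (he : ∀ d, c (-d) = c d)
    (h0 : ∀ d, (N : ℤ) < |d| → c d = 0) :
    ∃ (m : ℕ) (c' : ℤ → ℝ), (∀ d, c' (-d) = c' d) ∧ (∀ d, (m : ℤ) < |d| → c' d = 0) ∧
      ∀ x, cosPoly m c' x = (1 - Real.cos x) * cosPoly N c x := by
  have hm : ∀ d : ℤ, ((N + 1 : ℕ) : ℤ) < |d| → (N : ℤ) < |d| ∧ (N : ℤ) < |d - 1| ∧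
      (N : ℤ) < |d + 1| := by
    intro d hd
    push_cast at hd
    have h1 := abs_sub_abs_le_abs_sub d 1
    have h2 := abs_sub_abs_le_abs_sub d (-1)
    rw [abs_neg, sub_neg_eq_add] at h2
    rw [abs_one] at h1 h2
    omega
  have h0' : ∀ d : ℤ, ((N + 1 : ℕ) : ℤ) < |d| → c d - (c (d - 1) + c (d + 1)) / 2 = 0 := by
    intro d hd
    obtain ⟨a, b, e⟩ := hm d hd
    rw [h0 _ a, h0 _ b, h0 _ e]; simp
  refine ⟨N + 1, fun d => c d - (c (d - 1) + c (d + 1)) / 2, fun d => ?_, h0', fun x => ?_⟩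
  · have e1 : c (-d - 1) = c (d + 1) := by rw [← he (d + 1)]; congr 1; ring
    have e2 : c (-d + 1) = c (d - 1) := by rw [← he (d - 1)]; congr 1; ring
    simp only [e1, e2, he, add_comm]
  · rw [cosPoly_eq_tsum h0', cosPoly_eq_tsum h0]
    have s1 := summable_of_band h0 (fun d => Real.cos (d * x))
    have s2 : Summable fun d : ℤ => c (d - 1) * Real.cos (d * x) :=
      summable_of_band (m := N + 1) (fun d hd => h0 _ (hm d hd).2.1) _
    have s3 : Summable fun d : ℤ => c (d + 1) * Real.cos (d * x) :=
      summable_of_band (m := N + 1) (fun d hd => h0 _ (hm d hd).2.2) _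
    have e1 : ∑' d : ℤ, c (d - 1) * Real.cos (d * x) =
        ∑' d : ℤ, c d * Real.cos ((d + 1) * x) := by
      rw [← (Equiv.addRight (1 : ℤ)).tsum_eq]
      simp
    have e2 : ∑' d : ℤ, c (d + 1) * Real.cos (d * x) =
        ∑' d : ℤ, c d * Real.cos ((d - 1) * x) := by
      rw [← (Equiv.subRight (1 : ℤ)).tsum_eq]
      simp
    have s4 := summable_of_band h0 (fun d => Real.cos ((d + 1) * x))
    have s5 := summable_of_band h0 (fun d => Real.cos ((d - 1) * x))
    have e3 : ∀ d : ℤ, (c d - (c (d - 1) + c (d + 1)) / 2) * Real.cos (d * x) =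
        c d * Real.cos (d * x) - (1 / 2) * (c (d - 1) * Real.cos (d * x) +
          c (d + 1) * Real.cos (d * x)) := fun d => by ring
    simp_rw [e3]
    rw [s1.tsum_sub ((s2.add s3).mul_left _), tsum_mul_left, s2.tsum_add s3, e1, e2,
      ← s4.tsum_add s5, sub_mul, one_mul, ← tsum_mul_left, ← tsum_mul_left]
    congr 1
    refine tsum_congr fun d => ?_
    rw [add_mul, sub_mul, one_mul, Real.cos_add, Real.cos_sub]
    ring

lemma cosCoeff_cos (e d : ℤ) : ∫ x, Real.cos (e * x) * Real.cos (d * x) ∂circ =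
    ((if d = e then Real.pi else 0) + if d = -e then Real.pi else 0) := by
  have h1 := cosCoeff_one (e - d)
  have h2 := cosCoeff_one (e + d)
  simp only [cosCoeff, one_mul] at h1 h2
  have i : ∀ k : ℤ, Integrable (fun x : ℝ => Real.cos (k * x)) circ := fun k => by
    simpa using integrable_mul_cos (integrable_const (1 : ℝ)) (k : ℝ)
  have : ∀ x : ℝ, Real.cos (e * x) * Real.cos (d * x) =
      (1 / 2) * (Real.cos (((e - d : ℤ) : ℝ) * x) + Real.cos (((e + d : ℤ) : ℝ) * x)) := by
    intro x
    push_cast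
    rw [sub_mul, add_mul, Real.cos_sub, Real.cos_add]; ring
  simp_rw [this]
  rw [integral_const_mul, integral_add (i _) (i _), h1, h2]
  have e1 : e - d = 0 ↔ d = e := by omega
  have e2 : e + d = 0 ↔ d = -e := by omega
  simp only [e1, e2]
  split_ifs <;> ring

lemma exists_cosPoly_near {h : ℝ → ℝ} (hh : MemLp h 2 circ) (heven : ∀ x, h (-x) = h x)
    {ε : ℝ} (hε : 0 < ε) :
    ∃ (N : ℕ) (c : ℤ → ℝ), (∀ d, c (-d) = c d) ∧ (∀ d, (N : ℤ) < |d| → c d = 0) ∧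
      ∫ x, (h x - cosPoly N c x) ^ 2 ∂circ < ε := by
  have hpi := Real.pi_pos
  have hi : Integrable h circ := hh.integrable (by norm_num)
  have hs := hasSum_sq_cosCoeff hh heven
  have hlim : Tendsto (fun N : ℕ => ∑ d ∈ Finset.Icc (-(N : ℤ)) N, cosCoeff h d ^ 2) atTop
      (𝓝 (2 * Real.pi * ∫ x, h x ^ 2 ∂circ)) := by
    refine hs.comp (tendsto_atTop_finset_of_monotone ?_ ?_)
    · intro a b hab
      exact Finset.Icc_subset_Icc (by omega) (by omega)
    · intro d
      exact ⟨d.natAbs, by rw [Finset.mem_Icc]; omega⟩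
  obtain ⟨N, hN⟩ := (hlim.eventually (lt_mem_nhds (show
    2 * Real.pi * (∫ x, h x ^ 2 ∂circ) - 2 * Real.pi * ε < 2 * Real.pi * ∫ x, h x ^ 2 ∂circ by
      nlinarith [mul_pos hpi hε]))).exists
  set c : ℤ → ℝ := fun d => if |d| ≤ N then cosCoeff h d / (2 * Real.pi) else 0 with hc
  have hcI : ∀ d ∈ Finset.Icc (-(N : ℤ)) N, c d = cosCoeff h d / (2 * Real.pi) := by
    intro d hd
    rw [Finset.mem_Icc, ← abs_le] at hd
    simp [hc, hd]
  have hce : ∀ d, c (-d) = c d := fun d => by simp only [hc, abs_neg, cosCoeff_neg]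
  have ic : ∀ e d : ℤ, Integrable (fun x : ℝ => Real.cos (e * x) * Real.cos (d * x)) circ :=
    fun e d => integrable_mul_cos (by
      simpa using integrable_mul_cos (integrable_const (1 : ℝ)) (e : ℝ)) _
  have hcp : ∀ d ∈ Finset.Icc (-(N : ℤ)) N, cosCoeff (cosPoly N c) d = cosCoeff h d := by
    intro d hd
    simp only [cosCoeff, cosPoly, Finset.sum_mul, mul_assoc]
    rw [integral_finsetSum _ fun e _ => (ic e d).const_mul _]
    simp_rw [integral_const_mul, cosCoeff_cos, mul_add, mul_ite, mul_zero]
    rw [Finset.sum_add_distrib, Finset.sum_ite_eq, if_pos hd]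
    have : ∀ e : ℤ, (d = -e) = (-d = e) := fun e => by rw [eq_iff_iff]; omega
    simp_rw [this]
    rw [Finset.sum_ite_eq, if_pos (by rw [Finset.mem_Icc] at hd ⊢; omega), hce, hcI d hd]
    simp only [cosCoeff]
    field_simp
    ring
  have hu : MemLp (cosPoly N c) 2 circ := by
    refine MemLp.of_bound (C := ∑ d ∈ Finset.Icc (-(N : ℤ)) N, |c d|)
      (continuous_cosPoly N c).aestronglyMeasurable (Eventually.of_forall fun x => ?_)
    refine (Finset.abs_sum_le_sum_abs _ _).trans (Finset.sum_le_sum fun d _ => ?_)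
    rw [abs_mul]
    exact mul_le_of_le_one_right (abs_nonneg _) (Real.abs_cos_le_one _)
  have hgen : ∀ φ : ℝ → ℝ, Integrable φ circ → ∫ x, φ x * cosPoly N c x ∂circ =
      ∑ d ∈ Finset.Icc (-(N : ℤ)) N, c d * cosCoeff φ d := by
    intro φ hφ
    simp only [cosPoly, Finset.mul_sum, cosCoeff]
    rw [integral_finsetSum]
    · refine Finset.sum_congr rfl fun d _ => ?_
      rw [← integral_const_mul]
      congr 1; ext x; ring
    · intro d _
      refine ((integrable_mul_cos hφ d).const_mul (c d)).congr (Eventually.of_forall fun x => ?_)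
      ring
  refine ⟨N, c, hce, fun d hd => by simp [hc, not_le.mpr hd], ?_⟩
  have e1 : ∫ x, h x * cosPoly N c x ∂circ =
      (∑ d ∈ Finset.Icc (-(N : ℤ)) N, cosCoeff h d ^ 2) / (2 * Real.pi) := by
    rw [hgen h hi, Finset.sum_div]
    exact Finset.sum_congr rfl fun d hd => by rw [hcI d hd]; ring
  have e2 : ∫ x, cosPoly N c x * cosPoly N c x ∂circ =
      (∑ d ∈ Finset.Icc (-(N : ℤ)) N, cosCoeff h d ^ 2) / (2 * Real.pi) := by
    rw [hgen _ (hu.integrable (by norm_num)), Finset.sum_div]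
    exact Finset.sum_congr rfl fun d hd => by rw [hcI d hd, hcp d hd]; ring
  have e3 : ∀ x, (h x - cosPoly N c x) ^ 2 = h x ^ 2 - 2 * (h x * cosPoly N c x) +
      cosPoly N c x * cosPoly N c x := fun x => by ring
  have i1 : Integrable (fun x => h x * cosPoly N c x) circ := hh.integrable_mul hu
  have i2 : Integrable (fun x => cosPoly N c x * cosPoly N c x) circ := hu.integrable_mul hu
  have i3 : Integrable (fun x => h x ^ 2 - 2 * (h x * cosPoly N c x)) circ :=
    hh.integrable_sq.sub (i1.const_mul 2)
  simp_rw [e3]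
  rw [integral_add i3 i2,
    integral_sub hh.integrable_sq (i1.const_mul 2), integral_const_mul, e1, e2]
  have : (∫ x, h x ^ 2 ∂circ) - ε <
      (∑ d ∈ Finset.Icc (-(N : ℤ)) N, cosCoeff h d ^ 2) / (2 * Real.pi) := by
    rw [lt_div_iff₀ (by positivity)]
    linarith
  linarith

lemma ae_circ_one_sub_cos_pos : ∀ᵐ x ∂circ, 0 < 1 - Real.cos x := by
  have h0 : ∀ᵐ x ∂circ, x ≠ 0 := ae_restrict_of_ae (Measure.ae_ne volume 0)
  filter_upwards [h0, ae_restrict_mem measurableSet_Ioc] with x hx hm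
  have hpi := Real.pi_pos
  have := (Real.cos_eq_one_iff_of_lt_of_lt (x := x) (by linarith [hm.1])
    (by linarith [hm.2])).not.mpr hx
  have h1 := Real.cos_le_one x
  rcases h1.lt_or_eq with h | h
  · linarith
  · exact absurd h this

section Szego

variable {f g : ℝ → ℝ}

lemma eventually_trace_inv_mul_sq_le (hfm : Measurable f) (hgm : Measurable g)
    (hfe : ∀ x, f (-x) = f x) (hge : ∀ x, g (-x) = g x)
    (hf0 : ∀ᵐ x ∂circ, 0 < f x) (hf : Integrable f circ) (hf' : Integrable (fun x => 1 / f x) circ)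
    (hfg : Integrable (fun x => f x * g x) circ) (hfg2 : Integrable (fun x => f x * g x ^ 2) circ)
    (hb : (∃ M, ∀ᵐ x ∂circ, 1 / f x ≤ M) ∨ ∃ M, ∀ᵐ x ∂circ, f x * g x ^ 2 ≤ M)
    {ε : ℝ} (hε : 0 < ε) :
    ∀ᶠ n : ℕ in atTop, ((toep f n)⁻¹ * toep (fun x => f x * g x) n *
      ((toep f n)⁻¹ * toep (fun x => f x * g x) n)).trace ≤
        n * (1 / (2 * Real.pi) * (∫ x, g x ^ 2 ∂circ) + ε) := by
  have hpi := Real.pi_pos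
  have hae : 0 ≤ᵐ[circ] fun x => 1 / f x := by
    filter_upwards [hf0] with x hx using by positivity
  have hbe : 0 ≤ᵐ[circ] fun x => f x * g x ^ 2 := by
    filter_upwards [hf0] with x hx using by positivity
  have hI : ∫ x, 1 / f x * (f x * g x ^ 2) ∂circ = ∫ x, g x ^ 2 ∂circ := by
    refine integral_congr_ae ?_
    filter_upwards [hf0] with x hx
    field_simp
  have hI' : ∫ x, f x * g x ^ 2 * (1 / f x) ∂circ = ∫ x, g x ^ 2 ∂circ := by
    rw [← hI]; congr 1; ext x; ring
  have key : ∀ᶠ n : ℕ in atTop,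
      (toep (fun x => 1 / f x) n * toep (fun x => f x * g x ^ 2) n).trace ≤
      n * (2 * Real.pi * (∫ x, g x ^ 2 ∂circ) + 4 * Real.pi ^ 2 * ε) := by
    rcases hb with ⟨M, hM⟩ | ⟨M, hM⟩
    · have := eventually_trace_toep_mul_le (a := fun x => 1 / f x) (b := fun x => f x * g x ^ 2)
        (by fun_prop) (by simp [hfe]) hae hM hfg2 (by fun_prop) (by simp [hfe, hge]) hbe
        (ε := 4 * Real.pi ^ 2 * ε) (by positivity)
      rwa [hI] at this
    · have := eventually_trace_toep_mul_le (b := fun x => 1 / f x) (a := fun x => f x * g x ^ 2)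
        (by fun_prop) (by simp [hfe, hge]) hbe hM hf' (by fun_prop) (by simp [hfe]) hae
        (ε := 4 * Real.pi ^ 2 * ε) (by positivity)
      rw [hI'] at this
      filter_upwards [this] with n hn
      rwa [Matrix.trace_mul_comm]
  filter_upwards [key] with n hn
  refine (trace_inv_mul_sq_le (toep_posDef hf hf0 n) (toep_schur hf hf0 hfg hfg2 n)).trans ?_
  refine (trace_inv_toep_mul_le hf hf0 hf' hfg2 hbe n).trans ?_
  refine (mul_le_mul_of_nonneg_left hn (by positivity)).trans (le_of_eq ?_)
  field_simp
  ring

lemma exists_cosPoly_weighted_near (hfm : Measurable f) (hgm : Measurable g)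
    (hfe : ∀ x, f (-x) = f x) (hge : ∀ x, g (-x) = g x)
    (hf0 : ∀ᵐ x ∂circ, 0 < f x) (hg2 : Integrable (fun x => g x ^ 2) circ)
    {W : ℝ} (hW : ∀ᵐ x ∂circ, f x * (1 - Real.cos x) ≤ W) {δ : ℝ} (hδ : 0 < δ) :
    ∃ (m : ℕ) (c : ℤ → ℝ) (M : ℝ), (∀ d, c (-d) = c d) ∧ (∀ d, (m : ℤ) < |d| → c d = 0) ∧
      (∀ᵐ x ∂circ, f x * cosPoly m c x ^ 2 ≤ M) ∧
      ∫ x, (g x - 2 * Real.pi * f x * cosPoly m c x) ^ 2 ∂circ < δ := by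
  have hpi := Real.pi_pos
  set w : ℝ → ℝ := fun x => 2 * Real.pi * f x * (1 - Real.cos x) with hw
  have hwm : Measurable w := by fun_prop
  have hw0 : ∀ᵐ x ∂circ, 0 < w x ∧ w x ≤ 2 * Real.pi * W := by
    filter_upwards [hf0, hW, ae_circ_one_sub_cos_pos] with x h1 h2 h3
    refine ⟨by simp only [hw]; positivity, ?_⟩
    simp only [hw, mul_assoc]
    gcongr
  set gK : ℕ → ℝ → ℝ := fun K => ({x | 1 < w x * K} ∩ {x | |g x| ≤ K}).indicator g with hgK
  have hgKm : ∀ K, Measurable (gK K) := fun K => hgm.indicator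
    ((measurableSet_lt measurable_const (hwm.mul_const _)).inter
      (measurableSet_le hgm.abs measurable_const))
  have hlim : Tendsto (fun K => ∫ x, (g x - gK K x) ^ 2 ∂circ) atTop (𝓝 0) := by
    have : Tendsto (fun K => ∫ x, (g x - gK K x) ^ 2 ∂circ) atTop (𝓝 (∫ x, (0 : ℝ) ∂circ)) := by
      refine tendsto_integral_of_dominated_convergence (fun x => g x ^ 2)
        (fun K => ((hgm.sub (hgKm K)).pow_const 2).aestronglyMeasurable) hg2 (fun K => ?_) ?_
      · refine Eventually.of_forall fun x => ?_
        rw [Real.norm_of_nonneg (sq_nonneg _)]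
        by_cases hx : x ∈ ({x | 1 < w x * K} ∩ {x | |g x| ≤ K})
        · simp only [hgK, Set.indicator_of_mem hx, sub_self, zero_pow two_ne_zero]; positivity
        · simp only [hgK, Set.indicator_of_notMem hx, sub_zero, le_refl]
      · filter_upwards [hw0] with x hx
        refine tendsto_const_nhds.congr' ?_
        have t1 : ∀ᶠ K : ℕ in atTop, |g x| ≤ K :=
          (tendsto_natCast_atTop_atTop (R := ℝ)).eventually_ge_atTop _
        have t2 : ∀ᶠ K : ℕ in atTop, 1 / w x < K :=
          (tendsto_natCast_atTop_atTop (R := ℝ)).eventually_gt_atTop _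
        filter_upwards [t1, t2] with K h1 h2
        have hm : x ∈ ({x | 1 < w x * K} ∩ {x | |g x| ≤ K}) :=
          ⟨show 1 < w x * K by rw [div_lt_iff₀ hx.1] at h2; linarith, h1⟩
        simp only [hgK, Set.indicator_of_mem hm, sub_self]; norm_num
    simpa using this
  obtain ⟨K, hK⟩ := (hlim.eventually_lt_const (show 0 < δ / 4 by positivity)).exists
  set h : ℝ → ℝ := fun x => gK K x / w x with hh
  have hhb : ∀ x, |h x| ≤ (K : ℝ) ^ 2 := by
    intro x
    by_cases hx : x ∈ ({x | 1 < w x * K} ∩ {x | |g x| ≤ K})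
    · simp only [hh, hgK, Set.indicator_of_mem hx, abs_div]
      have h1 : 1 < w x * K := hx.1
      have h2 : |g x| ≤ K := hx.2
      have hKp : (0 : ℝ) ≤ K := Nat.cast_nonneg K
      have hwp : 0 < w x := by
        by_contra hc
        nlinarith
      rw [abs_of_pos hwp, div_le_iff₀ hwp]
      nlinarith
    · simp only [hh, hgK, Set.indicator_of_notMem hx]; simp
  have hhm : Measurable h := (hgKm K).div hwm
  have hh2 : MemLp h 2 circ := MemLp.of_bound hhm.aestronglyMeasurable ((K : ℝ) ^ 2)
    (Eventually.of_forall hhb)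
  have hwe : ∀ x, w (-x) = w x := fun x => by simp [hw, hfe]
  have hhe : ∀ x, h (-x) = h x := fun x => by
    simp only [hh, hgK, hwe, Set.indicator, Set.mem_inter_iff, Set.mem_ofPred_eq, hge]
  obtain ⟨N, c, hce, hc0, hcN⟩ := exists_cosPoly_near hh2 hhe
    (show 0 < δ / (4 * (2 * Real.pi * W) ^ 2 + 4) by positivity)
  obtain ⟨m, c', he', h0', hv⟩ := exists_cosPoly_one_sub_cos_mul hce hc0
  set U : ℝ := ∑ d ∈ Finset.Icc (-(N : ℤ)) N, |c d| with hU
  have hub : ∀ x, |cosPoly N c x| ≤ U := fun x => by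
    refine (Finset.abs_sum_le_sum_abs _ _).trans (Finset.sum_le_sum fun d _ => ?_)
    rw [abs_mul]
    exact mul_le_of_le_one_right (abs_nonneg _) (Real.abs_cos_le_one _)
  refine ⟨m, c', W * (2 * U ^ 2), he', h0', ?_, ?_⟩
  · filter_upwards [hf0, hW, ae_circ_one_sub_cos_pos] with x h1 h2 h3
    have e : f x * cosPoly m c' x ^ 2 =
        f x * (1 - Real.cos x) * ((1 - Real.cos x) * cosPoly N c x ^ 2) := by rw [hv]; ring
    rw [e]
    have h4 : cosPoly N c x ^ 2 ≤ U ^ 2 := by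
      rw [← sq_abs]; exact pow_le_pow_left₀ (abs_nonneg _) (hub x) 2
    have h5 := Real.neg_one_le_cos x
    have h6 : 0 < f x * (1 - Real.cos x) := by positivity
    exact mul_le_mul h2 (mul_le_mul (by linarith) h4 (by positivity) (by norm_num))
      (by positivity) (by linarith)
  · have i1 : Integrable (fun x => (g x - gK K x) ^ 2) circ := by
      refine hg2.mono' ((hgm.sub (hgKm K)).pow_const 2).aestronglyMeasurable
        (Eventually.of_forall fun x => ?_)
      rw [Real.norm_of_nonneg (sq_nonneg _)]
      by_cases hx : x ∈ ({x | 1 < w x * K} ∩ {x | |g x| ≤ K})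
      · simp only [hgK, Set.indicator_of_mem hx, sub_self, zero_pow two_ne_zero]; positivity
      · simp only [hgK, Set.indicator_of_notMem hx, sub_zero, le_refl]
    have hu2 : MemLp (cosPoly N c) 2 circ := MemLp.of_bound
      (continuous_cosPoly N c).aestronglyMeasurable U (Eventually.of_forall hub)
    have i2 : Integrable (fun x => (h x - cosPoly N c x) ^ 2) circ := (hh2.sub hu2).integrable_sq
    have hle : ∫ x, (g x - 2 * Real.pi * f x * cosPoly m c' x) ^ 2 ∂circ ≤
        ∫ x, 2 * (g x - gK K x) ^ 2 + 2 * (2 * Real.pi * W) ^ 2 *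
          (h x - cosPoly N c x) ^ 2 ∂circ := by
      refine integral_mono_of_nonneg (Eventually.of_forall fun x => sq_nonneg _)
        ((i1.const_mul 2).add (i2.const_mul _)) ?_
      filter_upwards [hw0] with x hx
      have e1 : w x * h x = gK K x := by simp only [hh]; field_simp [hx.1.ne']
      have e2 : g x - 2 * Real.pi * f x * cosPoly m c' x =
          (g x - gK K x) + w x * (h x - cosPoly N c x) := by
        rw [mul_sub, e1, hv]; simp only [hw]; ring
      have e3 : w x ^ 2 ≤ (2 * Real.pi * W) ^ 2 := pow_le_pow_left₀ hx.1.le hx.2 2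
      have e4 : w x ^ 2 * (h x - cosPoly N c x) ^ 2 ≤
          (2 * Real.pi * W) ^ 2 * (h x - cosPoly N c x) ^ 2 := by gcongr
      rw [e2]
      nlinarith [sq_nonneg ((g x - gK K x) - w x * (h x - cosPoly N c x))]
    rw [integral_add (i1.const_mul 2) (i2.const_mul _), integral_const_mul,
      integral_const_mul] at hle
    rw [lt_div_iff₀ (by positivity)] at hcN
    have : 0 ≤ ∫ x, (h x - cosPoly N c x) ^ 2 ∂circ := integral_nonneg fun x => sq_nonneg _
    nlinarith

lemma eventually_le_trace_inv_mul_sq (hfm : Measurable f) (hgm : Measurable g)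
    (hfe : ∀ x, f (-x) = f x) (hge : ∀ x, g (-x) = g x)
    (hf0 : ∀ᵐ x ∂circ, 0 < f x) (hf : Integrable f circ)
    (hfg : Integrable (fun x => f x * g x) circ) (hg2 : Integrable (fun x => g x ^ 2) circ)
    {W : ℝ} (hW : ∀ᵐ x ∂circ, f x * (1 - Real.cos x) ≤ W) {ε : ℝ} (hε : 0 < ε) :
    ∀ᶠ n : ℕ in atTop, n * (1 / (2 * Real.pi) * (∫ x, g x ^ 2 ∂circ) - ε) ≤
      ((toep f n)⁻¹ * toep (fun x => f x * g x) n *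
        ((toep f n)⁻¹ * toep (fun x => f x * g x) n)).trace := by
  have hpi := Real.pi_pos
  obtain ⟨m, c, M, he, h0, hM, hd⟩ := exists_cosPoly_weighted_near hfm hgm hfe hge hf0 hg2 hW
    (show 0 < 2 * Real.pi * (ε / 3) by positivity)
  have hvc := continuous_cosPoly m c
  have hvm : Measurable (cosPoly m c) := hvc.measurable
  have ha0 : 0 ≤ᵐ[circ] fun x => f x * cosPoly m c x ^ 2 := by
    filter_upwards [hf0] with x hx using by positivity
  set v := cosPoly m c with hv
  set U : ℝ := ∑ d ∈ Finset.Icc (-(m : ℤ)) m, |c d| with hU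
  have hub : ∀ x, |v x| ≤ U := fun x => by
    refine (Finset.abs_sum_le_sum_abs _ _).trans (Finset.sum_le_sum fun d _ => ?_)
    rw [abs_mul]
    exact mul_le_of_le_one_right (abs_nonneg _) (Real.abs_cos_le_one _)
  have i1 : Integrable (fun x => f x * g x * v x) circ :=
    hfg.mul_bdd (c := U) (by fun_prop) (Eventually.of_forall hub)
  have i2 : Integrable (fun x => f x * v x ^ 2 * f x) circ := by
    refine hf.bdd_mul (c := M) (by fun_prop) ?_
    filter_upwards [ha0, hM] with x h1 h2
    rwa [Real.norm_of_nonneg h1]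
  have hL : 2 * (∫ x, f x * g x * v x ∂circ) - 2 * Real.pi * ∫ x, f x * v x ^ 2 * f x ∂circ =
      1 / (2 * Real.pi) * ((∫ x, g x ^ 2 ∂circ) -
        ∫ x, (g x - 2 * Real.pi * f x * v x) ^ 2 ∂circ) := by
    have e : ∀ x, (g x - 2 * Real.pi * f x * v x) ^ 2 =
        g x ^ 2 - 4 * Real.pi * (f x * g x * v x) + 4 * Real.pi ^ 2 * (f x * v x ^ 2 * f x) :=
      fun x => by ring
    have i3 : Integrable (fun x => g x ^ 2 - 4 * Real.pi * (f x * g x * v x)) circ :=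
      hg2.sub (i1.const_mul _)
    simp_rw [e]
    rw [integral_add i3 (i2.const_mul _), integral_sub hg2 (i1.const_mul _), integral_const_mul,
      integral_const_mul]
    field_simp
    ring
  set L := 1 / (2 * Real.pi) * (∫ x, g x ^ 2 ∂circ) with hLdef
  have hL1 : L - ε / 3 ≤ 2 * (∫ x, f x * g x * v x ∂circ) -
      2 * Real.pi * ∫ x, f x * v x ^ 2 * f x ∂circ := by
    rw [hL, mul_sub, ← hLdef]
    have : 1 / (2 * Real.pi) * ∫ x, (g x - 2 * Real.pi * f x * v x) ^ 2 ∂circ ≤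
        1 / (2 * Real.pi) * (2 * Real.pi * (ε / 3)) := by gcongr
    have e : 1 / (2 * Real.pi) * (2 * Real.pi * (ε / 3)) = ε / 3 := by field_simp
    linarith
  have hve : ∀ x, v (-x) = v x := fun x => cosPoly_neg m c x
  have key := eventually_trace_toep_mul_le (a := fun x => f x * v x ^ 2) (b := f)
    (by fun_prop) (by simp [hfe, hve]) ha0 hM hf hfm hfe (hf0.mono fun x hx => hx.le)
    (ε := ε / 3) (by positivity)
  have hbig : ∀ᶠ k : ℕ in atTop, 2 * m * (L - 2 * ε / 3) ≤ k * (ε / 3) := by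
    have : Tendsto (fun k : ℕ => (k : ℝ) * (ε / 3)) atTop atTop :=
      tendsto_natCast_atTop_atTop.atTop_mul_const (by positivity)
    exact this.eventually_ge_atTop _
  have hk : ∀ᶠ k : ℕ in atTop, ((k + 2 * m : ℕ) : ℝ) * (L - ε) ≤
      ((toep f (k + 2 * m))⁻¹ * toep (fun x => f x * g x) (k + 2 * m) *
        ((toep f (k + 2 * m))⁻¹ * toep (fun x => f x * g x) (k + 2 * m))).trace := by
    filter_upwards [key, hbig] with k h1 h2
    refine le_trans ?_ (trace_inv_mul_sq_ge he h0 hf hf0 hfg)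
    rw [← hv]
    have h3 : (k : ℝ) * (L - ε / 3) ≤ k * (2 * (∫ x, f x * g x * v x ∂circ) -
      2 * Real.pi * ∫ x, f x * v x ^ 2 * f x ∂circ) :=
      mul_le_mul_of_nonneg_left hL1 (Nat.cast_nonneg k)
    push_cast
    have hm : (0 : ℝ) ≤ m := Nat.cast_nonneg m
    nlinarith
  obtain ⟨k0, hk0⟩ := eventually_atTop.mp hk
  refine eventually_atTop.mpr ⟨k0 + 2 * m, fun n hn => ?_⟩
  have := hk0 (n - 2 * m) (by omega)
  rwa [Nat.sub_add_cancel (by omega)] at this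

/-- Szegő-type limit for the normalized trace of the square of a quotient of Toeplitz matrices. -/
lemma tendsto_trace_inv_mul_sq (hfm : Measurable f) (hgm : Measurable g)
    (hfe : ∀ x, f (-x) = f x) (hge : ∀ x, g (-x) = g x)
    (hf0 : ∀ᵐ x ∂circ, 0 < f x) (hf : Integrable f circ) (hf' : Integrable (fun x => 1 / f x) circ)
    (hfg : Integrable (fun x => f x * g x) circ) (hfg2 : Integrable (fun x => f x * g x ^ 2) circ)
    (hg2 : Integrable (fun x => g x ^ 2) circ)
    (hb : (∃ M, ∀ᵐ x ∂circ, 1 / f x ≤ M) ∨ ∃ M, ∀ᵐ x ∂circ, f x * g x ^ 2 ≤ M)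
    (hW : ∃ W, ∀ᵐ x ∂circ, f x * (1 - Real.cos x) ≤ W) :
    Tendsto (fun n : ℕ => 1 / (n : ℝ) * ((toep f n)⁻¹ * toep (fun x => f x * g x) n *
      ((toep f n)⁻¹ * toep (fun x => f x * g x) n)).trace) atTop
      (𝓝 (1 / (2 * Real.pi) * ∫ x, g x ^ 2 ∂circ)) := by
  obtain ⟨W, hW⟩ := hW
  rw [Metric.tendsto_nhds]
  intro ε hε
  filter_upwards [eventually_trace_inv_mul_sq_le hfm hgm hfe hge hf0 hf hf' hfg hfg2 hb
    (half_pos hε), eventually_le_trace_inv_mul_sq hfm hgm hfe hge hf0 hf hfg hg2 hW (half_pos hε),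
    eventually_gt_atTop 0] with n h1 h2 hn
  have hn' : (0 : ℝ) < n := by exact_mod_cast hn
  rw [Real.dist_eq, one_div_mul_eq_div, abs_lt]
  constructor
  · rw [← sub_pos]
    have := (le_div_iff₀' hn').mpr h2
    linarith
  · have := (div_le_iff₀' hn').mpr h1
    linarith

/-- Linear bound for the traces of powers of a quotient of Toeplitz matrices. -/
lemma exists_trace_inv_toep_mul_le (hf0 : ∀ᵐ x ∂circ, 0 < f x) (hf : Integrable f circ)
    (hf' : Integrable (fun x => 1 / f x) circ) {b : ℝ → ℝ} (hb : Integrable b circ)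
    (hb0 : 0 ≤ᵐ[circ] b)
    (hM : (∃ M, ∀ᵐ x ∂circ, 1 / f x ≤ M) ∨ ∃ M, ∀ᵐ x ∂circ, b x ≤ M) :
    ∃ C : ℝ, ∀ n : ℕ, ((toep f n)⁻¹ * toep b n).trace ≤ C * n := by
  have hpi := Real.pi_pos
  have hae : 0 ≤ᵐ[circ] fun x => 1 / f x := by
    filter_upwards [hf0] with x hx using by positivity
  rcases hM with ⟨M, hM⟩ | ⟨M, hM⟩
  · refine ⟨1 / (4 * Real.pi ^ 2) * (2 * Real.pi * M * ∫ x, b x ∂circ), fun n => ?_⟩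
    refine (trace_inv_toep_mul_le hf hf0 hf' hb hb0 n).trans ?_
    refine (mul_le_mul_of_nonneg_left (trace_toep_mul_le hf' hM hb hb0 n) (by positivity)).trans
      (le_of_eq (by ring))
  · refine ⟨1 / (4 * Real.pi ^ 2) * (2 * Real.pi * M * ∫ x, 1 / f x ∂circ), fun n => ?_⟩
    refine (trace_inv_toep_mul_le hf hf0 hf' hb hb0 n).trans ?_
    rw [Matrix.trace_mul_comm]
    refine (mul_le_mul_of_nonneg_left (trace_toep_mul_le hb hM hf' hae n) (by positivity)).trans
      (le_of_eq (by ring))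

lemma exists_trace_inv_mul_sq_le (hf0 : ∀ᵐ x ∂circ, 0 < f x) (hf : Integrable f circ)
    (hf' : Integrable (fun x => 1 / f x) circ)
    (hfg : Integrable (fun x => f x * g x) circ) (hfg2 : Integrable (fun x => f x * g x ^ 2) circ)
    (hM : (∃ M, ∀ᵐ x ∂circ, 1 / f x ≤ M) ∨ ∃ M, ∀ᵐ x ∂circ, f x * g x ^ 2 ≤ M) :
    ∃ C : ℝ, ∀ n : ℕ, ((toep f n)⁻¹ * toep (fun x => f x * g x) n *
      ((toep f n)⁻¹ * toep (fun x => f x * g x) n)).trace ≤ C * n := by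
  obtain ⟨C, hC⟩ := exists_trace_inv_toep_mul_le hf0 hf hf' hfg2
    (by filter_upwards [hf0] with x hx using by positivity) hM
  exact ⟨C, fun n => (trace_inv_mul_sq_le (toep_posDef hf hf0 n)
    (toep_schur hf hf0 hfg hfg2 n)).trans (hC n)⟩

lemma exists_trace_inv_mul_pow_four_le (hf0 : ∀ᵐ x ∂circ, 0 < f x) (hf : Integrable f circ)
    (hf' : Integrable (fun x => 1 / f x) circ)
    (hfg : Integrable (fun x => f x * g x) circ) (hfg2 : Integrable (fun x => f x * g x ^ 2) circ)
    (hfg4 : Integrable (fun x => f x * (g x ^ 2) ^ 2) circ)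
    (hM : (∃ M, ∀ᵐ x ∂circ, 1 / f x ≤ M) ∨ ∃ M, ∀ᵐ x ∂circ, f x * (g x ^ 2) ^ 2 ≤ M) :
    ∃ C : ℝ, ∀ n : ℕ, ((toep f n)⁻¹ * toep (fun x => f x * g x) n *
      ((toep f n)⁻¹ * toep (fun x => f x * g x) n) *
      ((toep f n)⁻¹ * toep (fun x => f x * g x) n *
      ((toep f n)⁻¹ * toep (fun x => f x * g x) n))).trace ≤ C * n := by
  obtain ⟨C, hC⟩ := exists_trace_inv_mul_sq_le (g := fun x => g x ^ 2) hf0 hf hf' hfg2 hfg4 hM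
  exact ⟨C, fun n => (trace_inv_mul_pow_four_le (toep_posDef hf hf0 n) (toep_isSymm _ _)
    (toep_schur hf hf0 hfg hfg2 n)).trans (hC n)⟩

end Szego

/-- Tonelli's theorem for nonnegative kernels with explicitly known partial integrals. -/
lemma integrable_integral_of_swap {X Y : Type*} [MeasurableSpace X] [MeasurableSpace Y]
    {μ : Measure X} {ν : Measure Y} [SFinite μ] [SFinite ν] {F : X → Y → ℝ} {A : X → ℝ} {B : Y → ℝ}
    (hF : AEStronglyMeasurable (Function.uncurry F) (μ.prod ν))
    (h0 : ∀ᵐ y ∂ν, ∀ᵐ x ∂μ, 0 ≤ F x y) (hA : ∀ᵐ x ∂μ, ∫ y, F x y ∂ν = A x)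
    (hBi : ∀ᵐ y ∂ν, Integrable (fun x => F x y) μ) (hB : ∀ᵐ y ∂ν, ∫ x, F x y ∂μ = B y)
    (hi : Integrable B ν) : Integrable A μ ∧ ∫ x, A x ∂μ = ∫ y, B y ∂ν := by
  have h : Integrable (Function.uncurry F) (μ.prod ν) := by
    rw [integrable_prod_iff' hF]
    refine ⟨hBi, hi.congr ?_⟩
    filter_upwards [h0, hB] with y h1 h2
    rw [← h2]
    refine integral_congr_ae ?_
    filter_upwards [h1] with x hx
    exact (Real.norm_of_nonneg hx).symm
  refine ⟨h.integral_prod_left.congr hA, ?_⟩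
  rw [← integral_congr_ae hA, ← integral_congr_ae hB]
  exact integral_integral_swap h

/-- `(0,∞)` with Lebesgue measure. -/
abbrev half : Measure ℝ := volume.restrict (Set.Ioi 0)

lemma ae_half_pos : ∀ᵐ x ∂half, 0 < x := ae_restrict_mem measurableSet_Ioi

lemma integrable_rpow_mul_exp {a r : ℝ} (ha : 0 < a) (hr : 0 < r) :
    Integrable (fun t => t ^ (a - 1) * Real.exp (-(r * t))) half := by
  have := integrableOn_rpow_mul_exp_neg_mul_rpow (p := 1) (s := a - 1) (b := r) (by linarith)
    one_pos hr
  simpa [IntegrableOn, neg_mul] using this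

lemma integrable_exp_neg_mul {t : ℝ} (ht : 0 < t) :
    Integrable (fun x => Real.exp (-(t * x))) half := by
  simpa using integrable_rpow_mul_exp one_pos ht

lemma integral_exp_neg_mul {t : ℝ} (ht : 0 < t) : ∫ x, Real.exp (-(t * x)) ∂half = 1 / t := by
  have := Real.integral_rpow_mul_exp_neg_mul_Ioi one_pos ht
  simpa using this

lemma integral_cos_mul_exp_neg {t : ℝ} (ht : 0 < t) :
    ∫ x, Real.cos x * Real.exp (-(t * x)) ∂half = t / (1 + t ^ 2) := by
  have hre : (-(t : ℂ) + Complex.I).re < 0 := by simpa using ht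
  have h := integral_exp_mul_complex_Ioi hre 0
  have hi := integrableOn_exp_mul_complex_Ioi hre 0
  have e : ∀ x : ℝ, (Complex.exp ((-(t : ℂ) + Complex.I) * x)).re =
      Real.cos x * Real.exp (-(t * x)) := fun x => by
    rw [Complex.exp_re]
    simp [mul_comm]
  have h2 := integral_re (𝕜 := ℂ) (μ := half) hi
  simp only [RCLike.re_to_complex, e] at h2
  rw [h2, h]
  simp [Complex.normSq, Complex.div_re]
  have : (0 : ℝ) < t * t + 1 := by positivity
  field_simp
  ring

lemma integral_one_sub_cos_mul_exp {t : ℝ} (ht : 0 < t) :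
    Integrable (fun x => (1 - Real.cos x) * Real.exp (-(t * x))) half ∧
    ∫ x, (1 - Real.cos x) * Real.exp (-(t * x)) ∂half = 1 / (t * (1 + t ^ 2)) := by
  have h1 := integrable_exp_neg_mul ht
  have h2 : Integrable (fun x => Real.cos x * Real.exp (-(t * x))) half :=
    h1.bdd_mul (c := 1) (by fun_prop) (Eventually.of_forall fun x => by
      simpa using Real.abs_cos_le_one _)
  simp only [sub_mul, one_mul]
  refine ⟨h1.sub h2, ?_⟩
  rw [integral_sub h1 h2, integral_exp_neg_mul ht, integral_cos_mul_exp_neg ht]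
  have : 1 + t ^ 2 ≠ 0 := by positivity
  field_simp
  ring

lemma integral_rpow_div_one_add_sq {h : ℝ} (h0 : 0 < h) (h1 : h < 1) :
    Integrable (fun t => t ^ (2 * h - 1) / (1 + t ^ 2)) half ∧
    ∫ t, t ^ (2 * h - 1) / (1 + t ^ 2) ∂half = Real.pi / (2 * Real.sin (Real.pi * h)) := by
  have hB := (integrable_rpow_mul_exp (a := 1 - h) (r := 1) (by linarith) one_pos).const_mul
    (Real.Gamma h / 2)
  have hBv : ∫ s, Real.Gamma h / 2 * (s ^ (1 - h - 1) * Real.exp (-(1 * s))) ∂half =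
      Real.pi / (2 * Real.sin (Real.pi * h)) := by
    rw [integral_const_mul, Real.integral_rpow_mul_exp_neg_mul_Ioi (by linarith) one_pos]
    have := Real.Gamma_mul_Gamma_one_sub h
    rw [div_one, Real.one_rpow, one_mul, div_mul_eq_mul_div, this]
    field_simp
  rw [← hBv]
  refine integrable_integral_of_swap
    (F := fun t s => t ^ (2 * h - 1) * Real.exp (-((1 + t ^ 2) * s))) ?_ ?_ ?_ ?_ ?_ hB
  · exact Measurable.aestronglyMeasurable (by unfold Function.uncurry; fun_prop)
  · refine Eventually.of_forall fun s => ?_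
    filter_upwards [ae_half_pos] with t ht using by positivity
  · refine Eventually.of_forall fun t => ?_
    rw [integral_const_mul, integral_exp_neg_mul (by positivity), mul_one_div]
  · filter_upwards [ae_half_pos] with s hs
    have := (integrableOn_rpow_mul_exp_neg_mul_rpow (p := 2) (s := 2 * h - 1) (b := s)
      (by linarith) two_pos hs).const_mul (Real.exp (-s))
    refine this.congr (Eventually.of_forall fun t => ?_)
    dsimp only
    rw [mul_left_comm, ← Real.exp_add, Real.rpow_two]
    congr 2; ring
  · filter_upwards [ae_half_pos] with s hs
    have := integral_rpow_mul_exp_neg_mul_rpow (p := 2) (q := 2 * h - 1) (b := s) two_pos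
      (by linarith) hs
    have e : ∀ t : ℝ, t ^ (2 * h - 1) * Real.exp (-((1 + t ^ 2) * s)) =
        Real.exp (-s) * (t ^ (2 * h - 1) * Real.exp (-s * t ^ (2 : ℝ))) := fun t => by
      rw [mul_left_comm, ← Real.exp_add, Real.rpow_two]
      congr 2; ring
    simp_rw [e]
    rw [integral_const_mul, this, show (2 * h - 1 + 1) / 2 = h by ring,
      show -(2 * h - 1 + 1) / 2 = 1 - h - 1 by ring, one_mul]
    ring

lemma integrable_comp_abs {φ : ℝ → ℝ} (h : Integrable φ half) : Integrable fun x => φ |x| := by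
  have h1 : IntegrableOn (fun x => φ |x|) (Set.Ioi 0) := by
    refine h.congr ?_
    filter_upwards [ae_half_pos] with x hx
    rw [abs_of_pos hx]
  have h2 : IntegrableOn (fun x => φ |x|) (Set.Iic 0) := by
    have m : MeasurableEmbedding fun x : ℝ => -x := (Homeomorph.neg ℝ).measurableEmbedding
    rw [← Measure.map_neg_eq_self (volume : Measure ℝ), m.integrableOn_map_iff]
    simpa [Function.comp_def, integrableOn_Ici_iff_integrableOn_Ioi] using h1
  rw [← integrableOn_univ, ← Set.Iic_union_Ioi (a := (0 : ℝ))]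
  exact h2.union h1

/-- The constant `C_H` of the spectral density. -/
def specConst (h : ℝ) : ℝ := Real.Gamma (2 * h + 1) * Real.sin (Real.pi * h) / (2 * Real.pi)

lemma specConst_pos {h : ℝ} (h0 : 0 < h) (h1 : h < 1) : 0 < specConst h := by
  have := Real.sin_pos_of_pos_of_lt_pi (x := Real.pi * h) (by positivity)
    (by nlinarith [Real.pi_pos])
  have := Real.Gamma_pos_of_pos (s := 2 * h + 1) (by linarith)
  have := Real.pi_pos
  unfold specConst
  positivity

lemma integral_one_sub_cos_mul_rpow {h : ℝ} (h0 : 0 < h) (h1 : h < 1) :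
    Integrable (fun x => (1 - Real.cos x) * x ^ (-2 * h - 1)) half ∧
    ∫ x, (1 - Real.cos x) * x ^ (-2 * h - 1) ∂half = 1 / (4 * specConst h) := by
  obtain ⟨hi, hv⟩ := integral_rpow_div_one_add_sq h0 h1
  have hG := Real.Gamma_pos_of_pos (s := 2 * h + 1) (by linarith)
  have hs := specConst_pos h0 h1
  obtain ⟨k1, k2⟩ := integrable_integral_of_swap (μ := half) (ν := half)
    (F := fun x t => (1 - Real.cos x) * (t ^ (2 * h) * Real.exp (-(x * t))))
    (A := fun x => Real.Gamma (2 * h + 1) * ((1 - Real.cos x) * x ^ (-2 * h - 1)))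
    (B := fun t => t ^ (2 * h - 1) / (1 + t ^ 2))
    (Measurable.aestronglyMeasurable (by unfold Function.uncurry; fun_prop))
    (by
      filter_upwards [ae_half_pos] with t ht
      refine Eventually.of_forall fun x => ?_
      have := Real.cos_le_one x
      exact mul_nonneg (by linarith) (by positivity))
    (by
      filter_upwards [ae_half_pos] with x hx
      have := Real.integral_rpow_mul_exp_neg_mul_Ioi (a := 2 * h + 1) (by linarith) hx
      rw [add_sub_cancel_right] at this
      rw [integral_const_mul, this, one_div, Real.inv_rpow hx.le, ← Real.rpow_neg hx.le]
      ring_nf)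
    (by
      filter_upwards [ae_half_pos] with t ht
      refine ((integral_one_sub_cos_mul_exp ht).1.const_mul (t ^ (2 * h))).congr
        (Eventually.of_forall fun x => ?_)
      dsimp only
      ring_nf)
    (by
      filter_upwards [ae_half_pos] with t ht
      have e : ∀ x : ℝ, (1 - Real.cos x) * (t ^ (2 * h) * Real.exp (-(x * t))) =
        t ^ (2 * h) * ((1 - Real.cos x) * Real.exp (-(t * x))) := fun x => by
          rw [mul_comm x t]; ring
      simp_rw [e]
      rw [integral_const_mul, (integral_one_sub_cos_mul_exp ht).2, Real.rpow_sub_one ht.ne']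
      field_simp)
    hi
  refine ⟨?_, ?_⟩
  · refine (k1.const_mul (Real.Gamma (2 * h + 1))⁻¹).congr (Eventually.of_forall fun x => ?_)
    dsimp only
    field_simp
  · rw [integral_const_mul, hv] at k2
    have hsin := Real.sin_pos_of_pos_of_lt_pi (x := Real.pi * h) (by positivity)
      (by nlinarith [Real.pi_pos])
    have hpi := Real.pi_pos
    rw [mul_comm, ← eq_div_iff hG.ne'] at k2
    rw [k2, specConst]
    field_simp
    ring

lemma integral_one_sub_cos_mul_abs_rpow {h : ℝ} (h0 : 0 < h) (h1 : h < 1) (u : ℝ) :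
    Integrable (fun x => (1 - Real.cos (u * x)) * |x| ^ (-2 * h - 1)) ∧
    ∫ x, (1 - Real.cos (u * x)) * |x| ^ (-2 * h - 1) = |u| ^ (2 * h) / (2 * specConst h) := by
  have hs := specConst_pos h0 h1
  obtain ⟨hi, hv⟩ := integral_one_sub_cos_mul_rpow h0 h1
  have e : (fun x => (1 - Real.cos (u * x)) * |x| ^ (-2 * h - 1)) =
      fun x => (fun y => (1 - Real.cos (|u| * y)) * y ^ (-2 * h - 1)) |x| := by
    ext x
    dsimp only
    rw [← abs_mul, Real.cos_abs]
  have key : Integrable (fun y => (1 - Real.cos (|u| * y)) * y ^ (-2 * h - 1)) half ∧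
      ∫ y, (1 - Real.cos (|u| * y)) * y ^ (-2 * h - 1) ∂half =
        |u| ^ (2 * h) / (4 * specConst h) := by
    rcases (abs_nonneg u).eq_or_lt with hu | hu
    · rw [← hu]
      simp [Real.zero_rpow (show 2 * h ≠ 0 by positivity)]
    · have e2 : ∀ᵐ y ∂half,
        |u| ^ (2 * h + 1) * ((1 - Real.cos (|u| * y)) * (|u| * y) ^ (-2 * h - 1))
          = (1 - Real.cos (|u| * y)) * y ^ (-2 * h - 1) := by
        filter_upwards [ae_half_pos] with y hy
        rw [Real.mul_rpow hu.le hy.le, show -2 * h - 1 = -(2 * h + 1) by ring, Real.rpow_neg hu.le]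
        field_simp
      have hi2 : Integrable
          (fun y => (1 - Real.cos (|u| * y)) * (|u| * y) ^ (-2 * h - 1)) half := by
        have := (integrableOn_Ioi_comp_mul_left_iff
          (fun y => (1 - Real.cos y) * y ^ (-2 * h - 1)) 0 hu).mpr (by rw [mul_zero]; exact hi)
        exact this
      refine ⟨(hi2.const_mul _).congr e2, ?_⟩
      rw [← integral_congr_ae e2, integral_const_mul]
      have := integral_comp_mul_left_Ioi (fun y => (1 - Real.cos y) * y ^ (-2 * h - 1)) 0 hu
      rw [mul_zero, hv] at this
      rw [this, Real.rpow_add_one hu.ne', smul_eq_mul]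
      field_simp
  rw [e]
  refine ⟨integrable_comp_abs key.1, ?_⟩
  · rw [integral_comp_abs (f := fun y => (1 - Real.cos (|u| * y)) * y ^ (-2 * h - 1)), key.2]
    field_simp
    ring

lemma rpow_le_rpow_add_rpow {t p q r : ℝ} (ht : 0 < t) (hp : p ≤ r) (hq : r ≤ q) :
    t ^ r ≤ t ^ p + t ^ q := by
  have h1 := Real.rpow_pos_of_pos ht p
  have h2 := Real.rpow_pos_of_pos ht q
  rcases le_total 1 t with h | h
  · linarith [Real.rpow_le_rpow_of_exponent_le h hq]
  · linarith [Real.rpow_le_rpow_of_exponent_ge ht h hp]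

lemma exists_abs_log_pow_le (j : ℕ) {δ : ℝ} (hδ : 0 < δ) :
    ∃ K : ℝ, 0 ≤ K ∧ ∀ t : ℝ, 0 < t → |Real.log t| ^ j ≤ K * (t ^ δ + t ^ (-δ)) := by
  set η : ℝ := δ / (j + 1) with hη
  have hη0 : 0 < η := by positivity
  have key : ∀ t : ℝ, 1 ≤ t → |Real.log t| ^ j ≤ (1 / η) ^ j * t ^ δ := by
    intro t ht
    have ht0 : 0 ≤ t := by linarith
    have h1 := Real.log_le_rpow_div ht0 hη0
    rw [abs_of_nonneg (Real.log_nonneg ht)]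
    calc Real.log t ^ j ≤ (t ^ η / η) ^ j := pow_le_pow_left₀ (Real.log_nonneg ht) h1 j
      _ = (1 / η) ^ j * t ^ (η * j) := by
        rw [div_eq_mul_one_div, mul_pow, Real.rpow_mul ht0, Real.rpow_natCast, mul_comm]
      _ ≤ (1 / η) ^ j * t ^ δ := by
        have : η * j ≤ δ := by
          rw [hη, div_mul_eq_mul_div, div_le_iff₀ (by positivity)]
          nlinarith
        gcongr
  refine ⟨(1 / η) ^ j, by positivity, fun t ht => ?_⟩
  have h1 := Real.rpow_pos_of_pos ht δ
  have h2 := Real.rpow_pos_of_pos ht (-δ)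
  have h3 : 0 < (1 / η) ^ j := by positivity
  rcases le_total 1 t with h | h
  · nlinarith [key t h, mul_pos h3 h2]
  · have := key t⁻¹ ((one_le_inv₀ ht).mpr h)
    rw [Real.log_inv, abs_neg, Real.inv_rpow ht.le, ← Real.rpow_neg ht.le] at this
    nlinarith [mul_pos h3 h1]

lemma exists_abs_log_pow_mul_rpow_le (j : ℕ) {a b a' b' : ℝ} (ha : a < a') (hb : b' < b) :
    ∃ K : ℝ, 0 ≤ K ∧ ∀ t : ℝ, 0 < t → ∀ h ∈ Set.Icc a' b',
      |Real.log t| ^ j * t ^ (-2 * h - 1) ≤ K * (t ^ (-2 * a - 1) + t ^ (-2 * b - 1)) := by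
  set δ : ℝ := min (a' - a) (b - b') with hδ
  have hδ0 : 0 < δ := lt_min (by linarith) (by linarith)
  have hδ1 : δ ≤ a' - a := min_le_left _ _
  have hδ2 : δ ≤ b - b' := min_le_right _ _
  obtain ⟨K, hK, h⟩ := exists_abs_log_pow_le j hδ0
  refine ⟨2 * K, by positivity, fun t ht x hx => ?_⟩
  obtain ⟨hx1, hx2⟩ := hx
  have h1 : t ^ δ * t ^ (-2 * x - 1) ≤ t ^ (-2 * a - 1) + t ^ (-2 * b - 1) := by
    rw [← Real.rpow_add ht, add_comm (t ^ (-2 * a - 1))]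
    exact rpow_le_rpow_add_rpow ht (by linarith) (by linarith)
  have h2 : t ^ (-δ) * t ^ (-2 * x - 1) ≤ t ^ (-2 * a - 1) + t ^ (-2 * b - 1) := by
    rw [← Real.rpow_add ht, add_comm (t ^ (-2 * a - 1))]
    exact rpow_le_rpow_add_rpow ht (by linarith) (by linarith)
  calc |Real.log t| ^ j * t ^ (-2 * x - 1)
      ≤ K * (t ^ δ + t ^ (-δ)) * t ^ (-2 * x - 1) := by gcongr; exact h t ht
    _ = K * (t ^ δ * t ^ (-2 * x - 1) + t ^ (-δ) * t ^ (-2 * x - 1)) := by ring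
    _ ≤ K * ((t ^ (-2 * a - 1) + t ^ (-2 * b - 1)) + (t ^ (-2 * a - 1) + t ^ (-2 * b - 1))) := by
      gcongr
    _ = _ := by ring

/-- The kernel `(-2 log t)^j t^{-2h-1}`, the `j`-th derivative in `h` of `t^{-2h-1}`. -/
def logKer (j : ℕ) (h t : ℝ) : ℝ := (-2 * Real.log t) ^ j * t ^ (-2 * h - 1)

lemma measurable_logKer (j : ℕ) (h : ℝ) : Measurable (logKer j h) := by
  unfold logKer; fun_prop

lemma logKer_zero (h t : ℝ) : logKer 0 h t = t ^ (-2 * h - 1) := by simp [logKer]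

lemma hasDerivAt_logKer (j : ℕ) (h : ℝ) {t : ℝ} (ht : 0 < t) :
    HasDerivAt (fun h => logKer j h t) (logKer (j + 1) h t) h := by
  have h1 : HasDerivAt (fun h : ℝ => -2 * h - 1) (-2) h := by
    simpa using ((hasDerivAt_id h).const_mul (-2)).sub_const 1
  have h2 := (h1.const_rpow ht).const_mul ((-2 * Real.log t) ^ j)
  refine h2.congr_deriv ?_
  simp only [logKer]
  ring

lemma exists_abs_logKer_le (j : ℕ) {a b a' b' : ℝ} (ha : a < a') (hb : b' < b) :
    ∃ K : ℝ, 0 ≤ K ∧ ∀ t : ℝ, 0 < t → ∀ h ∈ Set.Icc a' b',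
      |logKer j h t| ≤ K * (t ^ (-2 * a - 1) + t ^ (-2 * b - 1)) := by
  obtain ⟨K, hK, h⟩ := exists_abs_log_pow_mul_rpow_le j ha hb
  refine ⟨2 ^ j * K, by positivity, fun t ht x hx => ?_⟩
  have := h t ht x hx
  rw [logKer, abs_mul, abs_pow, abs_mul, abs_neg, abs_two, mul_pow,
    abs_of_pos (Real.rpow_pos_of_pos ht _), mul_assoc, mul_assoc]
  gcongr

section LogKernelIntegral

variable {X : Type*} [MeasurableSpace X] {μ : Measure X} {ψ y : X → ℝ}

lemma integrable_mul_logKer (hψ : Measurable ψ) (hy : Measurable y) (hy0 : ∀ᵐ x ∂μ, 0 < y x)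
    (hi : ∀ h ∈ Set.Ioo (0 : ℝ) 1, Integrable (fun x => ψ x * y x ^ (-2 * h - 1)) μ)
    (j : ℕ) {h : ℝ} (hh : h ∈ Set.Ioo (0 : ℝ) 1) :
    Integrable (fun x => ψ x * logKer j h (y x)) μ := by
  obtain ⟨h0, h1⟩ := hh
  obtain ⟨K, hK, hb⟩ := exists_abs_logKer_le j (a := h / 2) (b := (h + 1) / 2) (a' := h) (b' := h)
    (by linarith) (by linarith)
  have hB := ((hi (h / 2) ⟨by linarith, by linarith⟩).norm.add
    (hi ((h + 1) / 2) ⟨by linarith, by linarith⟩).norm).const_mul K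
  refine hB.mono' ((hψ.mul ((measurable_logKer j h).comp hy)).aestronglyMeasurable) ?_
  filter_upwards [hy0] with x hx
  have h2 := hb _ hx h ⟨le_rfl, le_rfl⟩
  simp only [Pi.add_apply, Real.norm_eq_abs, abs_mul, abs_of_pos (Real.rpow_pos_of_pos hx _)]
  calc |ψ x| * |logKer j h (y x)| ≤
      |ψ x| * (K * (y x ^ (-2 * (h / 2) - 1) + y x ^ (-2 * ((h + 1) / 2) - 1))) := by gcongr
    _ = _ := by ring

lemma hasDerivAt_integral_logKer (hψ : Measurable ψ) (hy : Measurable y)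
    (hy0 : ∀ᵐ x ∂μ, 0 < y x)
    (hi : ∀ h ∈ Set.Ioo (0 : ℝ) 1, Integrable (fun x => ψ x * y x ^ (-2 * h - 1)) μ)
    (j : ℕ) {h : ℝ} (hh : h ∈ Set.Ioo (0 : ℝ) 1) :
    HasDerivAt (fun h => ∫ x, ψ x * logKer j h (y x) ∂μ)
      (∫ x, ψ x * logKer (j + 1) h (y x) ∂μ) h := by
  have hh' := hh
  obtain ⟨h0, h1⟩ := hh
  obtain ⟨K, hK, hb⟩ := exists_abs_logKer_le (j + 1) (a := h / 4) (b := (h + 3) / 4)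
    (a' := h / 2) (b' := (h + 1) / 2) (by linarith) (by linarith)
  have hB := ((hi (h / 4) ⟨by linarith, by linarith⟩).norm.add
    (hi ((h + 3) / 4) ⟨by linarith, by linarith⟩).norm).const_mul K
  have hm : ∀ j h, AEStronglyMeasurable (fun x => ψ x * logKer j h (y x)) μ := fun j h =>
    (hψ.mul ((measurable_logKer j h).comp hy)).aestronglyMeasurable
  refine (hasDerivAt_integral_of_dominated_loc_of_deriv_le
    (s := Set.Icc (h / 2) ((h + 1) / 2)) (F := fun h x => ψ x * logKer j h (y x))
    (F' := fun h x => ψ x * logKer (j + 1) h (y x))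
    (Icc_mem_nhds (by linarith) (by linarith)) (Eventually.of_forall fun t => hm j t)
    (integrable_mul_logKer hψ hy hy0 hi j hh') (hm _ _) ?_ hB ?_).2
  · filter_upwards [hy0] with x hx t ht
    have h2 := hb _ hx t ht
    simp only [Pi.add_apply, Real.norm_eq_abs, abs_mul, abs_of_pos (Real.rpow_pos_of_pos hx _)]
    calc |ψ x| * |logKer (j + 1) t (y x)| ≤
        |ψ x| * (K * (y x ^ (-2 * (h / 4) - 1) + y x ^ (-2 * ((h + 3) / 4) - 1))) := by gcongr
      _ = _ := by ring
  · filter_upwards [hy0] with x hx t _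
    exact (hasDerivAt_logKer j t hx).const_mul _

end LogKernelIntegral

lemma integral_count_eq_tsum {F : ℤ → ℝ} (hF : Summable F) :
    ∫ k, F k ∂Measure.count = ∑' k, F k := by
  rw [integral_countable (integrable_count_iff.mpr hF.norm)]
  simp [Measure.real]

/-- `∫_ℝ 2(1-cos x) cos(kx) (-2 log|x|)^j |x|^{-2h-1} dx`. -/
def cosLogInt (j : ℕ) (h k : ℝ) : ℝ :=
  ∫ x, 2 * (1 - Real.cos x) * Real.cos (k * x) * logKer j h |x|

lemma ae_abs_pos : ∀ᵐ x : ℝ, 0 < |x| := by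
  filter_upwards [Measure.ae_ne volume (0 : ℝ)] with x hx using abs_pos.mpr hx

lemma integrable_base (k : ℝ) : ∀ h ∈ Set.Ioo (0 : ℝ) 1,
    Integrable (fun x : ℝ => 2 * (1 - Real.cos x) * Real.cos (k * x) * |x| ^ (-2 * h - 1)) := by
  rintro h ⟨h0, h1⟩
  have := ((integral_one_sub_cos_mul_abs_rpow h0 h1 1).1.const_mul 2).mul_bdd (c := 1)
    (g := fun x => Real.cos (k * x)) (by fun_prop) (Eventually.of_forall fun x => by
      simpa using Real.abs_cos_le_one _)
  refine this.congr (Eventually.of_forall fun x => ?_)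
  dsimp only
  rw [one_mul]
  ring

lemma integrable_cosLog (j : ℕ) (k : ℝ) {h : ℝ} (hh : h ∈ Set.Ioo (0 : ℝ) 1) :
    Integrable (fun x : ℝ => 2 * (1 - Real.cos x) * Real.cos (k * x) * logKer j h |x|) :=
  integrable_mul_logKer (by fun_prop) (by fun_prop) ae_abs_pos (integrable_base k) j hh

lemma hasDerivAt_cosLogInt (j : ℕ) (k : ℝ) {h : ℝ} (hh : h ∈ Set.Ioo (0 : ℝ) 1) :
    HasDerivAt (fun h => cosLogInt j h k) (cosLogInt (j + 1) h k) h :=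
  hasDerivAt_integral_logKer (by fun_prop) (by fun_prop) ae_abs_pos (integrable_base k) j hh

lemma specConst_mul_cosLogInt_zero (k : ℝ) {h : ℝ} (hh : h ∈ Set.Ioo (0 : ℝ) 1) :
    specConst h * cosLogInt 0 h k =
      (|k + 1| ^ (2 * h) - 2 * |k| ^ (2 * h) + |k - 1| ^ (2 * h)) / 2 := by
  obtain ⟨h0, h1⟩ := hh
  obtain ⟨i1, e1⟩ := integral_one_sub_cos_mul_abs_rpow h0 h1 (k + 1)
  obtain ⟨i2, e2⟩ := integral_one_sub_cos_mul_abs_rpow h0 h1 k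
  obtain ⟨i3, e3⟩ := integral_one_sub_cos_mul_abs_rpow h0 h1 (k - 1)
  have e : ∀ x : ℝ, 2 * (1 - Real.cos x) * Real.cos (k * x) * logKer 0 h |x| =
      ((1 - Real.cos ((k + 1) * x)) * |x| ^ (-2 * h - 1) -
        2 * ((1 - Real.cos (k * x)) * |x| ^ (-2 * h - 1))) +
        (1 - Real.cos ((k - 1) * x)) * |x| ^ (-2 * h - 1) := fun x => by
    rw [logKer_zero, add_mul, sub_mul k, one_mul, Real.cos_add, Real.cos_sub]
    ring
  have i4 : Integrable (fun x : ℝ => (1 - Real.cos ((k + 1) * x)) * |x| ^ (-2 * h - 1) -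
        2 * ((1 - Real.cos (k * x)) * |x| ^ (-2 * h - 1))) := i1.sub (i2.const_mul 2)
  have hs := specConst_pos h0 h1
  rw [cosLogInt]
  simp_rw [e]
  rw [integral_add i4 i3, integral_sub i1 (i2.const_mul 2), integral_const_mul, e1, e2, e3]
  field_simp

lemma specConst_mul_cosLogInt_zero_zero {h : ℝ} (hh : h ∈ Set.Ioo (0 : ℝ) 1) :
    specConst h * cosLogInt 0 h 0 = 1 := by
  rw [specConst_mul_cosLogInt_zero 0 hh]
  have : 2 * h ≠ 0 := by linarith [hh.1]
  simp [Real.zero_rpow this]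

lemma fgnT_apply {n : ℕ} {h : ℝ} (hh : h ∈ Set.Ioo (0 : ℝ) 1) (i j : Fin n) :
    fgnT n h i j = specConst h * cosLogInt 0 h (((i : ℤ) - (j : ℤ) : ℤ) : ℝ) := by
  rw [specConst_mul_cosLogInt_zero _ hh, fgnT]
  push_cast
  rfl

/-- First derivative of the spectral constant. -/
def specConst' (h : ℝ) : ℝ := -cosLogInt 1 h 0 / cosLogInt 0 h 0 ^ 2

/-- Second derivative of the spectral constant. -/
def specConst'' (h : ℝ) : ℝ := deriv specConst' h

lemma cosLogInt_zero_zero_ne {h : ℝ} (hh : h ∈ Set.Ioo (0 : ℝ) 1) : cosLogInt 0 h 0 ≠ 0 :=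
  right_ne_zero_of_mul (specConst_mul_cosLogInt_zero_zero hh ▸ one_ne_zero)

lemma hasDerivAt_specConst {h : ℝ} (hh : h ∈ Set.Ioo (0 : ℝ) 1) :
    HasDerivAt specConst (specConst' h) h := by
  refine ((hasDerivAt_cosLogInt 0 0 hh).inv (cosLogInt_zero_zero_ne hh)).congr_of_eventuallyEq ?_
  filter_upwards [Ioo_mem_nhds hh.1 hh.2] with t ht
  exact eq_inv_of_mul_eq_one_left (specConst_mul_cosLogInt_zero_zero ht)

lemma hasDerivAt_specConst' {h : ℝ} (hh : h ∈ Set.Ioo (0 : ℝ) 1) :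
    HasDerivAt specConst' (specConst'' h) h := by
  refine DifferentiableAt.hasDerivAt ?_
  exact ((hasDerivAt_cosLogInt 1 0 hh).differentiableAt.neg).div
    ((hasDerivAt_cosLogInt 0 0 hh).differentiableAt.pow 2)
    (pow_ne_zero 2 (cosLogInt_zero_zero_ne hh))

/-- Periodization of an integrable function over `2πℤ`. -/
def fold (ψ : ℝ → ℝ) (x : ℝ) : ℝ := ∑' k : ℤ, ψ (x + 2 * (k : ℝ) * Real.pi)

lemma hasSum_integral_circ {ψ : ℝ → ℝ} (hi : Integrable ψ) :
    HasSum (fun k : ℤ => ∫ x, ψ (x + 2 * (k : ℝ) * Real.pi) ∂circ) (∫ x, ψ x) := by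
  have hpi := Real.pi_pos
  have hU := iUnion_Ioc_add_zsmul (show 0 < 2 * Real.pi by positivity) (-Real.pi)
  have hD := Set.pairwise_disjoint_Ioc_add_zsmul (-Real.pi) (2 * Real.pi)
  have h := hasSum_integral_iUnion (μ := volume) (f := ψ) (fun k : ℤ => measurableSet_Ioc) hD
    hi.integrableOn
  rw [hU, Measure.restrict_univ] at h
  have e : (fun k : ℤ => ∫ x, ψ (x + 2 * (k : ℝ) * Real.pi) ∂circ) = fun k : ℤ =>
      ∫ x in Set.Ioc (-Real.pi + k • (2 * Real.pi)) (-Real.pi + (k + 1) • (2 * Real.pi)), ψ x := by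
    ext k
    rw [integral_circ, intervalIntegral.integral_comp_add_right,
      intervalIntegral.integral_of_le (by linarith)]
    congr 3
    · simp; ring
    · simp; ring
  rwa [e]

lemma fold_aux {ψ : ℝ → ℝ} (hm : Measurable ψ) (hi : Integrable ψ) :
    Integrable (fold ψ) circ ∧ ∫ x, fold ψ x ∂circ = ∫ x, ψ x := by
  have hint : ∀ k : ℤ, Integrable (fun x => ψ (x + 2 * (k : ℝ) * Real.pi)) circ := fun k =>
    (hi.comp_add_right _).integrableOn
  have h1 := hasSum_integral_circ hi
  have h2 := (hasSum_integral_circ hi.norm).summable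
  have hF : AEStronglyMeasurable
      (Function.uncurry fun (x : ℝ) (k : ℤ) => ψ (x + 2 * (k : ℝ) * Real.pi))
      (circ.prod Measure.count) := by
    refine (hm.comp ?_).aestronglyMeasurable
    have : Measurable fun p : ℝ × ℤ => (p.2 : ℝ) := (measurable_of_countable _).comp measurable_snd
    exact measurable_fst.add ((this.const_mul 2).mul_const _)
  have h3 : Integrable (Function.uncurry fun (x : ℝ) (k : ℤ) => ψ (x + 2 * (k : ℝ) * Real.pi))
      (circ.prod Measure.count) := by
    rw [integrable_prod_iff' hF]
    refine ⟨Eventually.of_forall hint, ?_⟩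
    rw [integrable_count_iff]
    exact h2.norm
  have h4 : ∀ᵐ x ∂circ, ∫ k : ℤ, ψ (x + 2 * (k : ℝ) * Real.pi) ∂Measure.count = fold ψ x := by
    filter_upwards [h3.prod_right_ae] with x hx
    exact integral_count_eq_tsum ((integrable_count_iff.mp hx).of_norm)
  refine ⟨h3.integral_prod_left.congr h4, ?_⟩
  rw [← integral_congr_ae h4, ← h1.tsum_eq]
  refine (integral_integral_swap h3).trans ?_
  exact integral_count_eq_tsum h1.summable

lemma cosCoeff_fold {ψ : ℝ → ℝ} (hm : Measurable ψ) (hi : Integrable ψ) (d : ℤ) :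
    cosCoeff (fold ψ) d = ∫ x, ψ x * Real.cos (d * x) := by
  have h := fold_aux (ψ := fun x => ψ x * Real.cos (d * x)) (by fun_prop)
    (hi.mul_bdd (c := 1) (by fun_prop) (Eventually.of_forall fun x => by
      simpa using Real.abs_cos_le_one _))
  rw [← h.2, cosCoeff]
  congr 1; ext x
  rw [fold, fold, ← tsum_mul_right]
  congr 1; ext k
  have : (d : ℝ) * (x + 2 * k * Real.pi) = d * x + (d * k : ℤ) * (2 * Real.pi) := by push_cast; ring
  rw [this, Real.cos_add_int_mul_two_pi]

/-- The lattice sum `∑_k (-2 log|l+2kπ|)^j |l+2kπ|^{-2h-1}`. -/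
def specS (j : ℕ) (h l : ℝ) : ℝ :=
  ∫ k : ℤ, logKer j h |l + 2 * (k : ℝ) * Real.pi| ∂Measure.count

lemma measurable_specS (j : ℕ) (h : ℝ) : Measurable (specS j h) := by
  have hF : Measurable
      (Function.uncurry fun (l : ℝ) (k : ℤ) => logKer j h |l + 2 * (k : ℝ) * Real.pi|) := by
    have : Measurable fun p : ℝ × ℤ => (p.2 : ℝ) := (measurable_of_countable _).comp measurable_snd
    have h2 : Measurable fun p : ℝ × ℤ => |p.1 + 2 * (p.2 : ℝ) * Real.pi| :=
      (measurable_fst.add ((this.const_mul 2).mul_const _)).abs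
    exact (measurable_logKer j h).comp h2
  exact (hF.stronglyMeasurable.integral_prod_right (ν := (Measure.count : Measure ℤ))).measurable

lemma specS_neg (j : ℕ) (h l : ℝ) : specS j h (-l) = specS j h l := by
  have hn : MeasurePreserving (Neg.neg : ℤ → ℤ) Measure.count Measure.count :=
    ⟨measurable_of_countable _, by
      ext s hs
      rw [Measure.map_apply (measurable_of_countable _) hs]
      have : (Neg.neg : ℤ → ℤ) ⁻¹' s = Neg.neg '' s := by
        rw [Set.image_neg_eq_neg]; rfl
      rw [this]
      exact Measure.count_injective_image neg_injective s⟩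
  have := hn.integral_comp (MeasurableEquiv.neg ℤ).measurableEmbedding
    (fun k : ℤ => logKer j h |l + 2 * (k : ℝ) * Real.pi|)
  rw [specS, specS, ← this]
  congr 1; ext k
  rw [← abs_neg]
  congr 2; push_cast; ring

lemma pi_mul_abs_le {l : ℝ} (hl : |l| ≤ Real.pi) {k : ℤ} (hk : k ≠ 0) :
    Real.pi * |(k : ℝ)| ≤ |l + 2 * (k : ℝ) * Real.pi| := by
  have h1 : (1 : ℝ) ≤ |(k : ℝ)| := by exact_mod_cast Int.one_le_abs hk
  have h2 : |2 * (k : ℝ) * Real.pi| = 2 * |(k : ℝ)| * Real.pi := by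
    rw [abs_mul, abs_mul, abs_two, abs_of_pos Real.pi_pos]
  have h3 := abs_sub_abs_le_abs_sub (2 * (k : ℝ) * Real.pi) (-l)
  rw [abs_neg, h2, sub_neg_eq_add, add_comm _ l] at h3
  nlinarith [Real.pi_pos]

lemma summable_pi_mul_abs_rpow {s : ℝ} (hs : s < -1) :
    Summable fun k : ℤ => (Real.pi * |(k : ℝ)|) ^ s := by
  have := (Real.summable_abs_int_rpow (b := -s) (by linarith)).mul_left (Real.pi ^ s)
  refine this.congr fun k => ?_
  rw [neg_neg, Real.mul_rpow Real.pi_pos.le (abs_nonneg _)]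

lemma summable_abs_add_rpow {l s : ℝ} (hl : |l| ≤ Real.pi) (hs : s < -1) :
    Summable fun k : ℤ => |l + 2 * (k : ℝ) * Real.pi| ^ s := by
  refine (summable_pi_mul_abs_rpow hs).of_norm_bounded_eventually ?_
  filter_upwards [(Set.finite_singleton (0 : ℤ)).compl_mem_cofinite] with k hk
  have hk' : k ≠ 0 := hk
  have h1 : (0 : ℝ) < |(k : ℝ)| := by positivity
  rw [Real.norm_of_nonneg (by positivity)]
  exact Real.rpow_le_rpow_of_nonpos (by positivity) (pi_mul_abs_le hl hk') (by linarith)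

lemma abs_add_pos {l : ℝ} (hl0 : 0 < |l|) (hl : |l| ≤ Real.pi) (k : ℤ) :
    0 < |l + 2 * (k : ℝ) * Real.pi| := by
  rcases eq_or_ne k 0 with rfl | hk
  · simpa using hl0
  · have h1 : (0 : ℝ) < |(k : ℝ)| := by positivity
    exact (by positivity : 0 < Real.pi * |(k : ℝ)|).trans_le (pi_mul_abs_le hl hk)

lemma integrable_count_base {l : ℝ} (hl : |l| ≤ Real.pi) : ∀ h ∈ Set.Ioo (0 : ℝ) 1,
    Integrable (fun k : ℤ => (1 : ℝ) * |l + 2 * (k : ℝ) * Real.pi| ^ (-2 * h - 1))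
      Measure.count := fun h hh => by
  simp only [one_mul]
  exact integrable_count_iff.mpr (summable_abs_add_rpow hl (by linarith [hh.1])).norm

lemma summable_logKer (j : ℕ) {h l : ℝ} (hh : h ∈ Set.Ioo (0 : ℝ) 1) (hl0 : 0 < |l|)
    (hl : |l| ≤ Real.pi) : Summable fun k : ℤ => logKer j h |l + 2 * (k : ℝ) * Real.pi| := by
  have := integrable_mul_logKer (μ := (Measure.count : Measure ℤ)) measurable_const
    (measurable_of_countable _) (Eventually.of_forall (abs_add_pos hl0 hl))
    (integrable_count_base hl) j hh
  simp only [one_mul] at this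
  exact (integrable_count_iff.mp this).of_norm

lemma specS_eq_tsum (j : ℕ) {h l : ℝ} (hh : h ∈ Set.Ioo (0 : ℝ) 1) (hl0 : 0 < |l|)
    (hl : |l| ≤ Real.pi) :
    specS j h l = ∑' k : ℤ, logKer j h |l + 2 * (k : ℝ) * Real.pi| :=
  integral_count_eq_tsum (summable_logKer j hh hl0 hl)

lemma hasDerivAt_specS (j : ℕ) {h l : ℝ} (hh : h ∈ Set.Ioo (0 : ℝ) 1) (hl0 : 0 < |l|)
    (hl : |l| ≤ Real.pi) : HasDerivAt (fun h => specS j h l) (specS (j + 1) h l) h := by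
  have := hasDerivAt_integral_logKer (μ := (Measure.count : Measure ℤ)) measurable_const
    (measurable_of_countable _) (Eventually.of_forall (abs_add_pos hl0 hl))
    (integrable_count_base hl) j hh
  simp only [one_mul] at this
  exact this

lemma rpow_le_specS_zero {h l : ℝ} (hh : h ∈ Set.Ioo (0 : ℝ) 1) (hl0 : 0 < |l|)
    (hl : |l| ≤ Real.pi) : |l| ^ (-2 * h - 1) ≤ specS 0 h l := by
  rw [specS_eq_tsum 0 hh hl0 hl]
  have := (summable_logKer 0 hh hl0 hl).le_tsum 0 fun k _ => by
    rw [logKer_zero]; positivity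
  simpa [logKer_zero] using this

lemma specS_zero_pos {h l : ℝ} (hh : h ∈ Set.Ioo (0 : ℝ) 1) (hl0 : 0 < |l|)
    (hl : |l| ≤ Real.pi) : 0 < specS 0 h l :=
  (Real.rpow_pos_of_pos hl0 _).trans_le (rpow_le_specS_zero hh hl0 hl)

lemma exists_abs_specS_sub_le (j : ℕ) {h : ℝ} (hh : h ∈ Set.Ioo (0 : ℝ) 1) :
    ∃ B : ℝ, 0 ≤ B ∧ ∀ l : ℝ, 0 < |l| → |l| ≤ Real.pi →
      |specS j h l - logKer j h (|l|)| ≤ B := by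
  obtain ⟨h0, h1⟩ := hh
  obtain ⟨K, hK, hb⟩ := exists_abs_logKer_le j (a := h / 2) (b := (h + 1) / 2) (a' := h) (b' := h)
    (by linarith) (by linarith)
  have hu : Summable fun k : ℤ => K * ((Real.pi * |(k : ℝ)|) ^ (-2 * (h / 2) - 1) +
      (Real.pi * |(k : ℝ)|) ^ (-2 * ((h + 1) / 2) - 1)) :=
    ((summable_pi_mul_abs_rpow (by linarith)).add
      (summable_pi_mul_abs_rpow (by linarith))).mul_left K
  have hn : ∀ k : ℤ, 0 ≤ K * ((Real.pi * |(k : ℝ)|) ^ (-2 * (h / 2) - 1) +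
      (Real.pi * |(k : ℝ)|) ^ (-2 * ((h + 1) / 2) - 1)) := fun k => by
    have := Real.pi_pos
    positivity
  refine ⟨∑' k : ℤ, _, tsum_nonneg hn, fun l hl0 hl => ?_⟩
  rw [specS_eq_tsum j ⟨h0, h1⟩ hl0 hl, (summable_logKer j ⟨h0, h1⟩ hl0 hl).tsum_eq_add_tsum_ite 0]
  simp only [Int.cast_zero, mul_zero, zero_mul, add_zero, add_sub_cancel_left]
  rw [← Real.norm_eq_abs]
  refine tsum_of_norm_bounded hu.hasSum fun k => ?_
  split_ifs with hk
  · simpa using hn k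
  · have h3 : (0 : ℝ) < |(k : ℝ)| := by positivity
    have h4 : 0 < Real.pi * |(k : ℝ)| := by positivity
    have h5 := pi_mul_abs_le hl hk
    refine (hb _ (h4.trans_le h5) h ⟨le_rfl, le_rfl⟩).trans ?_
    gcongr ?_ * (?_ + ?_)
    · exact Real.rpow_le_rpow_of_nonpos h4 h5 (by linarith)
    · exact Real.rpow_le_rpow_of_nonpos h4 h5 (by linarith)

lemma fgnSpec_eq {h l : ℝ} (hh : h ∈ Set.Ioo (0 : ℝ) 1) (hl0 : 0 < |l|) (hl : |l| ≤ Real.pi) :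
    fgnSpec h l = specConst h * (2 * (1 - Real.cos l)) * specS 0 h l := by
  rw [specS_eq_tsum 0 hh hl0 hl, fgnSpec, specConst]
  simp only [logKer_zero]

lemma one_sub_cos_pos {l : ℝ} (hl0 : 0 < |l|) (hl : |l| ≤ Real.pi) : 0 < 1 - Real.cos l := by
  have h := Real.cos_le_one_sub_mul_cos_sq hl
  have : 0 < 2 / Real.pi ^ 2 * l ^ 2 := by
    have := Real.pi_pos
    have h2 : 0 < l ^ 2 := by rw [← sq_abs]; positivity
    positivity
  linarith

lemma dlogSpec_eq {h l : ℝ} (hh : h ∈ Set.Ioo (0 : ℝ) 1) (hl0 : 0 < |l|) (hl : |l| ≤ Real.pi) :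
    dlogSpec h l = specConst' h / specConst h + specS 1 h l / specS 0 h l := by
  have hc := specConst_pos hh.1 hh.2
  have hs := specS_zero_pos hh hl0 hl
  have hk := one_sub_cos_pos hl0 hl
  have hd : HasDerivAt (fun t => specConst t * (2 * (1 - Real.cos l)) * specS 0 t l) _ h :=
    ((hasDerivAt_specConst hh).mul_const (2 * (1 - Real.cos l))).mul (hasDerivAt_specS 0 hh hl0 hl)
  have hp : 0 < specConst h * (2 * (1 - Real.cos l)) * specS 0 h l := by positivity
  have he : (fun t => Real.log (fgnSpec t l)) =ᶠ[𝓝 h]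
      fun t => Real.log (specConst t * (2 * (1 - Real.cos l)) * specS 0 t l) := by
    filter_upwards [Ioo_mem_nhds hh.1 hh.2] with t ht
    rw [fgnSpec_eq ht hl0 hl]
  rw [dlogSpec, he.deriv_eq]
  refine (hd.log hp.ne').deriv.trans ?_
  field_simp

lemma ae_circ_abs : ∀ᵐ l ∂circ, 0 < |l| ∧ |l| ≤ Real.pi := by
  have h1 : ∀ᵐ l ∂circ, l ∈ Set.Ioc (-Real.pi) Real.pi := ae_restrict_mem measurableSet_Ioc
  have h2 : ∀ᵐ l ∂circ, 0 < |l| := ae_restrict_of_ae ae_abs_pos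
  filter_upwards [h1, h2] with l h1 h2
  exact ⟨h2, abs_le.mpr ⟨h1.1.le, h1.2⟩⟩

/-- The derivative of order `j` in `h` of the spectral density without its constant. -/
def specPhi (j : ℕ) (h l : ℝ) : ℝ := 2 * (1 - Real.cos l) * specS j h l

lemma fold_ae_eq (j : ℕ) {h : ℝ} (hh : h ∈ Set.Ioo (0 : ℝ) 1) :
    fold (fun x => 2 * (1 - Real.cos x) * logKer j h |x|) =ᵐ[circ] specPhi j h := by
  filter_upwards [ae_circ_abs] with l hl
  rw [specPhi, specS_eq_tsum j hh hl.1 hl.2, fold, ← tsum_mul_left]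
  congr 1; ext k
  have : l + 2 * (k : ℝ) * Real.pi = l + k * (2 * Real.pi) := by ring
  rw [this, Real.cos_add_int_mul_two_pi]

lemma measurable_fold_kernel (j : ℕ) (h : ℝ) :
    Measurable fun x : ℝ => 2 * (1 - Real.cos x) * logKer j h |x| :=
  Measurable.mul (by fun_prop) ((measurable_logKer j h).comp measurable_norm)

lemma integrable_fold_kernel (j : ℕ) {h : ℝ} (hh : h ∈ Set.Ioo (0 : ℝ) 1) :
    Integrable fun x : ℝ => 2 * (1 - Real.cos x) * logKer j h |x| := by
  simpa using integrable_cosLog j 0 hh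

lemma integrable_specPhi (j : ℕ) {h : ℝ} (hh : h ∈ Set.Ioo (0 : ℝ) 1) :
    Integrable (specPhi j h) circ :=
  (fold_aux (measurable_fold_kernel j h) (integrable_fold_kernel j hh)).1.congr (fold_ae_eq j hh)

lemma cosCoeff_specPhi (j : ℕ) {h : ℝ} (hh : h ∈ Set.Ioo (0 : ℝ) 1) (d : ℤ) :
    cosCoeff (specPhi j h) d = cosLogInt j h d := by
  have h1 : cosCoeff (specPhi j h) d =
      cosCoeff (fold (fun x => 2 * (1 - Real.cos x) * logKer j h |x|)) d := by
    refine integral_congr_ae ?_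
    filter_upwards [fold_ae_eq j hh] with l hl
    rw [hl]
  rw [h1, cosCoeff_fold (measurable_fold_kernel j h) (integrable_fold_kernel j hh), cosLogInt]
  congr 1; ext x; ring

/-- Functions whose singularity at `0` is weaker than any power. -/
def SubPower (u : ℝ → ℝ) : Prop :=
  ∀ s : ℝ, 0 < s → ∃ K : ℝ, 0 ≤ K ∧ ∀ l : ℝ, 0 < |l| → |l| ≤ Real.pi → |u l| ≤ K * |l| ^ (-s)

lemma one_le_pi_rpow_mul {s l : ℝ} (hs : 0 < s) (hl0 : 0 < |l|) (hl : |l| ≤ Real.pi) :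
    1 ≤ Real.pi ^ s * |l| ^ (-s) := by
  have h := Real.rpow_le_rpow_of_nonpos hl0 hl (neg_nonpos.mpr hs.le)
  calc (1 : ℝ) = Real.pi ^ s * Real.pi ^ (-s) := by
        rw [← Real.rpow_add Real.pi_pos, add_neg_cancel, Real.rpow_zero]
    _ ≤ _ := by
        have := Real.rpow_pos_of_pos Real.pi_pos s
        gcongr

lemma SubPower.const (c : ℝ) : SubPower fun _ => c := fun s hs =>
  ⟨|c| * Real.pi ^ s, by have := Real.pi_pos; positivity, fun l hl0 hl => by
    have := one_le_pi_rpow_mul hs hl0 hl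
    rw [mul_assoc]
    exact le_mul_of_one_le_right (abs_nonneg c) this⟩

lemma SubPower.add {u v : ℝ → ℝ} (hu : SubPower u) (hv : SubPower v) :
    SubPower fun l => u l + v l := fun s hs => by
  obtain ⟨K, hK, h⟩ := hu s hs
  obtain ⟨L, hL, h'⟩ := hv s hs
  refine ⟨K + L, by positivity, fun l hl0 hl => ?_⟩
  rw [add_mul]
  exact (abs_add_le _ _).trans (add_le_add (h l hl0 hl) (h' l hl0 hl))

lemma SubPower.mul {u v : ℝ → ℝ} (hu : SubPower u) (hv : SubPower v) :
    SubPower fun l => u l * v l := fun s hs => by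
  obtain ⟨K, hK, h⟩ := hu (s / 2) (half_pos hs)
  obtain ⟨L, hL, h'⟩ := hv (s / 2) (half_pos hs)
  refine ⟨K * L, by positivity, fun l hl0 hl => ?_⟩
  have e : |l| ^ (-s) = |l| ^ (-(s / 2)) * |l| ^ (-(s / 2)) := by
    rw [← Real.rpow_add hl0]; congr 1; ring
  rw [abs_mul, e]
  calc |u l| * |v l| ≤ (K * |l| ^ (-(s / 2))) * (L * |l| ^ (-(s / 2))) := by
        gcongr
        · exact h l hl0 hl
        · exact h' l hl0 hl
    _ = _ := by ring

lemma SubPower.sq {u : ℝ → ℝ} (hu : SubPower u) : SubPower fun l => u l ^ 2 := by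
  simpa only [pow_two] using hu.mul hu

lemma SubPower.of_le {u v : ℝ → ℝ} (hv : SubPower v)
    (h : ∀ l, 0 < |l| → |l| ≤ Real.pi → |u l| ≤ v l) : SubPower u := fun s hs => by
  obtain ⟨K, hK, h'⟩ := hv s hs
  exact ⟨K, hK, fun l hl0 hl => (h l hl0 hl).trans ((le_abs_self _).trans (h' l hl0 hl))⟩

lemma SubPower.abs_log_pow (j : ℕ) : SubPower fun l => |Real.log (|l|)| ^ j := fun s hs => by
  obtain ⟨K, hK, h⟩ := exists_abs_log_pow_le j hs
  refine ⟨K * (Real.pi ^ s * Real.pi ^ s + 1), by have := Real.pi_pos; positivity,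
    fun l hl0 hl => ?_⟩
  rw [abs_of_nonneg (by positivity)]
  refine (h _ hl0).trans ?_
  rw [mul_assoc, add_mul, one_mul]
  gcongr
  have h1 := one_le_pi_rpow_mul hs hl0 hl
  have h2 : |l| ^ s ≤ Real.pi ^ s := Real.rpow_le_rpow hl0.le hl hs.le
  have h3 := Real.rpow_pos_of_pos Real.pi_pos s
  nlinarith

lemma SubPower.specS_div (j : ℕ) {h : ℝ} (hh : h ∈ Set.Ioo (0 : ℝ) 1) :
    SubPower fun l => specS j h l / specS 0 h l := by
  obtain ⟨B, hB, hb⟩ := exists_abs_specS_sub_le j hh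
  refine (((SubPower.const (2 ^ j)).mul (SubPower.abs_log_pow j)).add
    (SubPower.const (B * Real.pi ^ (2 * h + 1)))).of_le fun l hl0 hl => ?_
  have h0 := specS_zero_pos hh hl0 hl
  have h1 := rpow_le_specS_zero hh hl0 hl
  have h2 := hb l hl0 hl
  have h3 : |logKer j h (|l|)| = 2 ^ j * |Real.log (|l|)| ^ j * |l| ^ (-2 * h - 1) := by
    rw [logKer, abs_mul, abs_pow, abs_mul, abs_neg, abs_two, mul_pow,
      abs_of_pos (Real.rpow_pos_of_pos hl0 _)]
  have h4 := one_le_pi_rpow_mul (s := 2 * h + 1) (by linarith [hh.1]) hl0 hl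
  rw [neg_add, ← sub_eq_add_neg, ← neg_mul] at h4
  have h5 := abs_sub_abs_le_abs_sub (specS j h l) (logKer j h (|l|))
  have hpi := Real.rpow_pos_of_pos Real.pi_pos (2 * h + 1)
  rw [abs_div, abs_of_pos h0, div_le_iff₀ h0]
  calc |specS j h l| ≤ 2 ^ j * |Real.log (|l|)| ^ j * |l| ^ (-2 * h - 1) + B * 1 := by
        rw [← h3]; linarith
    _ ≤ 2 ^ j * |Real.log (|l|)| ^ j * |l| ^ (-2 * h - 1) +
        B * (Real.pi ^ (2 * h + 1) * |l| ^ (-2 * h - 1)) := by gcongr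
    _ = (2 ^ j * |Real.log (|l|)| ^ j + B * Real.pi ^ (2 * h + 1)) * |l| ^ (-2 * h - 1) := by ring
    _ ≤ _ := by gcongr

lemma integrable_abs_rpow_circ {s : ℝ} (hs : -1 < s) :
    Integrable (fun l : ℝ => |l| ^ s) circ := by
  have hpi := Real.pi_pos
  have : IntervalIntegrable (fun l : ℝ => |l| ^ s) volume (-Real.pi) Real.pi := by
    refine intervalIntegrable_of_even (fun x => by rw [abs_neg]) fun x hx => ?_
    refine (intervalIntegral.intervalIntegrable_rpow' hs).congr ?_
    intro y hy
    rw [Set.uIoc_of_le hx.le] at hy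
    simp [abs_of_pos hy.1]
  exact (intervalIntegrable_iff_integrableOn_Ioc_of_le (by linarith)).mp this

lemma integrable_of_abs_le_rpow {F : ℝ → ℝ} (hF : Measurable F) {K s : ℝ} (hs : -1 < s)
    (h : ∀ l, 0 < |l| → |l| ≤ Real.pi → |F l| ≤ K * |l| ^ s) : Integrable F circ := by
  refine ((integrable_abs_rpow_circ hs).const_mul K).mono' hF.aestronglyMeasurable ?_
  filter_upwards [ae_circ_abs] with l hl using h l hl.1 hl.2

lemma SubPower.integrable {u : ℝ → ℝ} (hu : SubPower u) (hm : Measurable u) :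
    Integrable u circ := by
  obtain ⟨K, hK, h⟩ := hu (1 / 2) (by norm_num)
  exact integrable_of_abs_le_rpow hm (by norm_num) h

lemma abs_rpow_le_pi_rpow {s l : ℝ} (hs : 0 ≤ s) (hl : |l| ≤ Real.pi) :
    |l| ^ s ≤ Real.pi ^ s := Real.rpow_le_rpow (abs_nonneg l) hl hs

section PowerDensity

variable {f : ℝ → ℝ} {h c K : ℝ}

lemma exists_mul_subPower_le (hf : ∀ l, 0 < |l| → |l| ≤ Real.pi → f l ≤ K * |l| ^ (1 - 2 * h))
    (hf0 : ∀ l, 0 < |l| → |l| ≤ Real.pi → 0 < f l) {u : ℝ → ℝ} (hu : SubPower u) {s : ℝ}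
    (hs : 0 < s) : ∃ K', ∀ l, 0 < |l| → |l| ≤ Real.pi →
      |f l * u l| ≤ K' * |l| ^ (1 - 2 * h - s) := by
  obtain ⟨L, hL, h1⟩ := hu s hs
  refine ⟨K * L, fun l hl0 hl => ?_⟩
  have h2 := hf l hl0 hl
  have h3 := hf0 l hl0 hl
  rw [abs_mul, abs_of_pos h3, sub_eq_add_neg (1 - 2 * h), Real.rpow_add hl0]
  calc f l * |u l| ≤ (K * |l| ^ (1 - 2 * h)) * (L * |l| ^ (-s)) := by
        gcongr
        · exact h3.le.trans h2
        · exact h1 l hl0 hl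
    _ = _ := by ring

lemma integrable_mul_subPower (hfm : Measurable f) (h1 : h < 1)
    (hf : ∀ l, 0 < |l| → |l| ≤ Real.pi → f l ≤ K * |l| ^ (1 - 2 * h))
    (hf0 : ∀ l, 0 < |l| → |l| ≤ Real.pi → 0 < f l) {u : ℝ → ℝ} (hum : Measurable u)
    (hu : SubPower u) : Integrable (fun l => f l * u l) circ := by
  obtain ⟨K', hK⟩ := exists_mul_subPower_le hf hf0 hu (s := 1 - h) (by linarith)
  exact integrable_of_abs_le_rpow (hfm.mul hum) (by linarith) hK

lemma one_div_le_of_rpow_le (hc : 0 < c)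
    (hf : ∀ l, 0 < |l| → |l| ≤ Real.pi → c * |l| ^ (1 - 2 * h) ≤ f l) :
    ∀ l, 0 < |l| → |l| ≤ Real.pi → 1 / f l ≤ 1 / c * |l| ^ (2 * h - 1) := fun l hl0 hl => by
  have h1 := Real.rpow_pos_of_pos hl0 (1 - 2 * h)
  have h2 : |l| ^ (2 * h - 1) = (|l| ^ (1 - 2 * h))⁻¹ := by
    rw [← Real.rpow_neg hl0.le]; congr 1; ring
  rw [h2, ← one_div, one_div_mul_one_div]
  exact one_div_le_one_div_of_le (by positivity) (hf l hl0 hl)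

lemma integrable_one_div (hfm : Measurable f) (h0 : 0 < h) (hc : 0 < c)
    (hf : ∀ l, 0 < |l| → |l| ≤ Real.pi → c * |l| ^ (1 - 2 * h) ≤ f l)
    (hf0 : ∀ l, 0 < |l| → |l| ≤ Real.pi → 0 < f l) : Integrable (fun l => 1 / f l) circ := by
  refine integrable_of_abs_le_rpow (K := 1 / c) (s := 2 * h - 1) (measurable_const.div hfm)
    (by linarith) fun l hl0 hl => ?_
  have := hf0 l hl0 hl
  rw [abs_of_pos (by positivity)]
  exact one_div_le_of_rpow_le hc hf l hl0 hl

lemma bounded_one_div_or_bounded_mul (hc : 0 < c)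
    (hf : ∀ l, 0 < |l| → |l| ≤ Real.pi → c * |l| ^ (1 - 2 * h) ≤ f l)
    (hf' : ∀ l, 0 < |l| → |l| ≤ Real.pi → f l ≤ K * |l| ^ (1 - 2 * h))
    (hf0 : ∀ l, 0 < |l| → |l| ≤ Real.pi → 0 < f l) {u : ℝ → ℝ} (hu : SubPower u) :
    (∃ M, ∀ᵐ l ∂circ, 1 / f l ≤ M) ∨ ∃ M, ∀ᵐ l ∂circ, f l * u l ≤ M := by
  rcases le_or_gt (1 / 2) h with hh | hh
  · refine Or.inl ⟨1 / c * Real.pi ^ (2 * h - 1), ?_⟩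
    filter_upwards [ae_circ_abs] with l ⟨hl0, hl⟩
    refine (one_div_le_of_rpow_le hc hf l hl0 hl).trans ?_
    exact mul_le_mul_of_nonneg_left (abs_rpow_le_pi_rpow (by linarith) hl) (by positivity)
  · obtain ⟨M, hM⟩ := exists_mul_subPower_le hf' hf0 hu (s := 1 - 2 * h) (by linarith)
    refine Or.inr ⟨M, ?_⟩
    filter_upwards [ae_circ_abs] with l ⟨hl0, hl⟩
    have := hM l hl0 hl
    rw [sub_self, Real.rpow_zero, mul_one] at this
    exact (le_abs_self _).trans this

lemma exists_mul_one_sub_cos_le (h1 : h < 1)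
    (hf : ∀ l, 0 < |l| → |l| ≤ Real.pi → f l ≤ K * |l| ^ (1 - 2 * h))
    (hf0 : ∀ l, 0 < |l| → |l| ≤ Real.pi → 0 < f l) :
    ∃ W, ∀ᵐ l ∂circ, f l * (1 - Real.cos l) ≤ W := by
  refine ⟨K * Real.pi ^ (3 - 2 * h), ?_⟩
  filter_upwards [ae_circ_abs] with l ⟨hl0, hl⟩
  have h2 := hf l hl0 hl
  have h3 := hf0 l hl0 hl
  have h4 := Real.one_sub_sq_div_two_le_cos (x := l)
  have h5 := one_sub_cos_pos hl0 hl
  have hr := Real.rpow_pos_of_pos hl0 (1 - 2 * h)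
  have hK : 0 < K := pos_of_mul_pos_left (h3.trans_le h2) hr.le
  have e : |l| ^ (3 - 2 * h) = |l| ^ (1 - 2 * h) * l ^ 2 := by
    rw [← sq_abs, ← Real.rpow_natCast, ← Real.rpow_add hl0]; congr 1; push_cast; ring
  calc f l * (1 - Real.cos l) ≤ (K * |l| ^ (1 - 2 * h)) * l ^ 2 := by
        gcongr
        nlinarith [sq_nonneg l]
    _ = K * |l| ^ (3 - 2 * h) := by rw [e]; ring
    _ ≤ _ := by
      exact mul_le_mul_of_nonneg_left (abs_rpow_le_pi_rpow (by linarith) hl) hK.le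

end PowerDensity

/-- A version of the spectral density that is even and measurable everywhere. -/
def specF (h l : ℝ) : ℝ := specConst h * specPhi 0 h l

lemma specPhi_neg (j : ℕ) (h l : ℝ) : specPhi j h (-l) = specPhi j h l := by
  rw [specPhi, specPhi, specS_neg, Real.cos_neg]

lemma measurable_specPhi (j : ℕ) (h : ℝ) : Measurable (specPhi j h) :=
  Measurable.mul (by fun_prop) (measurable_specS j h)

lemma specPhi_zero_pos {h l : ℝ} (hh : h ∈ Set.Ioo (0 : ℝ) 1) (hl0 : 0 < |l|)
    (hl : |l| ≤ Real.pi) : 0 < specPhi 0 h l := by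
  have h1 := one_sub_cos_pos hl0 hl
  have h2 := specS_zero_pos hh hl0 hl
  unfold specPhi
  positivity

lemma specF_pos {h : ℝ} (hh : h ∈ Set.Ioo (0 : ℝ) 1) :
    ∀ l, 0 < |l| → |l| ≤ Real.pi → 0 < specF h l := fun _ hl0 hl =>
  mul_pos (specConst_pos hh.1 hh.2) (specPhi_zero_pos hh hl0 hl)

lemma exists_le_specF {h : ℝ} (hh : h ∈ Set.Ioo (0 : ℝ) 1) :
    ∃ c > 0, ∀ l, 0 < |l| → |l| ≤ Real.pi → c * |l| ^ (1 - 2 * h) ≤ specF h l := by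
  have hC := specConst_pos hh.1 hh.2
  have hpi := Real.pi_pos
  refine ⟨specConst h * (2 * (2 / Real.pi ^ 2)), by positivity, fun l hl0 hl => ?_⟩
  have h1 := Real.cos_le_one_sub_mul_cos_sq hl
  have h2 := rpow_le_specS_zero hh hl0 hl
  have h3 := Real.rpow_pos_of_pos hl0 (-2 * h - 1)
  have e : |l| ^ (1 - 2 * h) = l ^ 2 * |l| ^ (-2 * h - 1) := by
    rw [← sq_abs, ← Real.rpow_natCast, ← Real.rpow_add hl0]; congr 1; push_cast; ring
  rw [specF, specPhi, e, mul_assoc]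
  refine mul_le_mul_of_nonneg_left ?_ hC.le
  calc 2 * (2 / Real.pi ^ 2) * (l ^ 2 * |l| ^ (-2 * h - 1)) =
        2 * (2 / Real.pi ^ 2 * l ^ 2) * |l| ^ (-2 * h - 1) := by ring
    _ ≤ _ := by
      gcongr
      · have := one_sub_cos_pos hl0 hl; positivity
      · linarith

lemma exists_specF_le {h : ℝ} (hh : h ∈ Set.Ioo (0 : ℝ) 1) :
    ∃ K, ∀ l, 0 < |l| → |l| ≤ Real.pi → specF h l ≤ K * |l| ^ (1 - 2 * h) := by
  have hC := specConst_pos hh.1 hh.2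
  have hpi := Real.rpow_pos_of_pos Real.pi_pos (2 * h + 1)
  obtain ⟨B, hB, hb⟩ := exists_abs_specS_sub_le 0 hh
  refine ⟨specConst h * (1 + B * Real.pi ^ (2 * h + 1)), fun l hl0 hl => ?_⟩
  have h1 := Real.one_sub_sq_div_two_le_cos (x := l)
  have h2 := (abs_le.mp (hb l hl0 hl)).2
  rw [logKer_zero] at h2
  have h4 := one_le_pi_rpow_mul (s := 2 * h + 1) (by linarith [hh.1]) hl0 hl
  rw [neg_add, ← sub_eq_add_neg, ← neg_mul] at h4
  have h5 := specS_zero_pos hh hl0 hl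
  have e : |l| ^ (1 - 2 * h) = l ^ 2 * |l| ^ (-2 * h - 1) := by
    rw [← sq_abs, ← Real.rpow_natCast, ← Real.rpow_add hl0]; congr 1; push_cast; ring
  have h6 : specS 0 h l ≤ (1 + B * Real.pi ^ (2 * h + 1)) * |l| ^ (-2 * h - 1) := by
    have := mul_le_mul_of_nonneg_left h4 hB
    linarith
  rw [specF, specPhi, e, mul_assoc (specConst h)]
  refine mul_le_mul_of_nonneg_left ?_ hC.le
  calc 2 * (1 - Real.cos l) * specS 0 h l ≤
        l ^ 2 * ((1 + B * Real.pi ^ (2 * h + 1)) * |l| ^ (-2 * h - 1)) := by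
        gcongr
        linarith
    _ = _ := by ring

/-- The logarithmic derivative of the spectral density, as an even measurable function. -/
def specG (h l : ℝ) : ℝ := specConst' h / specConst h + specS 1 h l / specS 0 h l

/-- The second derivative of the spectral density divided by the spectral density. -/
def specQ (h l : ℝ) : ℝ :=
  (specConst'' h / specConst h + 2 * specConst' h / specConst h * (specS 1 h l / specS 0 h l)) +
    specS 2 h l / specS 0 h l

lemma measurable_specF (h : ℝ) : Measurable (specF h) := (measurable_specPhi 0 h).const_mul _

lemma measurable_specG (h : ℝ) : Measurable (specG h) :=
  measurable_const.add ((measurable_specS 1 h).div (measurable_specS 0 h))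

lemma measurable_specQ (h : ℝ) : Measurable (specQ h) :=
  (measurable_const.add (((measurable_specS 1 h).div (measurable_specS 0 h)).const_mul _)).add
    ((measurable_specS 2 h).div (measurable_specS 0 h))

lemma specG_subPower {h : ℝ} (hh : h ∈ Set.Ioo (0 : ℝ) 1) : SubPower (specG h) :=
  (SubPower.const _).add (SubPower.specS_div 1 hh)

lemma specQ_subPower {h : ℝ} (hh : h ∈ Set.Ioo (0 : ℝ) 1) : SubPower (specQ h) :=
  ((SubPower.const _).add ((SubPower.const _).mul (SubPower.specS_div 1 hh))).add
    (SubPower.specS_div 2 hh)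

lemma cosCoeff_const_mul (c : ℝ) (φ : ℝ → ℝ) (d : ℤ) :
    cosCoeff (fun x => c * φ x) d = c * cosCoeff φ d := by
  simp only [cosCoeff, mul_assoc, integral_const_mul]

lemma fgnT_eq_toep (n : ℕ) {h : ℝ} (hh : h ∈ Set.Ioo (0 : ℝ) 1) :
    fgnT n h = toep (specF h) n := by
  ext i j
  rw [fgnT_apply hh, toep, ← cosCoeff_specPhi 0 hh]
  exact (cosCoeff_const_mul _ _ _).symm

/-- The entrywise first derivative of the covariance matrix. -/
def fgnT1 (n : ℕ) (h : ℝ) : Matrix (Fin n) (Fin n) ℝ := fun i j =>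
  specConst' h * cosLogInt 0 h (((i : ℤ) - (j : ℤ) : ℤ) : ℝ) +
    specConst h * cosLogInt 1 h (((i : ℤ) - (j : ℤ) : ℤ) : ℝ)

/-- The entrywise second derivative of the covariance matrix. -/
def fgnT2 (n : ℕ) (h : ℝ) : Matrix (Fin n) (Fin n) ℝ := fun i j =>
  (specConst'' h * cosLogInt 0 h (((i : ℤ) - (j : ℤ) : ℤ) : ℝ) +
    2 * specConst' h * cosLogInt 1 h (((i : ℤ) - (j : ℤ) : ℤ) : ℝ)) +
    specConst h * cosLogInt 2 h (((i : ℤ) - (j : ℤ) : ℤ) : ℝ)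

lemma mDeriv_fgnT (n : ℕ) {h : ℝ} (hh : h ∈ Set.Ioo (0 : ℝ) 1) :
    MDeriv (fgnT n) (fgnT1 n h) h := fun i j => by
  refine ((hasDerivAt_specConst hh).mul
    (hasDerivAt_cosLogInt 0 (((i : ℤ) - (j : ℤ) : ℤ) : ℝ) hh)).congr_of_eventuallyEq ?_
  filter_upwards [Ioo_mem_nhds hh.1 hh.2] with t ht
  exact fgnT_apply ht i j

lemma mDeriv_fgnT1 (n : ℕ) {h : ℝ} (hh : h ∈ Set.Ioo (0 : ℝ) 1) :
    MDeriv (fgnT1 n) (fgnT2 n h) h := fun i j => by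
  refine (((hasDerivAt_specConst' hh).mul
    (hasDerivAt_cosLogInt 0 (((i : ℤ) - (j : ℤ) : ℤ) : ℝ) hh)).add
    ((hasDerivAt_specConst hh).mul
    (hasDerivAt_cosLogInt 1 (((i : ℤ) - (j : ℤ) : ℤ) : ℝ) hh))).congr_deriv ?_
  rw [fgnT2]
  ring

lemma fgnT1_eq_toep (n : ℕ) {h : ℝ} (hh : h ∈ Set.Ioo (0 : ℝ) 1) :
    fgnT1 n h = toep (fun l => specF h l * specG h l) n := by
  have he : (fun l => specF h l * specG h l) =ᵐ[circ]
      fun l => specConst' h * specPhi 0 h l + specConst h * specPhi 1 h l := by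
    filter_upwards [ae_circ_abs] with l ⟨hl0, hl⟩
    have h1 := specS_zero_pos hh hl0 hl
    have h2 := specConst_pos hh.1 hh.2
    simp only [specF, specG, specPhi]
    field_simp
  rw [toep_congr he, toep_add ((integrable_specPhi 0 hh).const_mul _)
    ((integrable_specPhi 1 hh).const_mul _)]
  ext i j
  simp only [Matrix.add_apply, toep, cosCoeff_const_mul, cosCoeff_specPhi _ hh]
  rfl

lemma fgnT2_eq_toep (n : ℕ) {h : ℝ} (hh : h ∈ Set.Ioo (0 : ℝ) 1) :
    fgnT2 n h = toep (fun l => specF h l * specQ h l) n := by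
  have he : (fun l => specF h l * specQ h l) =ᵐ[circ]
      fun l => (specConst'' h * specPhi 0 h l + 2 * specConst' h * specPhi 1 h l) +
        specConst h * specPhi 2 h l := by
    filter_upwards [ae_circ_abs] with l ⟨hl0, hl⟩
    have h1 := specS_zero_pos hh hl0 hl
    have h2 := specConst_pos hh.1 hh.2
    simp only [specF, specQ, specPhi]
    field_simp
  have i01 : Integrable (fun l => specConst'' h * specPhi 0 h l +
      2 * specConst' h * specPhi 1 h l) circ :=
    ((integrable_specPhi 0 hh).const_mul _).add ((integrable_specPhi 1 hh).const_mul _)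
  rw [toep_congr he, toep_add i01 ((integrable_specPhi 2 hh).const_mul _),
    toep_add ((integrable_specPhi 0 hh).const_mul _) ((integrable_specPhi 1 hh).const_mul _)]
  ext i j
  simp only [Matrix.add_apply, toep, cosCoeff_const_mul, cosCoeff_specPhi _ hh]
  rfl

lemma two_mul_eH {h : ℝ} (hh : h ∈ Set.Ioo (0 : ℝ) 1) :
    1 / (2 * Real.pi) * ∫ l, specG h l ^ 2 ∂circ = 2 * eH h := by
  have : ∫ l, specG h l ^ 2 ∂circ = ∫ l, dlogSpec h l ^ 2 ∂circ := by
    refine integral_congr_ae ?_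
    filter_upwards [ae_circ_abs] with l ⟨hl0, hl⟩
    rw [dlogSpec_eq hh hl0 hl, specG]
  rw [this, integral_circ, eH]
  have := Real.pi_pos
  field_simp
  ring

theorem tendstoInProb_Estat {H σ : ℝ} (hH : H ∈ Set.Ioo (0 : ℝ) 1) (hσ : 0 < σ)
    {Δ : ℕ → ℝ} (hΔ : ∀ n, 0 < Δ n) :
    TendstoInProb (fun n => fgnP n (Δ n) H σ) (fun n => Estat n (Δ n) H σ) (eH H) := by
  obtain ⟨c, hc, hlow⟩ := exists_le_specF hH
  obtain ⟨K, hup⟩ := exists_specF_le hH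
  have hf0 := specF_pos hH
  have hfm := measurable_specF H
  have hgm := measurable_specG H
  have hqm := measurable_specQ H
  have hg := specG_subPower hH
  have hq := specQ_subPower hH
  have hpos : ∀ᵐ l ∂circ, 0 < specF H l := by
    filter_upwards [ae_circ_abs] with l hl using hf0 l hl.1 hl.2
  have hf : Integrable (specF H) circ := (integrable_specPhi 0 hH).const_mul _
  have hf' := integrable_one_div hfm hH.1 hc hlow hf0
  have hint : ∀ {u : ℝ → ℝ}, Measurable u → SubPower u →
      Integrable (fun l => specF H l * u l) circ :=
    fun hum hu => integrable_mul_subPower hfm hH.2 hup hf0 hum hu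
  have hbd : ∀ {u : ℝ → ℝ}, SubPower u → (∃ M, ∀ᵐ l ∂circ, 1 / specF H l ≤ M) ∨
      ∃ M, ∀ᵐ l ∂circ, specF H l * u l ≤ M :=
    fun hu => bounded_one_div_or_bounded_mul hc hlow hup hf0 hu
  have hlim := tendsto_trace_inv_mul_sq hfm hgm
    (fun l => by rw [specF, specF, specPhi_neg]) (fun l => by simp only [specG, specS_neg])
    hpos hf hf' (hint hgm hg) (hint (hgm.pow_const 2) hg.sq)
    (hg.sq.integrable (hgm.pow_const 2)) (hbd hg.sq) (exists_mul_one_sub_cos_le hH.2 hup hf0)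
  obtain ⟨C4, hC4⟩ := exists_trace_inv_mul_pow_four_le hpos hf hf' (hint hgm hg)
    (hint (hgm.pow_const 2) hg.sq) (hint ((hgm.pow_const 2).pow_const 2) hg.sq.sq) (hbd hg.sq.sq)
  obtain ⟨C2, hC2⟩ := exists_trace_inv_mul_sq_le hpos hf hf' (hint hqm hq)
    (hint (hqm.pow_const 2) hq.sq) (hbd hq.sq)
  have hP : ∀ n, (fgnT n H).PosDef := fun n => by
    rw [fgnT_eq_toep n hH]; exact toep_posDef hf hpos n
  have hdet : ∀ n, (fgnT n H).det ≠ 0 := fun n => (hP n).det_pos.ne'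
  have hev : ∀ n, ∀ᶠ h in 𝓝 H, MDeriv (fgnT n) (fgnT1 n h) h := fun n => by
    filter_upwards [Ioo_mem_nhds hH.1 hH.2] with t ht using mDeriv_fgnT n ht
  rw [two_mul_eH hH] at hlim
  refine tendstoInProb_of_trace (G := fun n => fgnT1 n H) (G2 := fun n => fgnT2 n H)
    (C := max C4 C2) hσ hΔ hP (fun n => ?_) (fun n => ?_) (fun n => ?_)
    (fun n => deriv_deriv_log_det (hev n) (mDeriv_fgnT1 n hH) (hdet n)) ?_ (fun n => ?_)
    (fun n => ?_)
  · simp only [fgnT1_eq_toep n hH]; exact toep_isSymm _ _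
  · simp only [fgnT2_eq_toep n hH]; exact toep_isSymm _ _
  · exact deriv_deriv_inv (hev n) (mDeriv_fgnT1 n hH) (hdet n)
  · simp only [fgnT_eq_toep _ hH, fgnT1_eq_toep _ hH]
    exact hlim
  · simp only [fgnT_eq_toep _ hH, fgnT1_eq_toep _ hH]
    exact (hC4 n).trans (by gcongr; exact le_max_left _ _)
  · simp only [fgnT_eq_toep _ hH, fgnT2_eq_toep _ hH]
    exact (hC2 n).trans (by gcongr; exact le_max_right _ _)

end FGN

/-- **Law of large numbers for the second-derivative term.** Under `P^n_{(H,σ)}`,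
`E_n → e_H = (1/(4π)) ∫_{-π}^{π} |∂_H log f_H(λ)|² dλ` in probability. -/
theorem Estat_tendsto_inProb (H σ : ℝ) (hH : H ∈ Set.Ioo (0 : ℝ) 1) (hσ : 0 < σ)
    (Δ : ℕ → ℝ) (hΔ : ∀ n, 0 < Δ n) :
    TendstoInProb (fun n => fgnP n (Δ n) H σ) (fun n => Estat n (Δ n) H σ) (eH H) := by
  exact FGN.tendstoInProb_Estat hH hσ hΔ
end
end

section
/- Positive definiteness of the fGn covariance matrix: For every H ∈ (0,1) and every n ≥ 1, the matrix T_n(H) is symmetric positive definite; in particular it is invertible and det T_n(H) > 0. -/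
open MeasureTheory Filter Topology Matrix

noncomputable section

theorem integrableOn_one_sub_cos_mul_rpow {a : ℝ} (h0 : 0 < a) (h2 : a < 2) (t : ℝ) :
    IntegrableOn (fun u : ℝ => (1 - Real.cos (t * u)) * u ^ (-1 - a)) (Set.Ioi 0) := by
  have hmeas : Measurable fun u : ℝ => (1 - Real.cos (t * u)) * u ^ (-1 - a) := by fun_prop
  rw [← Set.Ioc_union_Ioi_eq_Ioi zero_le_one]
  refine IntegrableOn.union ?_ ?_
  · have hg : IntegrableOn (fun u : ℝ => t ^ 2 / 2 * u ^ (1 - a)) (Set.Ioc 0 1) :=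
      Integrable.const_mul ((intervalIntegrable_iff_integrableOn_Ioc_of_le zero_le_one).1
        (intervalIntegral.intervalIntegrable_rpow' (by linarith))) _
    refine Integrable.mono' hg hmeas.aestronglyMeasurable ?_
    filter_upwards [ae_restrict_mem measurableSet_Ioc] with u hu
    have hu0 : 0 < u := hu.1
    have hpow : u ^ (1 - a) = u ^ 2 * u ^ (-1 - a) := by
      rw [← Real.rpow_natCast u 2, ← Real.rpow_add hu0]
      norm_num
      ring_nf
    have hcos := Real.one_sub_sq_div_two_le_cos (x := t * u)
    rw [Real.norm_of_nonneg (mul_nonneg (sub_nonneg.2 (Real.cos_le_one _)) (by positivity)),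
      hpow, ← mul_assoc]
    gcongr
    linarith
  · have hg : IntegrableOn (fun u : ℝ => 2 * u ^ (-1 - a)) (Set.Ioi 1) :=
      Integrable.const_mul (integrableOn_Ioi_rpow_of_lt (by linarith) one_pos) _
    refine Integrable.mono' hg hmeas.aestronglyMeasurable ?_
    filter_upwards [ae_restrict_mem measurableSet_Ioi] with u hu
    have hu0 : 0 < u := one_pos.trans hu
    rw [Real.norm_of_nonneg (mul_nonneg (sub_nonneg.2 (Real.cos_le_one _)) (by positivity))]
    gcongr
    linarith [Real.neg_one_le_cos (t * u)]

theorem integral_one_sub_cos_mul_rpow {a : ℝ} (h0 : 0 < a) (t : ℝ) :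
    ∫ u in Set.Ioi (0 : ℝ), (1 - Real.cos (t * u)) * u ^ (-1 - a) =
      |t| ^ a * ∫ u in Set.Ioi (0 : ℝ), (1 - Real.cos u) * u ^ (-1 - a) := by
  rcases eq_or_ne t 0 with rfl | ht
  · simp [Real.zero_rpow h0.ne']
  have ht' : 0 < |t| := abs_pos.2 ht
  have hscale := integral_comp_mul_left_Ioi
    (fun u : ℝ => (1 - Real.cos u) * u ^ (-1 - a)) 0 ht'
  rw [mul_zero, smul_eq_mul] at hscale
  have hpow : |t| ^ (1 + a) * |t|⁻¹ = |t| ^ a := by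
    rw [Real.rpow_add ht', Real.rpow_one]
    field_simp
  rw [← hpow, mul_assoc, ← hscale, ← integral_const_mul]
  refine setIntegral_congr_fun measurableSet_Ioi fun u hu => ?_
  have hcos : Real.cos (|t| * u) = Real.cos (t * u) := by
    rcases abs_choice t with h | h <;> simp [h]
  have hinv : |t| ^ (1 + a) * |t| ^ (-1 - a) = 1 := by
    rw [← Real.rpow_add ht']
    simp
  simp only [hcos, Real.mul_rpow ht'.le (le_of_lt hu)]
  linear_combination -(1 - Real.cos (t * u)) * u ^ (-1 - a) * hinv

theorem cos_mul_one_sub_cos_mul_eq (k u w : ℝ) :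
    Real.cos (k * u) * ((1 - Real.cos u) * w) =
      ((1 - Real.cos ((k + 1) * u)) * w - 2 * ((1 - Real.cos (k * u)) * w)
        + (1 - Real.cos ((k - 1) * u)) * w) / 2 := by
  rw [add_mul, sub_mul k, one_mul, Real.cos_add, Real.cos_sub]
  ring

theorem integrableOn_cos_mul_one_sub_cos_mul_rpow {a : ℝ} (h0 : 0 < a) (h2 : a < 2) (k : ℝ) :
    IntegrableOn (fun u : ℝ => Real.cos (k * u) * ((1 - Real.cos u) * u ^ (-1 - a)))
      (Set.Ioi 0) := by
  have hint := integrableOn_one_sub_cos_mul_rpow h0 h2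
  simp only [cos_mul_one_sub_cos_mul_eq]
  exact (((hint (k + 1)).sub ((hint k).const_mul 2)).add (hint (k - 1))).div_const 2

theorem integral_cos_mul_one_sub_cos_mul_rpow {a : ℝ} (h0 : 0 < a) (h2 : a < 2) (k : ℝ) :
    ∫ u in Set.Ioi (0 : ℝ), Real.cos (k * u) * ((1 - Real.cos u) * u ^ (-1 - a)) =
      ((|k + 1| ^ a - 2 * |k| ^ a + |k - 1| ^ a) / 2) *
        ∫ u in Set.Ioi (0 : ℝ), (1 - Real.cos u) * u ^ (-1 - a) := by
  have hint := integrableOn_one_sub_cos_mul_rpow h0 h2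
  have hsub : IntegrableOn (fun u : ℝ => (1 - Real.cos ((k + 1) * u)) * u ^ (-1 - a)
      - 2 * ((1 - Real.cos (k * u)) * u ^ (-1 - a))) (Set.Ioi 0) :=
    (hint (k + 1)).sub ((hint k).const_mul 2)
  simp only [cos_mul_one_sub_cos_mul_eq]
  rw [integral_div, integral_add hsub (hint (k - 1)),
    integral_sub (hint (k + 1)) ((hint k).const_mul 2), integral_const_mul]
  simp only [integral_one_sub_cos_mul_rpow h0]
  ring

theorem sum_mul_cos_sub_mul_eq {ι : Type*} [Fintype ι] (x k : ι → ℝ) (u : ℝ) :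
    ∑ i, ∑ j, x i * x j * Real.cos ((k i - k j) * u) =
      (∑ i, x i * Real.cos (k i * u)) ^ 2 + (∑ i, x i * Real.sin (k i * u)) ^ 2 := by
  simp only [sq, Finset.sum_mul_sum, ← Finset.sum_add_distrib, sub_mul, Real.cos_sub]
  refine Finset.sum_congr rfl fun i _ => Finset.sum_congr rfl fun j _ => ?_
  ring

theorem finite_zeros_trigPoly {n : ℕ} {x : Fin n → ℝ} (hx : x ≠ 0) :
    {u ∈ Set.Ioo (0 : ℝ) 1 | (∑ i : Fin n, x i * Real.cos (((i : ℕ) : ℝ) * u)) ^ 2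
      + (∑ i : Fin n, x i * Real.sin (((i : ℕ) : ℝ) * u)) ^ 2 = 0}.Finite := by
  classical
  set p : Polynomial ℂ := ∑ i : Fin n, Polynomial.monomial (i : ℕ) (x i : ℂ) with hp
  have hp0 : p ≠ 0 := by
    obtain ⟨i, hi⟩ := Function.ne_iff.1 hx
    intro h
    have hc := congrArg (fun q => Polynomial.coeff q (i : ℕ)) h
    simp [hp, Polynomial.finsetSum_coeff, Polynomial.coeff_monomial, Fin.val_inj] at hc
    exact hi hc
  refine Set.Finite.of_finite_image (f := fun u : ℝ => Complex.exp (u * Complex.I))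
    ((p.roots.toFinset.finite_toSet).subset ?_) ?_
  · rintro _ ⟨u, ⟨-, hu⟩, rfl⟩
    have hre : ∑ i : Fin n, x i * Real.cos (((i : ℕ) : ℝ) * u) = 0 := by nlinarith
    have him : ∑ i : Fin n, x i * Real.sin (((i : ℕ) : ℝ) * u) = 0 := by nlinarith
    have heval : p.eval (Complex.exp (u * Complex.I)) =
        ((∑ i : Fin n, x i * Real.cos (((i : ℕ) : ℝ) * u) : ℝ) : ℂ)
          + ((∑ i : Fin n, x i * Real.sin (((i : ℕ) : ℝ) * u) : ℝ) : ℂ) * Complex.I := by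
      simp only [hp, Polynomial.eval_finsetSum, Polynomial.eval_monomial, Complex.ofReal_sum,
        Finset.sum_mul, ← Finset.sum_add_distrib]
      refine Finset.sum_congr rfl fun i _ => ?_
      rw [← Complex.exp_nat_mul, ← mul_assoc, Complex.exp_mul_I]
      push_cast
      ring
    simp [hp0, Polynomial.IsRoot, heval, hre, him]
  · rintro u ⟨hu, -⟩ v ⟨hv, -⟩ huv
    have hcos : Real.cos u = Real.cos v := by
      simpa [Complex.exp_ofReal_mul_I_re] using congrArg Complex.re huv
    have hpi := Real.pi_gt_three
    exact Real.injOn_cos ⟨hu.1.le, by linarith [hu.2]⟩ ⟨hv.1.le, by linarith [hv.2]⟩ hcos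

theorem qForm_fgnT_pos {n : ℕ} {H : ℝ} (hH : H ∈ Set.Ioo (0 : ℝ) 1) {x : Fin n → ℝ}
    (hx : x ≠ 0) : 0 < qForm (fgnT n H) x := by
  have h0 : 0 < 2 * H := by linarith [hH.1]
  have h2 : 2 * H < 2 := by linarith [hH.2]
  have hK : 0 ≤ ∫ u in Set.Ioi (0 : ℝ), (1 - Real.cos u) * u ^ (-1 - 2 * H) :=
    setIntegral_nonneg measurableSet_Ioi fun u hu =>
      mul_nonneg (sub_nonneg.2 (Real.cos_le_one u)) (Real.rpow_nonneg (le_of_lt hu) _)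
  set w : ℝ → ℝ := fun u => (1 - Real.cos u) * u ^ (-1 - 2 * H) with hw
  set q : ℝ → ℝ := fun u => (∑ i : Fin n, x i * Real.cos (((i : ℕ) : ℝ) * u)) ^ 2
      + (∑ i : Fin n, x i * Real.sin (((i : ℕ) : ℝ) * u)) ^ 2 with hq
  have hqw : (fun u => q u * w u) = fun u => ∑ i : Fin n, ∑ j : Fin n,
      x i * x j * (Real.cos ((((i : ℕ) : ℝ) - ((j : ℕ) : ℝ)) * u) * w u) := by
    ext u
    simp only [hq, ← sum_mul_cos_sub_mul_eq x (fun i => ((i : ℕ) : ℝ)), Finset.sum_mul, mul_assoc]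
  have hterm : ∀ i j : Fin n, IntegrableOn (fun u =>
      x i * x j * (Real.cos ((((i : ℕ) : ℝ) - ((j : ℕ) : ℝ)) * u) * w u)) (Set.Ioi 0) :=
    fun i j => (integrableOn_cos_mul_one_sub_cos_mul_rpow h0 h2 _).const_mul _
  have hint : IntegrableOn (fun u => q u * w u) (Set.Ioi 0) := by
    rw [hqw]
    exact integrable_finsetSum _ fun i _ => integrable_finsetSum _ fun j _ => hterm i j
  have heq : ∫ u in Set.Ioi (0 : ℝ), q u * w u =
      qForm (fgnT n H) x * ∫ u in Set.Ioi (0 : ℝ), w u := by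
    rw [hqw, integral_finsetSum _ fun i _ => integrable_finsetSum _ fun j _ => hterm i j]
    simp only [qForm, Finset.sum_mul]
    refine Finset.sum_congr rfl fun i _ => ?_
    rw [integral_finsetSum _ fun j _ => hterm i j]
    refine Finset.sum_congr rfl fun j _ => ?_
    rw [integral_const_mul, integral_cos_mul_one_sub_cos_mul_rpow h0 h2, fgnT]
    ring
  refine pos_of_mul_pos_left (heq ▸ ?_) hK
  have hnn : 0 ≤ᵐ[volume.restrict (Set.Ioi 0)] fun u => q u * w u := by
    filter_upwards [ae_restrict_mem measurableSet_Ioi] with u hu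
    exact mul_nonneg (by positivity)
      (mul_nonneg (sub_nonneg.2 (Real.cos_le_one u)) (Real.rpow_nonneg (le_of_lt hu) _))
  rw [setIntegral_pos_iff_support_of_nonneg_ae hnn hint]
  have hfin := finite_zeros_trigPoly hx
  have hvol : volume (Set.Ioo (0 : ℝ) 1 \ {u ∈ Set.Ioo (0 : ℝ) 1 | q u = 0}) = 1 := by
    rw [measure_sdiff_null (hfin.measure_zero volume)]
    simp
  refine (hvol ▸ one_pos).trans_le (measure_mono ?_)
  rintro u ⟨hu, hqu⟩
  refine ⟨mul_ne_zero (fun h => hqu ⟨hu, h⟩)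
    (mul_ne_zero (fun h => ?_) (Real.rpow_pos_of_pos hu.1 _).ne'), hu.1⟩
  have hpi := Real.pi_gt_three
  have hcos := (Real.cos_eq_one_iff_of_lt_of_lt (by linarith [hu.1]) (by linarith [hu.2])).1
    (sub_eq_zero.1 h).symm
  exact hu.1.ne' hcos

theorem fgnT_isHermitian (n : ℕ) (H : ℝ) : (fgnT n H).IsHermitian := by
  ext i j
  simp only [conjTranspose_apply, star_trivial, fgnT]
  rw [abs_sub_comm ((j : ℕ) : ℝ), ← abs_neg (((j : ℕ) : ℝ) - _ + 1),
    ← abs_neg (((j : ℕ) : ℝ) - _ - 1)]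
  ring_nf

/-- **Positive definiteness of the fGn covariance matrix.** For every `H ∈ (0,1)` and `n ≥ 1`,
`T_n(H)` is symmetric positive definite; in particular it is invertible and has positive
determinant. -/
theorem fgnT_posDef (n : ℕ) (hn : 1 ≤ n) (H : ℝ) (hH : H ∈ Set.Ioo (0 : ℝ) 1) :
    (fgnT n H).PosDef ∧ IsUnit (fgnT n H) ∧ 0 < (fgnT n H).det := by
  have hpos : (fgnT n H).PosDef := by
    refine PosDef.of_dotProduct_mulVec_pos (fgnT_isHermitian n H) fun x hx => ?_
    have h := qForm_fgnT_pos hH hx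
    simpa [qForm, dotProduct, mulVec, Finset.mul_sum, mul_assoc] using h
  exact ⟨hpos, hpos.isUnit, hpos.det_pos⟩
end
end
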